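/- arXiv:2204.11347 — 8 statements merged into one kernel-verified Lean document; each statement's English description precedes it below -/
import Mathlib

section
/- Let H₁ and H₂ be real symmetric 2×2 matrices. Let K be the unique real symmetric 2×2 matrix such that ⟨Kζ, ζ⟩ = det(ζ₁H₁ + ζ₂H₂) for all ζ = (ζ₁, ζ₂) ∈ ℝ², and let B be the unique real symmetric 2×2 matrix such that ⟨Bζ, ζ⟩ = det(M(ζ)) for all ζ ∈ ℝ², where M(ζ) is the 2×2 matrix whose first column is H₁ζ and whose second column is H₂ζ. Then det B = det K. Consequently, min_{ζ∈S¹}|⟨Kζ,ζ⟩| > 0 if and only if det(M(h)) ≠ 0 for every h ∈ ℝ² \ {0}. -/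
open Matrix

lemma mulVec_dotProduct_fin_two (A : Matrix (Fin 2) (Fin 2) ℝ) (hA : A.IsSymm) (h : Fin 2 → ℝ) :
    A.mulVec h ⬝ᵥ h = A 0 0 * h 0 ^ 2 + 2 * A 0 1 * h 0 * h 1 + A 1 1 * h 1 ^ 2 := by
  have h10 : A 1 0 = A 0 1 := hA.apply 0 1
  simp only [dotProduct, mulVec, Fin.sum_univ_two, h10]
  ring

lemma det_eq_of_isSymm_fin_two (A : Matrix (Fin 2) (Fin 2) ℝ) (hA : A.IsSymm) :
    A.det = A 0 0 * A 1 1 - A 0 1 ^ 2 := by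
  rw [det_fin_two, hA.apply 0 1]
  ring

/-- A real binary quadratic form is anisotropic iff its determinant is positive. -/
lemma forall_quadForm_ne_zero_iff_det_pos (A : Matrix (Fin 2) (Fin 2) ℝ) (hA : A.IsSymm) :
    (∀ h : Fin 2 → ℝ, h ≠ 0 → A.mulVec h ⬝ᵥ h ≠ 0) ↔ 0 < A.det := by
  simp only [mulVec_dotProduct_fin_two A hA, det_eq_of_isSymm_fin_two A hA]
  constructor
  · intro H
    by_contra! hdet
    by_cases h00 : A 0 0 = 0
    · refine H ![1, 0] (fun h => one_ne_zero (congrFun h 0)) ?_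
      simp [h00]
    · refine H ![-A 0 1 + √(A 0 1 ^ 2 - A 0 0 * A 1 1), A 0 0] (fun h => h00 (congrFun h 1)) ?_
      have hs := Real.sq_sqrt (show 0 ≤ A 0 1 ^ 2 - A 0 0 * A 1 1 by linarith)
      simp only [cons_val_zero, cons_val_one]
      linear_combination A 0 0 * hs
  · intro hdet h hne hq
    have hsq : (A 0 0 * h 0 + A 0 1 * h 1) ^ 2 + (A 0 0 * A 1 1 - A 0 1 ^ 2) * h 1 ^ 2 = 0 := by
      linear_combination A 0 0 * hq
    have h1 : h 1 = 0 := by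
      by_contra h1
      have := mul_pos hdet (pow_pos (abs_pos.2 h1) 2)
      rw [sq_abs] at this
      nlinarith [sq_nonneg (A 0 0 * h 0 + A 0 1 * h 1)]
    have h00 : A 0 0 ≠ 0 := by
      intro h00
      rw [h00] at hdet
      nlinarith [sq_nonneg (A 0 1)]
    have h0 : h 0 = 0 := by simpa [h1, h00] using hq
    exact hne (by ext i; fin_cases i <;> simp [h0, h1])

/-- On the unit circle, the Cayley–Hamilton identity gives `det A ≤ tr A * ⟨A ζ, ζ⟩`. -/
lemma det_le_trace_mul_quadForm (A : Matrix (Fin 2) (Fin 2) ℝ) (hA : A.IsSymm) (ζ : Fin 2 → ℝ)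
    (hζ : ζ 0 ^ 2 + ζ 1 ^ 2 = 1) : A.det ≤ A.trace * (A.mulVec ζ ⬝ᵥ ζ) := by
  rw [mulVec_dotProduct_fin_two A hA, det_eq_of_isSymm_fin_two A hA, trace_fin_two]
  have key : (A 0 0 + A 1 1) * (A 0 0 * ζ 0 ^ 2 + 2 * A 0 1 * ζ 0 * ζ 1 + A 1 1 * ζ 1 ^ 2)
      - (A 0 0 * A 1 1 - A 0 1 ^ 2)
      = (A 0 0 * ζ 0 + A 0 1 * ζ 1) ^ 2 + (A 0 1 * ζ 0 + A 1 1 * ζ 1) ^ 2 := by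
    linear_combination (A 0 0 * A 1 1 - A 0 1 ^ 2) * hζ
  nlinarith [sq_nonneg (A 0 0 * ζ 0 + A 0 1 * ζ 1), sq_nonneg (A 0 1 * ζ 0 + A 1 1 * ζ 1)]

lemma sInf_abs_quadForm_pos_iff_det_pos (A : Matrix (Fin 2) (Fin 2) ℝ) (hA : A.IsSymm) :
    0 < sInf {r : ℝ | ∃ ζ : Fin 2 → ℝ, ζ 0 ^ 2 + ζ 1 ^ 2 = 1 ∧ r = |A.mulVec ζ ⬝ᵥ ζ|} ↔
      0 < A.det := by
  constructor
  · intro hpos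
    rw [← forall_quadForm_ne_zero_iff_det_pos A hA]
    intro h hne hq
    have hs : 0 < h 0 ^ 2 + h 1 ^ 2 := by
      by_contra! hle
      have h0 : h 0 = 0 := by nlinarith [sq_nonneg (h 0), sq_nonneg (h 1)]
      have h1 : h 1 = 0 := by nlinarith [sq_nonneg (h 0), sq_nonneg (h 1)]
      exact hne (by ext i; fin_cases i <;> simp [h0, h1])
    refine hpos.not_ge (csInf_le ⟨0, ?_⟩ ⟨(√(h 0 ^ 2 + h 1 ^ 2))⁻¹ • h, ?_, ?_⟩)
    · rintro r ⟨ζ, -, rfl⟩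
      exact abs_nonneg _
    · simp only [Pi.smul_apply, smul_eq_mul, mul_pow, inv_pow, Real.sq_sqrt hs.le]
      rw [← mul_add, inv_mul_cancel₀ hs.ne']
    · rw [mulVec_smul, smul_dotProduct, dotProduct_smul, hq, smul_zero, smul_zero, abs_zero]
  · intro hdet
    have htr : 0 < |A.trace| := by
      rw [abs_pos]
      intro h
      have := det_le_trace_mul_quadForm A hA ![1, 0] (by simp)
      rw [h, zero_mul] at this
      exact hdet.not_ge this
    refine (div_pos hdet htr).trans_le (le_csInf ⟨_, ![1, 0], by simp, rfl⟩ ?_)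
    rintro r ⟨ζ, hζ, rfl⟩
    rw [div_le_iff₀' htr, ← abs_mul]
    exact (det_le_trace_mul_quadForm A hA ζ hζ).trans (le_abs_self _)

/-- If `K` is the symmetric matrix of the quadratic form `ζ ↦ det(ζ₁H₁ + ζ₂H₂)` and
`B` is the symmetric matrix of the quadratic form `ζ ↦ det(M(ζ))`, where `M(ζ)` has
columns `H₁ζ` and `H₂ζ`, then `det B = det K`; consequently
`min_{ζ∈S¹}|⟨Kζ,ζ⟩| > 0` iff `det(M(h)) ≠ 0` for all `h ≠ 0`. -/
theorem stmt_1 (H₁ H₂ K B : Matrix (Fin 2) (Fin 2) ℝ)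
    (hH₁ : H₁.IsSymm) (hH₂ : H₂.IsSymm) (hK : K.IsSymm) (hB : B.IsSymm)
    (M : (Fin 2 → ℝ) → Matrix (Fin 2) (Fin 2) ℝ)
    (hM : ∀ ζ : Fin 2 → ℝ, ∀ i : Fin 2, M ζ i 0 = H₁.mulVec ζ i ∧ M ζ i 1 = H₂.mulVec ζ i)
    (hKq : ∀ ζ : Fin 2 → ℝ, K.mulVec ζ ⬝ᵥ ζ = (ζ 0 • H₁ + ζ 1 • H₂).det)
    (hBq : ∀ ζ : Fin 2 → ℝ, B.mulVec ζ ⬝ᵥ ζ = (M ζ).det) :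
    B.det = K.det ∧
    (0 < sInf {r : ℝ | ∃ ζ : Fin 2 → ℝ, ζ 0 ^ 2 + ζ 1 ^ 2 = 1 ∧ r = |K.mulVec ζ ⬝ᵥ ζ|} ↔
      ∀ h : Fin 2 → ℝ, h ≠ 0 → (M h).det ≠ 0) := by
  have hdet : B.det = K.det := by
    have hK' := fun x y : ℝ => hKq ![x, y]
    have hB' := fun x y : ℝ => hBq ![x, y]
    simp only [det_fin_two, (hM _ _).1, (hM _ _).2, mulVec, dotProduct, Fin.sum_univ_two,
      Matrix.add_apply, Matrix.smul_apply, smul_eq_mul, cons_val_zero, cons_val_one, hH₁.apply 0 1, hH₂.apply 0 1,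
      hK.apply 0 1, hB.apply 0 1] at hK' hB'
    have k00 : K 0 0 = H₁ 0 0 * H₁ 1 1 - H₁ 0 1 ^ 2 := by linear_combination hK' 1 0
    have k11 : K 1 1 = H₂ 0 0 * H₂ 1 1 - H₂ 0 1 ^ 2 := by linear_combination hK' 0 1
    have k01 : K 0 1 = (H₁ 0 0 * H₂ 1 1 + H₁ 1 1 * H₂ 0 0 - 2 * H₁ 0 1 * H₂ 0 1) / 2 := by
      linear_combination (hK' 1 1 - hK' 1 0 - hK' 0 1) / 2
    have b00 : B 0 0 = H₁ 0 0 * H₂ 0 1 - H₁ 0 1 * H₂ 0 0 := by linear_combination hB' 1 0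
    have b11 : B 1 1 = H₁ 0 1 * H₂ 1 1 - H₁ 1 1 * H₂ 0 1 := by linear_combination hB' 0 1
    have b01 : B 0 1 = (H₁ 0 0 * H₂ 1 1 - H₁ 1 1 * H₂ 0 0) / 2 := by
      linear_combination (hB' 1 1 - hB' 1 0 - hB' 0 1) / 2
    rw [det_eq_of_isSymm_fin_two K hK, det_eq_of_isSymm_fin_two B hB, k00, k11, k01, b00, b11, b01]
    ring
  refine ⟨hdet, ?_⟩
  rw [sInf_abs_quadForm_pos_iff_det_pos K hK, ← hdet, ← forall_quadForm_ne_zero_iff_det_pos B hB]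
  simp only [hBq]
end

section
/- There exist two functions Λ₁, Λ₂ : V^{a,b} → ℝ which are real analytic on V^{a,b}, homogeneous of degree β = 2(m − α₁ − α₂) with respect to the dilations (i.e., Λᵢ(t∙x) = t^β Λᵢ(x) for all x ∈ V^{a,b}, t > 0, i = 1,2), and such that for every x ∈ V^{a,b} the multiset {Λ₁(x), Λ₂(x)} is exactly the set of eigenvalues (with multiplicity) of the symmetric matrix K(x). -/
open MeasureTheory Real Set
open scoped ENNReal

noncomputable section

/-- Nonisotropic dilation `t ∙ x = (t^{α₁} x₁, t^{α₂} x₂)` (for `t > 0`). -/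
def dil (α₁ α₂ t : ℝ) (x : Fin 2 → ℝ) : Fin 2 → ℝ :=
  ![t ^ α₁ * x 0, t ^ α₂ * x 1]

/-- The region `V^{a,b} = { t ∙ (1,s) : s ∈ (a,b), t > 0 }`. -/
def Vab (α₁ α₂ a b : ℝ) : Set (Fin 2 → ℝ) :=
  {x | ∃ s t : ℝ, a < s ∧ s < b ∧ 0 < t ∧ x = dil α₁ α₂ t ![1, s]}

/-- The region `V₁^{c,d} = { t ∙ (1,s) : s ∈ (c,d), 0 < t < 1 }`. -/
def V1 (α₁ α₂ c d : ℝ) : Set (Fin 2 → ℝ) :=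
  {x | ∃ s t : ℝ, c < s ∧ s < d ∧ 0 < t ∧ t < 1 ∧ x = dil α₁ α₂ t ![1, s]}

/-- Membership in the unit circle `S¹ ⊂ ℝ²`. -/
def onS1 (ζ : Fin 2 → ℝ) : Prop := ζ 0 ^ 2 + ζ 1 ^ 2 = 1

/-- The standard inner product on `ℝ²`. -/
def dot2 (u v : Fin 2 → ℝ) : ℝ := u 0 * v 0 + u 1 * v 1

/-- Hessian matrix of second partial derivatives of `f` at `x`. -/
def Hess (f : (Fin 2 → ℝ) → ℝ) (x : Fin 2 → ℝ) : Matrix (Fin 2) (Fin 2) ℝ :=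
  Matrix.of fun i j => fderiv ℝ (fun y => fderiv ℝ f y (Pi.single j 1)) x (Pi.single i 1)

/-- The form `Q_x(ζ) = det (ζ₁ Hess φ₁(x) + ζ₂ Hess φ₂(x))`. -/
def Qform (φ : (Fin 2 → ℝ) → Fin 2 → ℝ) (x ζ : Fin 2 → ℝ) : ℝ :=
  (ζ 0 • Hess (fun y => φ y 0) x + ζ 1 • Hess (fun y => φ y 1) x).det

/-- `x` is an elliptic point for `φ`: `min_{ζ ∈ S¹} |Q_x(ζ)| > 0`. -/
def Elliptic (φ : (Fin 2 → ℝ) → Fin 2 → ℝ) (x : Fin 2 → ℝ) : Prop :=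
  ∃ ε : ℝ, 0 < ε ∧ ∀ ζ : Fin 2 → ℝ, onS1 ζ → ε ≤ |Qform φ x ζ|

/-- The symmetric matrix `K(x)` associated with the quadratic form `Q_x`,
i.e. the matrix with entries `k₁₁ = det Hess φ₁`, `k₂₂ = det Hess φ₂`,
`k₁₂ = k₂₁ = ½(∂₁₁φ₁ ∂₂₂φ₂ + ∂₂₂φ₁ ∂₁₁φ₂ − 2 ∂₁₂φ₁ ∂₁₂φ₂)`, which satisfies
`Q_x(ζ) = ⟨K(x)ζ, ζ⟩`. -/
def Kmat (φ : (Fin 2 → ℝ) → Fin 2 → ℝ) (x : Fin 2 → ℝ) : Matrix (Fin 2) (Fin 2) ℝ :=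
  Matrix.of
    ![![(Hess (fun y => φ y 0) x).det,
        ((Hess (fun y => φ y 0) x) 0 0 * (Hess (fun y => φ y 1) x) 1 1
          + (Hess (fun y => φ y 0) x) 1 1 * (Hess (fun y => φ y 1) x) 0 0
          - 2 * (Hess (fun y => φ y 0) x) 0 1 * (Hess (fun y => φ y 1) x) 0 1) / 2],
      ![((Hess (fun y => φ y 0) x) 0 0 * (Hess (fun y => φ y 1) x) 1 1
          + (Hess (fun y => φ y 0) x) 1 1 * (Hess (fun y => φ y 1) x) 0 0
          - 2 * (Hess (fun y => φ y 0) x) 0 1 * (Hess (fun y => φ y 1) x) 0 1) / 2,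
        (Hess (fun y => φ y 1) x).det]]

/-- The function `G(ζ,s) = ⟨φ(1,s), ζ⟩`. -/
def Gfun (φ : (Fin 2 → ℝ) → Fin 2 → ℝ) (ζ : Fin 2 → ℝ) (s : ℝ) : ℝ :=
  dot2 (φ ![1, s]) ζ

/-- The standard inner product on `ℝ⁴`. -/
def dot4 (u v : Fin 4 → ℝ) : ℝ := u 0 * v 0 + u 1 * v 1 + u 2 * v 2 + u 3 * v 3

/-- The graph map `x ↦ (x, φ(x)) ∈ ℝ⁴`. -/
def graphMap (φ : (Fin 2 → ℝ) → Fin 2 → ℝ) (x : Fin 2 → ℝ) : Fin 4 → ℝ :=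
  ![x 0, x 1, φ x 0, φ x 1]

/-- The Fourier transform on `ℝ⁴`, `ĝ(ξ) = ∫ e^{-i⟨x,ξ⟩} g(x) dx`. -/
def ftrans (g : (Fin 4 → ℝ) → ℂ) (ξ : Fin 4 → ℝ) : ℂ :=
  ∫ x : Fin 4 → ℝ, Complex.exp (-Complex.I * (dot4 x ξ : ℂ)) * g x

/-- The Fourier transform of the measure `μ`,
`μ̂(ξ) = ∫_{V₁^{c,d}} e^{-i⟨(x,φ(x)),ξ⟩} dx`. -/
def muHat (α₁ α₂ c d : ℝ) (φ : (Fin 2 → ℝ) → Fin 2 → ℝ) (ξ : Fin 4 → ℝ) : ℂ :=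
  ∫ x in V1 α₁ α₂ c d, Complex.exp (-Complex.I * (dot4 (graphMap φ x) ξ : ℂ))

/-- Convolution with the measure `μ`: `(μ ∗ g)(y) = ∫_{V₁^{c,d}} g(y − (x, φ(x))) dx`. -/
def muConv (α₁ α₂ c d : ℝ) (φ : (Fin 2 → ℝ) → Fin 2 → ℝ) (g : (Fin 4 → ℝ) → ℂ)
    (y : Fin 4 → ℝ) : ℂ :=
  ∫ x in V1 α₁ α₂ c d, g (y - graphMap φ x)


/-- The function `H(ζ,s)` of Remark 2.4 / Statement 19, built from `G(ζ,s) = ⟨φ(1,s),ζ⟩`. -/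
def Hfun (α₁ α₂ m : ℝ) (φ : (Fin 2 → ℝ) → Fin 2 → ℝ) (ζ : Fin 2 → ℝ) (s : ℝ) : ℝ :=
  m * (m - α₁) * Gfun φ ζ s * deriv (deriv (Gfun φ ζ)) s
    + α₂ * (α₁ - α₂) * s * deriv (Gfun φ ζ) s * deriv (deriv (Gfun φ ζ)) s
    - (m - α₂) ^ 2 * (deriv (Gfun φ ζ) s) ^ 2

open Filter Topology

/-- The parity sign of the number of points of `O` between `x` and `y`. -/
def crossingSign (O : Set ℝ) (x y : ℝ) : ℝ := (-1) ^ (O ∩ uIoc x y).ncard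

lemma crossingSign_comm (O : Set ℝ) (x y : ℝ) : crossingSign O x y = crossingSign O y x := by
  rw [crossingSign, crossingSign, uIoc_comm]

lemma crossingSign_sq (O : Set ℝ) (x y : ℝ) : crossingSign O x y ^ 2 = 1 := by
  rw [crossingSign, ← pow_mul, mul_comm, pow_mul, neg_one_sq, one_pow]

lemma crossingSign_mul_of_le {O : Set ℝ} {x y z : ℝ} (hxy : x ≤ y) (hyz : y ≤ z)
    (hO : (O ∩ uIoc x z).Finite) :
    crossingSign O x z = crossingSign O x y * crossingSign O y z := by
  simp only [crossingSign, uIoc_of_le hxy, uIoc_of_le hyz, uIoc_of_le (hxy.trans hyz)] at hO ⊢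
  rw [← Ioc_union_Ioc_eq_Ioc hxy hyz, inter_union_distrib_left] at hO ⊢
  rw [Set.ncard_union_eq _ (hO.subset subset_union_left) (hO.subset subset_union_right), pow_add]
  exact ((Ioc_disjoint_Ioc_of_le le_rfl).mono inter_subset_right inter_subset_right)

lemma crossingSign_mul {O I : Set ℝ} (hO : ∀ x ∈ I, ∀ y ∈ I, (O ∩ uIoc x y).Finite)
    {x y z : ℝ} (hx : x ∈ I) (hy : y ∈ I) (hz : z ∈ I) :
    crossingSign O x z = crossingSign O x y * crossingSign O y z := by
  have split : ∀ u ∈ I, ∀ v ∈ I, ∀ w ∈ I, u ≤ v → v ≤ w →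
      crossingSign O u w = crossingSign O u v * crossingSign O v w :=
    fun u hu v _ w hw huv hvw => crossingSign_mul_of_le huv hvw (hO u hu w hw)
  have sqxy := crossingSign_sq O x y
  have sqyz := crossingSign_sq O y z
  have sqxz := crossingSign_sq O x z
  have cxy := crossingSign_comm O x y
  have cyz := crossingSign_comm O y z
  have cxz := crossingSign_comm O x z
  rcases le_total x y with h1 | h1 <;> rcases le_total y z with h2 | h2 <;>
    rcases le_total x z with h3 | h3
  · exact split x hx y hy z hz h1 h2
  · exact split x hx y hy z hz h1 h2
  · have := split x hx z hz y hy h3 h2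
    grind
  · have := split z hz x hx y hy h3 h1
    grind
  · have := split y hy x hx z hz h1 h3
    grind
  · have := split y hy z hz x hx h2 h3
    grind
  · have := split z hz y hy x hx h2 h1
    grind
  · have := split z hz y hy x hx h2 h1
    grind

lemma finite_inter_uIoc {O I : Set ℝ} (hI : I.OrdConnected)
    (hO : ∀ z ∈ I, ∀ᶠ s in 𝓝[≠] z, s ∉ O) {x y : ℝ} (hx : x ∈ I) (hy : y ∈ I) :
    (O ∩ uIoc x y).Finite := by
  by_contra h
  obtain ⟨z, hz, hacc⟩ := Set.Infinite.exists_accPt_of_subset_isCompact h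
    (isCompact_uIcc (a := x) (b := y)) (inter_subset_right.trans uIoc_subset_uIcc)
  rw [accPt_iff_frequently_nhdsNE] at hacc
  exact hacc ((hO z (hI.uIcc_subset hx hy hz)).mono fun s hs hs' => hs hs'.1)

open Classical in
lemma eventually_crossingSign {O : Set ℝ} {z : ℝ} (hO : ∀ᶠ s in 𝓝[≠] z, s ∉ O) :
    ∀ᶠ s in 𝓝 z, crossingSign O z s = if s < z ∧ z ∈ O then -1 else 1 := by
  rw [eventually_nhdsWithin_iff, Metric.eventually_nhds_iff_ball] at hO
  obtain ⟨r, hr, hO⟩ := hO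
  filter_upwards [Metric.ball_mem_nhds z hr] with s hs
  have sub : O ∩ uIoc z s ⊆ {z} := by
    rintro w ⟨hw, hws⟩
    by_contra hne
    refine hO w ?_ hne hw
    exact ((convex_ball z r).ordConnected.uIcc_subset (Metric.mem_ball_self hr) hs)
      (uIoc_subset_uIcc hws)
  split_ifs with h
  · have : O ∩ uIoc z s = {z} := by
      refine sub.antisymm (singleton_subset_iff.2 ⟨h.2, ?_⟩)
      rw [uIoc_of_ge h.1.le]
      exact ⟨h.1, le_rfl⟩
    rw [crossingSign, this, ncard_singleton, pow_one]
  · have : O ∩ uIoc z s = ∅ := by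
      refine eq_empty_of_forall_notMem fun w hw => ?_
      obtain rfl : w = z := sub hw
      rw [mem_inter_iff, mem_uIoc] at hw
      rcases hw with ⟨hw, h' | h'⟩
      · exact lt_irrefl _ h'.1
      · exact h ⟨h'.1, hw⟩
    rw [crossingSign, this, ncard_empty, pow_zero]

lemma AnalyticAt.real_sqrt {E : Type*} [NormedAddCommGroup E] [NormedSpace ℝ E] {f : E → ℝ} {x : E}
    (hf : AnalyticAt ℝ f x) (hx : f x ≠ 0) : AnalyticAt ℝ (fun y => √(f y)) x :=
  (hf.contDiffAt.sqrt hx).analyticAt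

lemma AnalyticAt.real_rpow_const {E : Type*} [NormedAddCommGroup E] [NormedSpace ℝ E] {f : E → ℝ}
    {x : E} (hf : AnalyticAt ℝ f x) (hx : f x ≠ 0) (p : ℝ) : AnalyticAt ℝ (fun y => f y ^ p) x :=
  (hf.contDiffAt.rpow_const_of_ne hx).analyticAt

/-- Near a zero of finite order, the square root of a nonnegative analytic function is
`|s - z| ^ k` times an analytic function. -/
lemma AnalyticAt.exists_sqrt_eq_abs_pow_mul {D : ℝ → ℝ} {z : ℝ} (hD : AnalyticAt ℝ D z)
    (hpos : ∀ᶠ s in 𝓝 z, 0 ≤ D s) (hne : ¬ ∀ᶠ s in 𝓝 z, D s = 0) :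
    ∃ (k : ℕ) (h : ℝ → ℝ), AnalyticAt ℝ h z ∧ ∀ᶠ s in 𝓝 z, √(D s) = |s - z| ^ k * h s := by
  obtain ⟨n, g, hg, hgz, hDg⟩ := hD.exists_eventuallyEq_pow_smul_nonzero_iff.2 hne
  have hg0 : 0 ≤ g z := by
    refine ge_of_tendsto (hg.continuousAt.tendsto.mono_left nhdsWithin_le_nhds :
      Tendsto g (𝓝[>] z) (𝓝 (g z))) ?_
    filter_upwards [nhdsWithin_le_nhds hDg, nhdsWithin_le_nhds hpos, self_mem_nhdsWithin]
      with s h1 h2 h3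
    rw [h1, smul_eq_mul] at h2
    exact nonneg_of_mul_nonneg_right h2 (pow_pos (sub_pos.2 h3) n)
  have hn : Even n := by
    by_contra hodd
    rw [Nat.not_even_iff_odd] at hodd
    refine hgz (le_antisymm ?_ hg0)
    refine le_of_tendsto (hg.continuousAt.tendsto.mono_left nhdsWithin_le_nhds :
      Tendsto g (𝓝[<] z) (𝓝 (g z))) ?_
    filter_upwards [nhdsWithin_le_nhds hDg, nhdsWithin_le_nhds hpos, self_mem_nhdsWithin]
      with s h1 h2 h3
    rw [h1, smul_eq_mul] at h2
    by_contra! h4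
    exact absurd h2 (mul_neg_of_neg_of_pos (hodd.pow_neg (sub_neg.2 h3)) h4).not_ge
  obtain ⟨k, rfl⟩ := hn
  refine ⟨k, fun s => √(g s), hg.real_sqrt hgz, ?_⟩
  filter_upwards [hDg] with s hs
  rw [hs, smul_eq_mul, ← two_mul, mul_comm 2 k, pow_mul, Real.sqrt_mul (sq_nonneg _),
    Real.sqrt_sq_eq_abs, abs_pow]

/-- A nonnegative real analytic function on an interval has a real analytic square root. -/
lemma AnalyticOnNhd.exists_sq_eq {D : ℝ → ℝ} {I : Set ℝ} (hIo : IsOpen I) (hI : I.OrdConnected)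
    (hD : AnalyticOnNhd ℝ D I) (hpos : ∀ s ∈ I, 0 ≤ D s) :
    ∃ δ : ℝ → ℝ, AnalyticOnNhd ℝ δ I ∧ ∀ s ∈ I, δ s ^ 2 = D s := by
  by_cases hzero : ∃ z ∈ I, ∃ᶠ s in 𝓝[≠] z, D s = 0
  · obtain ⟨z, hz, hfreq⟩ := hzero
    have hD0 := hD.eqOn_zero_of_preconnected_of_frequently_eq_zero hI.isPreconnected hz hfreq
    exact ⟨0, analyticOnNhd_const, fun s hs => by simp [hD0 hs]⟩
  push Not at hzero
  rcases I.eq_empty_or_nonempty with rfl | ⟨s₀, hs₀⟩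
  · exact ⟨0, fun _ h => h.elim, fun _ h => h.elim⟩
  set O : Set ℝ := {z | ¬ AnalyticAt ℝ (fun s => √(D s)) z}
  have hO : ∀ z ∈ I, ∀ᶠ s in 𝓝[≠] z, s ∉ O := by
    intro z hz
    filter_upwards [hzero z hz, nhdsWithin_le_nhds (hIo.mem_nhds hz)] with s hs hsI
    exact not_not.2 ((hD s hsI).real_sqrt hs)
  have hfin : ∀ x ∈ I, ∀ y ∈ I, (O ∩ uIoc x y).Finite :=
    fun x hx y hy => finite_inter_uIoc hI hO hx hy
  refine ⟨fun s => crossingSign O s₀ s * √(D s), fun z hz => ?_, fun s hs => ?_⟩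
  · suffices h : AnalyticAt ℝ (fun s => crossingSign O z s * √(D s)) z by
      refine (analyticAt_const.mul h : AnalyticAt ℝ
        (fun s => crossingSign O s₀ z * (crossingSign O z s * √(D s))) z).congr ?_
      filter_upwards [hIo.mem_nhds hz] with s hs
      simp only [Pi.mul_apply, crossingSign_mul hfin hs₀ hz hs, mul_assoc]
    have hsign := eventually_crossingSign (hO z hz)
    by_cases hzO : z ∈ O
    · obtain ⟨k, h, hh, hk⟩ := (hD z hz).exists_sqrt_eq_abs_pow_mul
        (eventually_of_mem (hIo.mem_nhds hz) hpos)
        (fun h => (((h.filter_mono nhdsWithin_le_nhds).and (hzero z hz)).exists).elim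
          fun s hs => hs.2 hs.1)
      have hpoly : AnalyticAt ℝ (fun s => (s - z) ^ k * h s) z := by fun_prop
      have hodd : Odd k := by
        rw [← Nat.not_even_iff_odd]
        intro heven
        refine hzO (hpoly.congr ?_)
        filter_upwards [hk] with s hs
        rw [hs, heven.pow_abs]
      refine hpoly.congr ?_
      filter_upwards [hk, hsign] with s h1 h2
      rw [h1, h2]
      split_ifs with hc
      · rw [abs_of_neg (sub_neg.2 hc.1), hodd.neg_pow]
        ring
      · have : z ≤ s := not_lt.1 fun h => hc ⟨h, hzO⟩
        rw [abs_of_nonneg (sub_nonneg.2 this), one_mul]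
    · refine (not_not.1 hzO).congr ?_
      filter_upwards [hsign] with s hs
      rw [hs, if_neg (fun h => hzO h.2), one_mul]
  · rw [mul_pow, crossingSign_sq, one_mul, Real.sq_sqrt (hpos s hs)]

lemma dil_zero_apply (α₁ α₂ t : ℝ) (x : Fin 2 → ℝ) : dil α₁ α₂ t x 0 = t ^ α₁ * x 0 := rfl

lemma dil_one_apply (α₁ α₂ t : ℝ) (x : Fin 2 → ℝ) : dil α₁ α₂ t x 1 = t ^ α₂ * x 1 := rfl

/-- The radial coordinate `r` of `x = r ∙ (1, s)`. -/
def dilRadius (α₁ : ℝ) (x : Fin 2 → ℝ) : ℝ := x 0 ^ α₁⁻¹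

/-- The slope coordinate `s` of `x = r ∙ (1, s)`. -/
def dilSlope (α₁ α₂ : ℝ) (x : Fin 2 → ℝ) : ℝ := x 0 ^ (-(α₂ / α₁)) * x 1

lemma dilRadius_dil {α₁ : ℝ} (hα₁ : α₁ ≠ 0) (α₂ : ℝ) {t : ℝ} (ht : 0 < t) {x : Fin 2 → ℝ}
    (hx : 0 < x 0) : dilRadius α₁ (dil α₁ α₂ t x) = t * dilRadius α₁ x := by
  rw [dilRadius, dilRadius, dil_zero_apply, Real.mul_rpow (Real.rpow_nonneg ht.le _) hx.le,
    ← Real.rpow_mul ht.le, mul_inv_cancel₀ hα₁, Real.rpow_one]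

lemma dilSlope_dil {α₁ : ℝ} (hα₁ : α₁ ≠ 0) (α₂ : ℝ) {t : ℝ} (ht : 0 < t) {x : Fin 2 → ℝ}
    (hx : 0 < x 0) : dilSlope α₁ α₂ (dil α₁ α₂ t x) = dilSlope α₁ α₂ x := by
  rw [dilSlope, dilSlope, dil_zero_apply, dil_one_apply,
    Real.mul_rpow (Real.rpow_nonneg ht.le _) hx.le, ← Real.rpow_mul ht.le,
    show α₁ * -(α₂ / α₁) = -α₂ by field_simp, Real.rpow_neg ht.le]
  have := (Real.rpow_pos_of_pos ht α₂).ne'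
  field_simp

lemma dilRadius_pos (α₁ : ℝ) {x : Fin 2 → ℝ} (hx : 0 < x 0) : 0 < dilRadius α₁ x :=
  Real.rpow_pos_of_pos hx _

lemma dil_dilRadius_dilSlope {α₁ : ℝ} (hα₁ : α₁ ≠ 0) (α₂ : ℝ) {x : Fin 2 → ℝ} (hx : 0 < x 0) :
    dil α₁ α₂ (dilRadius α₁ x) ![1, dilSlope α₁ α₂ x] = x := by
  ext i
  fin_cases i
  · simp [dil_zero_apply, dilRadius, ← Real.rpow_mul hx.le, hα₁]
  · simp only [Fin.mk_one, dil_one_apply, dilRadius, dilSlope, ← Real.rpow_mul hx.le,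
      Matrix.cons_val_one, Matrix.cons_val_fin_one, ← mul_assoc, ← Real.rpow_add hx]
    rw [show α₁⁻¹ * α₂ + -(α₂ / α₁) = 0 by field_simp; ring, Real.rpow_zero, one_mul]

lemma mem_Vab_iff {α₁ : ℝ} (hα₁ : α₁ ≠ 0) {α₂ a b : ℝ} {x : Fin 2 → ℝ} :
    x ∈ Vab α₁ α₂ a b ↔ 0 < x 0 ∧ dilSlope α₁ α₂ x ∈ Ioo a b := by
  constructor
  · rintro ⟨s, t, has, hsb, ht, rfl⟩
    rw [dilSlope_dil hα₁ α₂ ht (by simp)]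
    simpa [dil_zero_apply, dilSlope, has, hsb] using Real.rpow_pos_of_pos ht α₁
  · rintro ⟨hx, hs⟩
    exact ⟨_, _, hs.1, hs.2, dilRadius_pos α₁ hx, (dil_dilRadius_dilSlope hα₁ α₂ hx).symm⟩

lemma cons_one_mem_Vab (α₁ α₂ : ℝ) {a b s : ℝ} (hs : s ∈ Ioo a b) :
    ![1, s] ∈ Vab α₁ α₂ a b :=
  ⟨s, 1, hs.1, hs.2, one_pos, by simp [dil]⟩

lemma dil_mem_Vab {α₁ : ℝ} (hα₁ : α₁ ≠ 0) {α₂ a b t : ℝ} (ht : 0 < t) {x : Fin 2 → ℝ}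
    (hx : x ∈ Vab α₁ α₂ a b) : dil α₁ α₂ t x ∈ Vab α₁ α₂ a b := by
  rw [mem_Vab_iff hα₁] at hx ⊢
  rw [dilSlope_dil hα₁ α₂ ht hx.1]
  exact ⟨mul_pos (Real.rpow_pos_of_pos ht _) hx.1, hx.2⟩

lemma analyticAt_coord (i : Fin 2) (x : Fin 2 → ℝ) : AnalyticAt ℝ (fun y : Fin 2 → ℝ => y i) x :=
  (ContinuousLinearMap.proj (R := ℝ) (φ := fun _ : Fin 2 => ℝ) i).analyticAt x

lemma analyticAt_dilRadius (α₁ : ℝ) {x : Fin 2 → ℝ} (hx : 0 < x 0) :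
    AnalyticAt ℝ (dilRadius α₁) x :=
  (analyticAt_coord 0 x).real_rpow_const hx.ne' _

lemma analyticAt_dilSlope (α₁ α₂ : ℝ) {x : Fin 2 → ℝ} (hx : 0 < x 0) :
    AnalyticAt ℝ (dilSlope α₁ α₂) x :=
  ((analyticAt_coord 0 x).real_rpow_const hx.ne' _).mul (analyticAt_coord 1 x)

lemma isOpen_Vab {α₁ : ℝ} (hα₁ : α₁ ≠ 0) (α₂ a b : ℝ) : IsOpen (Vab α₁ α₂ a b) := by
  rw [isOpen_iff_mem_nhds]
  intro x hx
  rw [mem_Vab_iff hα₁] at hx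
  filter_upwards [(analyticAt_coord 0 x).continuousAt.eventually_mem (Ioi_mem_nhds hx.1),
    (analyticAt_dilSlope α₁ α₂ hx.1).continuousAt.eventually_mem (isOpen_Ioo.mem_nhds hx.2)]
    with y h1 h2
  exact (mem_Vab_iff hα₁).2 ⟨h1, h2⟩

/-- The dilation by `t` as a continuous linear map. -/
def dilCLM (α₁ α₂ t : ℝ) : (Fin 2 → ℝ) →L[ℝ] (Fin 2 → ℝ) :=
  (Matrix.toLin' (Matrix.diagonal ![t ^ α₁, t ^ α₂])).toContinuousLinearMap

lemma dilCLM_apply (α₁ α₂ t : ℝ) (x : Fin 2 → ℝ) : dilCLM α₁ α₂ t x = dil α₁ α₂ t x := by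
  ext i
  fin_cases i <;> simp [dilCLM, dil, Matrix.mulVec_diagonal]

/-- A partial derivative of a function homogeneous of degree `m` is homogeneous of degree
`m - αⱼ`. -/
lemma fderiv_single_dil {α₁ : ℝ} (hα₁ : α₁ ≠ 0) {α₂ a b c t : ℝ} (ht : 0 < t)
    {f : (Fin 2 → ℝ) → ℝ} (hf : AnalyticOnNhd ℝ f (Vab α₁ α₂ a b))
    (hom : ∀ x ∈ Vab α₁ α₂ a b, f (dil α₁ α₂ t x) = t ^ c * f x) (j : Fin 2)
    {x : Fin 2 → ℝ} (hx : x ∈ Vab α₁ α₂ a b) :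
    fderiv ℝ f (dil α₁ α₂ t x) (Pi.single j 1)
      = t ^ (c - ![α₁, α₂] j) * fderiv ℝ f x (Pi.single j 1) := by
  have hfx := (hf x hx).differentiableAt
  have hfy : DifferentiableAt ℝ f (dilCLM α₁ α₂ t x) := by
    rw [dilCLM_apply]
    exact (hf _ (dil_mem_Vab hα₁ ht hx)).differentiableAt
  have hev : (f ∘ dilCLM α₁ α₂ t) =ᶠ[𝓝 x] fun y => t ^ c * f y := by
    filter_upwards [(isOpen_Vab hα₁ α₂ a b).mem_nhds hx] with y hy
    rw [Function.comp_apply, dilCLM_apply, hom y hy]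
  have key := congrArg (fun A : (Fin 2 → ℝ) →L[ℝ] ℝ => A (Pi.single j 1)) hev.fderiv_eq
  have hsingle : dil α₁ α₂ t (Pi.single j 1) = t ^ (![α₁, α₂] j) • Pi.single j (1 : ℝ) := by
    ext i
    fin_cases i <;> fin_cases j <;> simp [dil]
  simp only [fderiv_comp x hfy (dilCLM α₁ α₂ t).differentiableAt, ContinuousLinearMap.fderiv,
    fderiv_const_mul hfx, ContinuousLinearMap.comp_apply, dilCLM_apply, hsingle, map_smul,
    _root_.smul_apply, smul_eq_mul] at key
  rw [Real.rpow_sub ht, div_mul_eq_mul_div, eq_div_iff (Real.rpow_pos_of_pos ht _).ne', ← key,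
    mul_comm]

lemma AnalyticOnNhd.fderiv_single {f : (Fin 2 → ℝ) → ℝ} {V : Set (Fin 2 → ℝ)}
    (hf : AnalyticOnNhd ℝ f V) (j : Fin 2) :
    AnalyticOnNhd ℝ (fun y => fderiv ℝ f y (Pi.single j 1)) V :=
  fun x hx => ((ContinuousLinearMap.apply ℝ ℝ (Pi.single j 1 : Fin 2 → ℝ)).analyticAt
    (fderiv ℝ f x)).comp (hf.fderiv x hx)

lemma analyticOnNhd_Hess {f : (Fin 2 → ℝ) → ℝ} {V : Set (Fin 2 → ℝ)}
    (hf : AnalyticOnNhd ℝ f V) (i j : Fin 2) : AnalyticOnNhd ℝ (fun x => Hess f x i j) V :=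
  (hf.fderiv_single j).fderiv_single i

lemma Hess_dil {α₁ : ℝ} (hα₁ : α₁ ≠ 0) {α₂ a b c t : ℝ} (ht : 0 < t)
    {f : (Fin 2 → ℝ) → ℝ} (hf : AnalyticOnNhd ℝ f (Vab α₁ α₂ a b))
    (hom : ∀ x ∈ Vab α₁ α₂ a b, f (dil α₁ α₂ t x) = t ^ c * f x) (i j : Fin 2)
    {x : Fin 2 → ℝ} (hx : x ∈ Vab α₁ α₂ a b) :
    Hess f (dil α₁ α₂ t x) i j = t ^ (c - ![α₁, α₂] j - ![α₁, α₂] i) * Hess f x i j :=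
  fderiv_single_dil hα₁ ht (hf.fderiv_single j)
    (fun _ hy => fderiv_single_dil hα₁ ht hf hom j hy) i hx

lemma analyticOnNhd_Kmat {φ : (Fin 2 → ℝ) → Fin 2 → ℝ} {V : Set (Fin 2 → ℝ)}
    (hφ : AnalyticOnNhd ℝ φ V) (i j : Fin 2) : AnalyticOnNhd ℝ (fun x => Kmat φ x i j) V := by
  intro x hx
  have hcomp (k : Fin 2) : AnalyticOnNhd ℝ (fun y => φ y k) V :=
    fun y hy => (analyticAt_coord k (φ y)).comp (hφ y hy)
  have h (k i j : Fin 2) := analyticOnNhd_Hess (hcomp k) i j x hx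
  have h0 := h 0
  have h1 := h 1
  fin_cases i <;> fin_cases j <;>
    simp only [Kmat, Matrix.det_fin_two, Matrix.of_apply, Fin.zero_eta, Fin.mk_one,
      Matrix.cons_val_zero, Matrix.cons_val_one, Matrix.cons_val_fin_one] <;>
    fun_prop (disch := norm_num)

lemma Kmat_dil {α₁ : ℝ} (hα₁ : α₁ ≠ 0) {α₂ a b m t : ℝ} (ht : 0 < t)
    {φ : (Fin 2 → ℝ) → Fin 2 → ℝ} (hφ : AnalyticOnNhd ℝ φ (Vab α₁ α₂ a b))
    (hom : ∀ x ∈ Vab α₁ α₂ a b, φ (dil α₁ α₂ t x) = t ^ m • φ x)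
    {x : Fin 2 → ℝ} (hx : x ∈ Vab α₁ α₂ a b) :
    Kmat φ (dil α₁ α₂ t x) = t ^ (2 * (m - α₁ - α₂)) • Kmat φ x := by
  have hcomp (k : Fin 2) : AnalyticOnNhd ℝ (fun y => φ y k) (Vab α₁ α₂ a b) :=
    fun y hy => (analyticAt_coord k (φ y)).comp (hφ y hy)
  have h (k i j : Fin 2) := Hess_dil hα₁ ht (hcomp k)
    (fun y hy => by rw [hom y hy, Pi.smul_apply, smul_eq_mul]) i j hx
  have e1 : t ^ (m - α₁ - α₁) * t ^ (m - α₂ - α₂) = t ^ (2 * (m - α₁ - α₂)) := by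
    rw [← Real.rpow_add ht]
    ring_nf
  have e2 : t ^ (m - α₁ - α₂) * t ^ (m - α₂ - α₁) = t ^ (2 * (m - α₁ - α₂)) := by
    rw [← Real.rpow_add ht]
    ring_nf
  have e3 : t ^ (m - α₂ - α₁) * t ^ (m - α₂ - α₁) = t ^ (2 * (m - α₁ - α₂)) := by
    rw [← Real.rpow_add ht]
    ring_nf
  ext i j
  fin_cases i <;> fin_cases j <;>
    simp [Kmat, Matrix.det_fin_two, h] <;> grind

/-- Existence of two real-analytic functions `Λ₁, Λ₂` on `V^{a,b}`, homogeneous of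
degree `β = 2(m − α₁ − α₂)`, whose values at each `x` are the eigenvalues (with
multiplicity) of the symmetric matrix `K(x)`. -/
theorem stmt_2 (α₁ α₂ m a b : ℝ) (φ : (Fin 2 → ℝ) → Fin 2 → ℝ)
    (hα₁ : 0 < α₁) (hα₂ : 0 < α₂) (hαne : α₁ ≠ α₂) (hab : a < b)
    (hm : 3 * (α₁ + α₂) ≤ m)
    (H1 : AnalyticOnNhd ℝ φ (Vab α₁ α₂ a b))
    (H2 : ∀ x ∈ Vab α₁ α₂ a b, ∀ t : ℝ, 0 < t → φ (dil α₁ α₂ t x) = t ^ m • φ x) :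
    ∃ Λ₁ Λ₂ : (Fin 2 → ℝ) → ℝ,
      AnalyticOnNhd ℝ Λ₁ (Vab α₁ α₂ a b) ∧ AnalyticOnNhd ℝ Λ₂ (Vab α₁ α₂ a b) ∧
      (∀ x ∈ Vab α₁ α₂ a b, ∀ t : ℝ, 0 < t →
        Λ₁ (dil α₁ α₂ t x) = t ^ (2 * (m - α₁ - α₂)) * Λ₁ x ∧
        Λ₂ (dil α₁ α₂ t x) = t ^ (2 * (m - α₁ - α₂)) * Λ₂ x) ∧
      (∀ x ∈ Vab α₁ α₂ a b,
        Λ₁ x + Λ₂ x = (Kmat φ x).trace ∧ Λ₁ x * Λ₂ x = (Kmat φ x).det) := by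
  have hα₁' := hα₁.ne'
  set V := Vab α₁ α₂ a b
  set β := 2 * (m - α₁ - α₂)
  have hK := analyticOnNhd_Kmat H1
  have hKdil : ∀ x ∈ V, ∀ t : ℝ, 0 < t → Kmat φ (dil α₁ α₂ t x) = t ^ β • Kmat φ x :=
    fun x hx t ht => Kmat_dil hα₁' ht H1 (fun y hy => H2 y hy t ht) hx
  set disc : (Fin 2 → ℝ) → ℝ :=
    fun x => (Kmat φ x 0 0 - Kmat φ x 1 1) ^ 2 + 4 * Kmat φ x 0 1 ^ 2 with hdisc
  have hsymm (x : Fin 2 → ℝ) : Kmat φ x 1 0 = Kmat φ x 0 1 := rfl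
  have hD : AnalyticOnNhd ℝ (fun s => disc ![1, s]) (Ioo a b) := by
    intro s hs
    have hx := cons_one_mem_Vab α₁ α₂ hs
    have h00 := hK 0 0 _ hx
    have h01 := hK 0 1 _ hx
    have h11 := hK 1 1 _ hx
    have hd : AnalyticAt ℝ disc ![1, s] := by fun_prop
    refine AnalyticAt.comp (f := fun s : ℝ => ![1, s]) hd ?_
    rw [analyticAt_pi_iff]
    intro i
    fin_cases i
    · exact analyticAt_const
    · exact analyticAt_id
  obtain ⟨δ, hδ, hδsq⟩ := hD.exists_sq_eq isOpen_Ioo ordConnected_Ioo fun s _ => by positivity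
  set ρ : (Fin 2 → ℝ) → ℝ := fun x => dilRadius α₁ x ^ β * δ (dilSlope α₁ α₂ x) with hρ
  have hρan : AnalyticOnNhd ℝ ρ V := by
    intro x hx
    obtain ⟨hx0, hxs⟩ := (mem_Vab_iff hα₁').1 hx
    exact ((analyticAt_dilRadius α₁ hx0).real_rpow_const (dilRadius_pos α₁ hx0).ne' β).mul
      ((hδ _ hxs).comp (analyticAt_dilSlope α₁ α₂ hx0))
  have hρdil : ∀ x ∈ V, ∀ t : ℝ, 0 < t → ρ (dil α₁ α₂ t x) = t ^ β * ρ x := by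
    intro x hx t ht
    have hx0 := ((mem_Vab_iff hα₁').1 hx).1
    simp only [hρ, dilRadius_dil hα₁' α₂ ht hx0, dilSlope_dil hα₁' α₂ ht hx0,
      Real.mul_rpow ht.le (dilRadius_pos α₁ hx0).le, mul_assoc]
  have hρsq : ∀ x ∈ V, ρ x ^ 2 = disc x := by
    intro x hx
    obtain ⟨hx0, hxs⟩ := (mem_Vab_iff hα₁').1 hx
    have h := hKdil _ (cons_one_mem_Vab α₁ α₂ hxs) _ (dilRadius_pos α₁ hx0)
    rw [dil_dilRadius_dilSlope hα₁' α₂ hx0] at h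
    simp only [hρ, mul_pow, hδsq _ hxs, hdisc, h, Matrix.smul_apply, smul_eq_mul]
    ring
  refine ⟨fun x => (Kmat φ x 0 0 + Kmat φ x 1 1 + ρ x) / 2,
    fun x => (Kmat φ x 0 0 + Kmat φ x 1 1 - ρ x) / 2, fun x hx => ?_, fun x hx => ?_,
    fun x hx t ht => ?_, fun x hx => ?_⟩
  · exact (((hK 0 0 x hx).add (hK 1 1 x hx)).add (hρan x hx)).div_const
  · exact (((hK 0 0 x hx).add (hK 1 1 x hx)).sub (hρan x hx)).div_const
  · simp only [hKdil x hx t ht, hρdil x hx t ht, Matrix.smul_apply, smul_eq_mul]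
    constructor <;> ring
  · have h := hρsq x hx
    rw [Matrix.trace_fin_two, Matrix.det_fin_two, hsymm]
    simp only [hdisc] at h
    constructor
    · ring
    · linear_combination -h / 4

end
end

section
/- There exist two positive integers n₁ and n₂ and a positive constant D such that for all sufficiently small δ > 0: if σ ∈ (c,d], then min{ |Λᵢ(t∙(1,s))| : i = 1,2 } ≥ D t^β |s − σ|^{n₁} for all s ∈ (σ − δ, σ) and all t > 0; and if σ ∈ [c,d), then min{ |Λᵢ(t∙(1,s))| : i = 1,2 } ≥ D t^β |s − σ|^{n₂} for all s ∈ (σ, σ + δ) and all t > 0. Here β = 2(m − α₁ − α₂). -/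
open MeasureTheory Real Set
open scoped ENNReal

noncomputable section

open Filter Topology in
/-- A real analytic function which is not locally zero at `σ` is bounded below by a power of the
distance to `σ`. -/
lemma AnalyticAt.exists_pow_le_abs {f : ℝ → ℝ} {σ : ℝ} (hf : AnalyticAt ℝ f σ)
    (hne : ∃ᶠ s in 𝓝[≠] σ, f s ≠ 0) :
    ∃ n : ℕ, ∃ C : ℝ, 0 < C ∧ ∀ᶠ s in 𝓝 σ, C * |s - σ| ^ n ≤ |f s| := by
  obtain ⟨n, g, hg, hg0, hfg⟩ := hf.exists_eventuallyEq_pow_smul_nonzero_iff.mpr fun h0 ↦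
    hne ((h0.filter_mono nhdsWithin_le_nhds).mono fun _ hs hs' ↦ hs' hs)
  refine ⟨n, |g σ| / 2, by positivity, ?_⟩
  have hlt : |g σ| / 2 < |g σ| := half_lt_self (abs_pos.mpr hg0)
  filter_upwards [hfg, hg.continuousAt.abs.eventually (lt_mem_nhds hlt)] with s hs hgs
  rw [hs, smul_eq_mul, abs_mul, abs_pow, mul_comm]
  gcongr

/-- The Hessian of an analytic function is symmetric. -/
lemma Hess_symm {f : (Fin 2 → ℝ) → ℝ} {x : Fin 2 → ℝ} (hf : AnalyticAt ℝ f x) (i j : Fin 2) :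
    Hess f x i j = Hess f x j i := by
  have hd : DifferentiableAt ℝ (fderiv ℝ f) x := hf.fderiv.differentiableAt
  have key (v w : Fin 2 → ℝ) :
      fderiv ℝ (fun y ↦ fderiv ℝ f y v) x w = fderiv ℝ (fderiv ℝ f) x w v := by
    rw [fderiv_clm_apply hd (differentiableAt_const v)]
    simp
  have hs : IsSymmSndFDerivAt ℝ f x := hf.contDiffAt.isSymmSndFDerivAt (n := 2) (by simp)
  simp only [Hess, Matrix.of_apply, key]
  exact hs _ _

/-- `Q_x` is the quadratic form of the matrix `K(x)`. -/
lemma Qform_eq {φ : (Fin 2 → ℝ) → Fin 2 → ℝ} {x : Fin 2 → ℝ} (hφ : AnalyticAt ℝ φ x)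
    (ζ : Fin 2 → ℝ) :
    Qform φ x ζ = Kmat φ x 0 0 * ζ 0 ^ 2 + 2 * Kmat φ x 0 1 * ζ 0 * ζ 1
      + Kmat φ x 1 1 * ζ 1 ^ 2 := by
  have hcomp := analyticAt_pi_iff.mp hφ
  have h0 := Hess_symm (hcomp 0) 1 0
  have h1 := Hess_symm (hcomp 1) 1 0
  simp only [Qform, Kmat, Matrix.det_fin_two, Matrix.add_apply, Matrix.smul_apply, smul_eq_mul,
    Matrix.of_apply, Matrix.cons_val_zero, Matrix.cons_val_one, h0, h1]
  ring

/-- At an elliptic point the matrix `K(x)` is nonsingular. -/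
lemma Elliptic.det_Kmat_ne_zero {φ : (Fin 2 → ℝ) → Fin 2 → ℝ} {x : Fin 2 → ℝ}
    (h : Elliptic φ x) (hφ : AnalyticAt ℝ φ x) : (Kmat φ x).det ≠ 0 := by
  intro hdet
  obtain ⟨ε, hε, hQ⟩ := h
  have hsymm : Kmat φ x 1 0 = Kmat φ x 0 1 := rfl
  rw [Matrix.det_fin_two, hsymm] at hdet
  have hzero (ζ : Fin 2 → ℝ) (hζ : onS1 ζ) (h0 : Qform φ x ζ = 0) : False := by
    have := hQ ζ hζ
    rw [h0, abs_zero] at this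
    exact this.not_gt hε
  simp only [Qform_eq hφ, onS1] at hzero
  generalize Kmat φ x 0 0 = p at *
  generalize Kmat φ x 0 1 = q at *
  generalize Kmat φ x 1 1 = r at *
  by_cases hp : p = 0
  · exact hzero ![1, 0] (by simp) (by simp [hp])
  · have hpos : 0 < p ^ 2 + q ^ 2 := by positivity
    have hsq := Real.sq_sqrt hpos.le
    have hρ : √(p ^ 2 + q ^ 2) ≠ 0 := (Real.sqrt_pos.mpr hpos).ne'
    generalize √(p ^ 2 + q ^ 2) = ρ at hsq hρ
    refine hzero ![q / ρ, -p / ρ] ?_ ?_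
    · simp only [Matrix.cons_val_zero, Matrix.cons_val_one]
      field_simp
      linarith
    · simp only [Matrix.cons_val_zero, Matrix.cons_val_one]
      field_simp
      linear_combination p * hdet

lemma dil_one (α₁ α₂ : ℝ) (x : Fin 2 → ℝ) : dil α₁ α₂ 1 x = x := by
  ext i
  fin_cases i <;> simp [dil]

lemma mk_one_mem_Vab (α₁ α₂ : ℝ) {a b s : ℝ} (ha : a < s) (hb : s < b) :
    ![1, s] ∈ Vab α₁ α₂ a b :=
  ⟨s, 1, ha, hb, one_pos, (dil_one _ _ _).symm⟩

/-- A dilate of `(1, σ)` of the form `(1, s)` is `(1, σ)` itself. -/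
lemma eq_of_mk_one_eq_dil {α₁ α₂ s σ t : ℝ} (hα₁ : 0 < α₁) (ht : 0 < t)
    (h : ![1, s] = dil α₁ α₂ t ![1, σ]) : s = σ := by
  have h0 := congrFun h 0
  have h1 := congrFun h 1
  simp only [dil, Matrix.cons_val_zero, Matrix.cons_val_one, mul_one] at h0 h1
  have ht1 : t = 1 := by
    rw [← Real.rpow_left_inj ht.le zero_le_one hα₁.ne', Real.one_rpow, ← h0]
  simpa [ht1] using h1

open Filter Topology in
/-- Every point of a nontrivial closed interval is approached by other points of its interior. -/
lemma frequently_mem_Ioo_of_mem_Icc {c d σ : ℝ} (hcd : c < d) (hσ : σ ∈ Set.Icc c d) :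
    ∃ᶠ s in 𝓝[≠] σ, s ∈ Set.Ioo c d := by
  rcases hσ.2.lt_or_eq with h | rfl
  · have : ∀ᶠ s in 𝓝[>] σ, s ∈ Set.Ioo c d :=
      mem_of_superset (Ioo_mem_nhdsGT h) (Set.Ioo_subset_Ioo_left hσ.1)
    exact this.frequently.filter_mono (nhdsWithin_mono _ fun _ hs ↦ ne_of_gt hs)
  · have : ∀ᶠ s in 𝓝[<] σ, s ∈ Set.Ioo c σ := Ioo_mem_nhdsLT hcd
    exact this.frequently.filter_mono (nhdsWithin_mono _ fun _ hs ↦ ne_of_lt hs)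

lemma analyticAt_mk_one (s : ℝ) : AnalyticAt ℝ (fun s : ℝ ↦ (![1, s] : Fin 2 → ℝ)) s := by
  rw [analyticAt_pi_iff]
  intro i
  fin_cases i
  · exact analyticAt_const
  · exact analyticAt_id

/-- Lower bounds `min|Λᵢ| ≥ D t^β |s−σ|^{nⱼ}` near the nonelliptic curve,
for all sufficiently small `δ > 0`. -/
theorem stmt_3 (α₁ α₂ m a b : ℝ) (φ : (Fin 2 → ℝ) → Fin 2 → ℝ)
    (hα₁ : 0 < α₁) (hα₂ : 0 < α₂) (hαne : α₁ ≠ α₂) (hab : a < b)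
    (hm : 3 * (α₁ + α₂) ≤ m)
    (H1 : AnalyticOnNhd ℝ φ (Vab α₁ α₂ a b))
    (H2 : ∀ x ∈ Vab α₁ α₂ a b, ∀ t : ℝ, 0 < t → φ (dil α₁ α₂ t x) = t ^ m • φ x)
    (c d σ : ℝ) (hac : a < c) (hcd : c < d) (hdb : d < b) (hσ : σ ∈ Set.Icc c d)
    (H3 : {x | x ∈ closure (Vab α₁ α₂ c d) ∧ x ≠ 0 ∧ ¬ Elliptic φ x}
        = {x | ∃ t : ℝ, 0 < t ∧ x = dil α₁ α₂ t ![1, σ]})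
    (Λ₁ Λ₂ : (Fin 2 → ℝ) → ℝ)
    (hΛ₁a : AnalyticOnNhd ℝ Λ₁ (Vab α₁ α₂ a b))
    (hΛ₂a : AnalyticOnNhd ℝ Λ₂ (Vab α₁ α₂ a b))
    (hΛhom : ∀ x ∈ Vab α₁ α₂ a b, ∀ t : ℝ, 0 < t →
      Λ₁ (dil α₁ α₂ t x) = t ^ (2 * (m - α₁ - α₂)) * Λ₁ x ∧
      Λ₂ (dil α₁ α₂ t x) = t ^ (2 * (m - α₁ - α₂)) * Λ₂ x)
    (hΛeig : ∀ x ∈ Vab α₁ α₂ a b,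
      Λ₁ x + Λ₂ x = (Kmat φ x).trace ∧ Λ₁ x * Λ₂ x = (Kmat φ x).det) :
    ∃ n₁ n₂ : ℕ, 0 < n₁ ∧ 0 < n₂ ∧ ∃ D : ℝ, 0 < D ∧ ∃ δ₀ : ℝ, 0 < δ₀ ∧
      ∀ δ : ℝ, 0 < δ → δ ≤ δ₀ →
        (σ ∈ Set.Ioc c d → ∀ s ∈ Set.Ioo (σ - δ) σ, ∀ t : ℝ, 0 < t →
          D * t ^ (2 * (m - α₁ - α₂)) * |s - σ| ^ n₁ ≤
            min |Λ₁ (dil α₁ α₂ t ![1, s])| |Λ₂ (dil α₁ α₂ t ![1, s])|) ∧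
        (σ ∈ Set.Ico c d → ∀ s ∈ Set.Ioo σ (σ + δ), ∀ t : ℝ, 0 < t →
          D * t ^ (2 * (m - α₁ - α₂)) * |s - σ| ^ n₂ ≤
            min |Λ₁ (dil α₁ α₂ t ![1, s])| |Λ₂ (dil α₁ α₂ t ![1, s])|) := by
  have hmem {s : ℝ} (hs : s ∈ Set.Ioo c d) : ![1, s] ∈ Vab α₁ α₂ a b :=
    mk_one_mem_Vab _ _ (hac.trans hs.1) (hs.2.trans hdb)
  have hprod {s : ℝ} (hs : s ∈ Set.Ioo c d) (hsσ : s ≠ σ) : Λ₁ ![1, s] * Λ₂ ![1, s] ≠ 0 := by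
    rw [(hΛeig _ (hmem hs)).2]
    refine Elliptic.det_Kmat_ne_zero ?_ (H1 _ (hmem hs))
    by_contra hell
    have hx : ![1, s] ∈ {x | x ∈ closure (Vab α₁ α₂ c d) ∧ x ≠ 0 ∧ ¬ Elliptic φ x} :=
      ⟨subset_closure (mk_one_mem_Vab _ _ hs.1 hs.2), fun h ↦ one_ne_zero (congrFun h 0), hell⟩
    rw [H3] at hx
    obtain ⟨t, ht, h⟩ := hx
    exact hsσ (eq_of_mk_one_eq_dil hα₁ ht h)
  have hfreq := (frequently_mem_Ioo_of_mem_Icc hcd hσ).and_eventually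
    (self_mem_nhdsWithin : ∀ᶠ s in nhdsWithin σ {σ}ᶜ, s ∈ ({σ}ᶜ : Set ℝ))
  have hσV : ![1, σ] ∈ Vab α₁ α₂ a b :=
    mk_one_mem_Vab _ _ (hac.trans_le hσ.1) (hσ.2.trans_lt hdb)
  have hexp (Λ : (Fin 2 → ℝ) → ℝ) (hΛ : AnalyticAt ℝ Λ ![1, σ])
      (hne : ∀ s ∈ Set.Ioo c d, s ≠ σ → Λ ![1, s] ≠ 0) :
      ∃ n : ℕ, ∃ C : ℝ, 0 < C ∧ ∀ᶠ s in nhds σ, C * |s - σ| ^ n ≤ |Λ ![1, s]| :=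
    AnalyticAt.exists_pow_le_abs (f := fun s ↦ Λ ![1, s])
      (AnalyticAt.fun_comp (f := fun s : ℝ ↦ (![1, s] : Fin 2 → ℝ)) hΛ (analyticAt_mk_one σ))
      (hfreq.mono fun s hs ↦ hne s hs.1 hs.2)
  obtain ⟨n, C, hC, hn⟩ := hexp Λ₁ (hΛ₁a _ hσV) fun s hs hsσ ↦ left_ne_zero_of_mul (hprod hs hsσ)
  obtain ⟨k, E, hE, hk⟩ := hexp Λ₂ (hΛ₂a _ hσV) fun s hs hsσ ↦ right_ne_zero_of_mul (hprod hs hsσ)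
  have hV : ∀ᶠ s in nhds σ, ![1, s] ∈ Vab α₁ α₂ a b :=
    Filter.mem_of_superset (Ioo_mem_nhds (hac.trans_le hσ.1) (hσ.2.trans_lt hdb))
      fun s hs ↦ mk_one_mem_Vab _ _ hs.1 hs.2
  obtain ⟨δ₀, hδ₀, hball⟩ := Metric.eventually_nhds_iff.mp
    ((hn.and hk).and (hV.and (Metric.ball_mem_nhds σ one_pos)))
  have hbound {s : ℝ} (hs : |s - σ| < δ₀) {t : ℝ} (ht : 0 < t) :
      min C E * t ^ (2 * (m - α₁ - α₂)) * |s - σ| ^ (n + k + 1) ≤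
        min |Λ₁ (dil α₁ α₂ t ![1, s])| |Λ₂ (dil α₁ α₂ t ![1, s])| := by
    obtain ⟨⟨h1, h2⟩, hsV, hs1⟩ := hball (by rwa [Real.dist_eq])
    have hs1 : |s - σ| ≤ 1 := by
      rw [← Real.dist_eq]
      exact (Metric.mem_ball.mp hs1).le
    have hT : 0 < t ^ (2 * (m - α₁ - α₂)) := Real.rpow_pos_of_pos ht _
    rw [(hΛhom _ hsV t ht).1, (hΛhom _ hsV t ht).2, abs_mul, abs_mul, abs_of_pos hT,
      mul_comm (min C E), mul_assoc]
    refine le_min (mul_le_mul_of_nonneg_left (le_trans ?_ h1) hT.le)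
      (mul_le_mul_of_nonneg_left (le_trans ?_ h2) hT.le)
    · exact mul_le_mul (min_le_left _ _) (pow_le_pow_of_le_one (abs_nonneg _) hs1 (by omega))
        (by positivity) hC.le
    · exact mul_le_mul (min_le_right _ _) (pow_le_pow_of_le_one (abs_nonneg _) hs1 (by omega))
        (by positivity) hE.le
  refine ⟨n + k + 1, n + k + 1, by omega, by omega, min C E, lt_min hC hE, δ₀, hδ₀,
    fun δ _ hδ ↦ ⟨fun _ s hs t ht ↦ hbound ?_ ht, fun _ s hs t ht ↦ hbound ?_ ht⟩⟩ <;>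
  · rw [abs_lt]
    constructor <;> linarith [hs.1, hs.2]

end
end

section
/- Let α₁, α₂ > 0 with α₁ ≠ α₂ and let m ≥ 3(α₁ + α₂). Then there exists a positive constant C, depending only on α₁, α₂, m, such that for all A₁, A₂, A₃ ∈ ℝ with A₃ ≠ 0: | ∫₀¹ e^{−i(A₁ t^{α₁} + A₂ t^{α₂} + A₃ t^{m})} t^{α₁+α₂−1} dt | ≤ C |A₃|^{−(α₁+α₂)/m}. -/
open MeasureTheory Real

/-- First-derivative van der Corput estimate on an interval where the derivative `f` of the phase
is bounded away from zero and monotone. -/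
lemma norm_integral_exp_le_of_abs_deriv_ge {φ f f' : ℝ → ℝ} {x y δ : ℝ} (hxy : x ≤ y)
    (hδ : 0 < δ) (hφ : ∀ v ∈ Set.Icc x y, HasDerivAt φ (f v) v)
    (hf : ∀ v ∈ Set.Icc x y, HasDerivAt f (f' v) v) (hf' : ContinuousOn f' (Set.Icc x y))
    (hlow : ∀ v ∈ Set.Icc x y, δ ≤ |f v|)
    (hs : (∀ v ∈ Set.Icc x y, 0 ≤ f' v) ∨ (∀ v ∈ Set.Icc x y, f' v ≤ 0)) :
    ‖∫ v in x..y, Complex.exp (Complex.I * (φ v : ℂ))‖ ≤ 4 / δ := by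
  have hne : ∀ v ∈ Set.Icc x y, f v ≠ 0 := fun v hv h0 => by
    have := hlow v hv
    rw [h0, abs_zero] at this
    linarith
  have hfc : ContinuousOn f (Set.Icc x y) := fun v hv => (hf v hv).continuousAt.continuousWithinAt
  have hφc : ContinuousOn φ (Set.Icc x y) :=
    fun v hv => (hφ v hv).continuousAt.continuousWithinAt
  have huIcc : Set.uIcc x y = Set.Icc x y := Set.uIcc_of_le hxy
  have hrc : ContinuousOn (fun v => -f' v / f v ^ 2) (Set.Icc x y) :=
    hf'.neg.div (hfc.pow 2) fun v hv => pow_ne_zero 2 (hne v hv)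
  have hri : IntervalIntegrable (fun v => -f' v / f v ^ 2) volume x y :=
    ContinuousOn.intervalIntegrable (huIcc ▸ hrc)
  have hinv : ∀ v ∈ Set.Icc x y, HasDerivAt (fun v => (f v)⁻¹) (-f' v / f v ^ 2) v :=
    fun v hv => (hf v hv).inv (hne v hv)
  have hu : ∀ v ∈ Set.uIcc x y, HasDerivAt (fun v => -Complex.I * (((f v)⁻¹ : ℝ) : ℂ))
      (-Complex.I * ((-f' v / f v ^ 2 : ℝ) : ℂ)) v :=
    fun v hv => ((hinv v (huIcc ▸ hv)).ofReal_comp).const_mul _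
  have hv : ∀ v ∈ Set.uIcc x y, HasDerivAt (fun v => Complex.exp (Complex.I * (φ v : ℂ)))
      (Complex.exp (Complex.I * (φ v : ℂ)) * (Complex.I * (f v : ℂ))) v :=
    fun v hv => (((hφ v (huIcc ▸ hv)).ofReal_comp).const_mul _).cexp
  have hexp : ContinuousOn (fun v => Complex.exp (Complex.I * (φ v : ℂ))) (Set.Icc x y) := by
    fun_prop
  have key := intervalIntegral.integral_mul_deriv_eq_deriv_mul hu hv
    (ContinuousOn.intervalIntegrable (huIcc ▸ by fun_prop))
    (ContinuousOn.intervalIntegrable (huIcc ▸ by fun_prop))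
  have hleft : ∫ v in x..y, Complex.exp (Complex.I * (φ v : ℂ)) =
      ∫ v in x..y, -Complex.I * (((f v)⁻¹ : ℝ) : ℂ) *
        (Complex.exp (Complex.I * (φ v : ℂ)) * (Complex.I * (f v : ℂ))) := by
    refine intervalIntegral.integral_congr fun v hv => ?_
    have h0 : (f v : ℂ) ≠ 0 := by exact_mod_cast hne v (huIcc ▸ hv)
    push_cast
    field_simp
    simp
  have hnexp : ∀ v, ‖Complex.exp (Complex.I * (φ v : ℂ))‖ = 1 := fun v => by
    rw [mul_comm]; exact Complex.norm_exp_ofReal_mul_I _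
  have hbd : ∀ v ∈ Set.Icc x y, |(f v)⁻¹| ≤ 1 / δ := fun v hv => by
    rw [abs_inv, inv_eq_one_div]
    exact one_div_le_one_div_of_le hδ (hlow v hv)
  have hx := hbd x (Set.left_mem_Icc.2 hxy)
  have hy := hbd y (Set.right_mem_Icc.2 hxy)
  have hftc : ∫ v in x..y, -f' v / f v ^ 2 = (f y)⁻¹ - (f x)⁻¹ :=
    intervalIntegral.integral_eq_sub_of_hasDerivAt (fun v hv => hinv v (huIcc ▸ hv)) hri
  have hvar : ∫ v in x..y, |-f' v / f v ^ 2| ≤ 2 / δ := by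
    have h2 : (2 : ℝ) / δ = 1 / δ + 1 / δ := by ring
    rcases hs with hs | hs
    · have : ∫ v in x..y, |-f' v / f v ^ 2| = -∫ v in x..y, -f' v / f v ^ 2 := by
        rw [← intervalIntegral.integral_neg]
        refine intervalIntegral.integral_congr fun v hv => abs_of_nonpos ?_
        exact div_nonpos_of_nonpos_of_nonneg (neg_nonpos.2 (hs v (huIcc ▸ hv))) (sq_nonneg _)
      rw [this, hftc, h2]
      linarith [(abs_le.1 hx).2, (abs_le.1 hy).1]
    · have : ∫ v in x..y, |-f' v / f v ^ 2| = ∫ v in x..y, -f' v / f v ^ 2 := by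
        refine intervalIntegral.integral_congr fun v hv => abs_of_nonneg ?_
        exact div_nonneg (neg_nonneg.2 (hs v (huIcc ▸ hv))) (sq_nonneg _)
      rw [this, hftc, h2]
      linarith [(abs_le.1 hx).1, (abs_le.1 hy).2]
  have hrest : ‖∫ v in x..y, -Complex.I * ((-f' v / f v ^ 2 : ℝ) : ℂ) *
      Complex.exp (Complex.I * (φ v : ℂ))‖ ≤ 2 / δ := by
    refine (intervalIntegral.norm_integral_le_integral_norm hxy).trans (le_trans (le_of_eq ?_) hvar)
    refine intervalIntegral.integral_congr fun v _ => ?_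
    simp only [norm_mul, hnexp, norm_neg, Complex.norm_I, one_mul, mul_one, Complex.norm_real,
      Real.norm_eq_abs]
  have hbdry : ∀ v ∈ Set.Icc x y, ‖-Complex.I * (((f v)⁻¹ : ℝ) : ℂ) *
      Complex.exp (Complex.I * (φ v : ℂ))‖ ≤ 1 / δ := fun v hv => by
    simp only [norm_mul, hnexp, norm_neg, Complex.norm_I, one_mul, mul_one, Complex.norm_real,
      Real.norm_eq_abs]
    exact hbd v hv
  rw [hleft, key]
  calc _ ≤ 1 / δ + 1 / δ + 2 / δ :=
        (norm_sub_le _ _).trans (add_le_add ((norm_sub_le _ _).trans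
          (add_le_add (hbdry y (Set.right_mem_Icc.2 hxy)) (hbdry x (Set.left_mem_Icc.2 hxy))))
          hrest)
    _ = 4 / δ := by ring

lemma norm_integral_le_of_norm_le_one {F : ℝ → ℂ} (hF1 : ∀ v, ‖F v‖ ≤ 1) {x y : ℝ}
    (hxy : x ≤ y) : ‖∫ v in x..y, F v‖ ≤ y - x := by
  have := intervalIntegral.norm_integral_le_of_norm_le_const (a := x) (b := y) (f := F) (C := 1)
    fun v _ => hF1 v
  rwa [one_mul, abs_of_nonneg (sub_nonneg.2 hxy)] at this

/-- Removing a neighbourhood of radius `δ` of a point from the domain of integration. -/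
lemma norm_integral_le_of_excise {F : ℝ → ℂ} (hF : Continuous F) (hF1 : ∀ v, ‖F v‖ ≤ 1)
    {x y z δ K : ℝ} (hz : z ∈ Set.Icc x y) (hδ : 0 ≤ δ) (hK : 0 ≤ K)
    (hl : x < z - δ → ‖∫ v in x..(z - δ), F v‖ ≤ K)
    (hr : z + δ < y → ‖∫ v in (z + δ)..y, F v‖ ≤ K) :
    ‖∫ v in x..y, F v‖ ≤ 2 * K + 2 * δ := by
  obtain ⟨hxz, hzy⟩ := hz
  have hint : ∀ a b, IntervalIntegrable F volume a b := fun a b => hF.intervalIntegrable a b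
  have hL : ‖∫ v in x..z, F v‖ ≤ K + δ := by
    rcases lt_or_ge x (z - δ) with h | h
    · rw [← intervalIntegral.integral_add_adjacent_intervals (hint x (z - δ)) (hint (z - δ) z)]
      refine (norm_add_le _ _).trans (add_le_add (hl h) ?_)
      exact (norm_integral_le_of_norm_le_one hF1 (by linarith)).trans (by linarith)
    · exact (norm_integral_le_of_norm_le_one hF1 hxz).trans (by linarith)
  have hR : ‖∫ v in z..y, F v‖ ≤ K + δ := by
    rcases lt_or_ge (z + δ) y with h | h
    · rw [← intervalIntegral.integral_add_adjacent_intervals (hint z (z + δ)) (hint (z + δ) y)]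
      refine (norm_add_le _ _).trans ?_
      have := norm_integral_le_of_norm_le_one hF1 (x := z) (y := z + δ) (by linarith)
      linarith [hr h]
    · exact (norm_integral_le_of_norm_le_one hF1 hzy).trans (by linarith)
  rw [← intervalIntegral.integral_add_adjacent_intervals (hint x z) (hint z y)]
  exact (norm_add_le _ _).trans (by linarith)

lemma exists_sign_change {h : ℝ → ℝ} {x y : ℝ} (hxy : x ≤ y) (hc : ContinuousOn h (Set.Icc x y)) :
    ∃ z ∈ Set.Icc x y, (x < z → h z ≤ 0) ∧ (z < y → 0 ≤ h z) := by
  rcases le_total 0 (h x) with hx | hx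
  · exact ⟨x, Set.left_mem_Icc.2 hxy, fun h => absurd h (lt_irrefl _), fun _ => hx⟩
  rcases le_total (h y) 0 with hy | hy
  · exact ⟨y, Set.right_mem_Icc.2 hxy, fun _ => hy, fun h => absurd h (lt_irrefl _)⟩
  obtain ⟨z, hz, h0⟩ := intermediate_value_Icc hxy hc ⟨hx, hy⟩
  exact ⟨z, hz, fun _ => h0.le, fun _ => h0.ge⟩

/-- If `h` is monotone, an integral over an interval is controlled by integrals over subintervals
on which `h` has constant sign. -/
lemma norm_integral_le_of_monotoneOn {F : ℝ → ℂ} (hF : Continuous F) (hF1 : ∀ v, ‖F v‖ ≤ 1)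
    {h : ℝ → ℝ} {x y K : ℝ} (hxy : x ≤ y) (hK : 0 ≤ K) (hc : ContinuousOn h (Set.Icc x y))
    (hm : MonotoneOn h (Set.Icc x y))
    (hb : ∀ u w, x ≤ u → u ≤ w → w ≤ y →
      ((∀ v ∈ Set.Icc u w, 0 ≤ h v) ∨ (∀ v ∈ Set.Icc u w, h v ≤ 0)) →
      ‖∫ v in u..w, F v‖ ≤ K) :
    ‖∫ v in x..y, F v‖ ≤ 2 * K := by
  obtain ⟨z, hz, hz1, hz2⟩ := exists_sign_change hxy hc
  have := norm_integral_le_of_excise hF hF1 hz le_rfl hK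
    (fun hlt => hb x (z - 0) le_rfl hlt.le (by linarith [hz.2]) (Or.inr fun v hv => by
      rw [sub_zero] at hlt hv
      exact (hm ⟨hv.1, hv.2.trans hz.2⟩ hz hv.2).trans (hz1 hlt)))
    (fun hlt => hb (z + 0) y (by linarith [hz.1]) hlt.le le_rfl (Or.inl fun v hv => by
      rw [add_zero] at hlt hv
      exact (hz2 hlt).trans (hm hz ⟨hz.1.trans hv.1, hv.2⟩ hv.1)))
  linarith

lemma norm_integral_le_of_antitoneOn {F : ℝ → ℂ} (hF : Continuous F) (hF1 : ∀ v, ‖F v‖ ≤ 1)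
    {h : ℝ → ℝ} {x y K : ℝ} (hxy : x ≤ y) (hK : 0 ≤ K) (hc : ContinuousOn h (Set.Icc x y))
    (hm : AntitoneOn h (Set.Icc x y))
    (hb : ∀ u w, x ≤ u → u ≤ w → w ≤ y →
      ((∀ v ∈ Set.Icc u w, 0 ≤ h v) ∨ (∀ v ∈ Set.Icc u w, h v ≤ 0)) →
      ‖∫ v in u..w, F v‖ ≤ K) :
    ‖∫ v in x..y, F v‖ ≤ 2 * K := by
  refine norm_integral_le_of_monotoneOn hF hF1 hxy hK hc.neg hm.neg fun u w hu huw hw hs => ?_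
  refine hb u w hu huw hw (hs.symm.imp (fun h v hv => ?_) (fun h v hv => ?_))
  · exact neg_nonpos.1 (h v hv)
  · exact neg_nonneg.1 (h v hv)

lemma rpow_le_rpow_add_one_sub_rpow_of_add_one_le {q z v : ℝ} (hq : 0 ≤ q) (hz : 0 < z)
    (h : z + 1 ≤ v) : v ^ q ≤ v ^ (q + 1) - z ^ (q + 1) := by
  have hv : 0 < v := by linarith
  rw [rpow_add_one hv.ne', rpow_add_one hz.ne']
  have h1 : z ^ q ≤ v ^ q := rpow_le_rpow hz.le (by linarith) hq
  have h2 : 0 < v ^ q := rpow_pos_of_pos hv q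
  nlinarith

lemma rpow_le_rpow_add_one_sub_rpow_of_le_sub_one {q z v : ℝ} (hq : 0 ≤ q) (hv : 0 < v)
    (h : v + 1 ≤ z) : v ^ q ≤ z ^ (q + 1) - v ^ (q + 1) := by
  have hz : 0 < z := by linarith
  rw [rpow_add_one hv.ne', rpow_add_one hz.ne']
  have h1 : v ^ q ≤ z ^ q := rpow_le_rpow hv.le (by linarith) hq
  have h2 : 0 < v ^ q := rpow_pos_of_pos hv q
  nlinarith

lemma hasDerivAt_const_mul_rpow (c p : ℝ) {v : ℝ} (hv : 0 < v) :
    HasDerivAt (fun v : ℝ => c * v ^ p) (c * (p * v ^ (p - 1))) v :=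
  (Real.hasDerivAt_rpow_const (Or.inl hv.ne')).const_mul c

/-- A function whose derivative is at least `v ^ β` is large away from a single point. -/
lemma exists_forall_rpow_le_abs {G G' : ℝ → ℝ} {β x y : ℝ} (hβ0 : 0 ≤ β) (hβ1 : β ≤ 1)
    (hx : 1 ≤ x) (hxy : x ≤ y) (hG : ∀ v ∈ Set.Icc x y, HasDerivAt G (G' v) v)
    (hlow : ∀ v ∈ Set.Icc x y, v ^ β ≤ G' v) :
    ∃ z ∈ Set.Icc x y, ∀ v ∈ Set.Icc x y, v + 1 ≤ z ∨ z + 1 ≤ v → v ^ β / 2 ≤ |G v| := by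
  have hpos : ∀ v ∈ Set.Icc x y, 0 < v := fun v hv => by linarith [hv.1]
  obtain ⟨z, hz, hz1, hz2⟩ := exists_sign_change hxy
    (fun v hv => (hG v hv).continuousAt.continuousWithinAt)
  have hH : ∀ v ∈ Set.Icc x y, HasDerivAt (fun v => G v - 1 / 2 * v ^ (β + 1))
      (G' v - 1 / 2 * ((β + 1) * v ^ (β + 1 - 1))) v := fun v hv =>
    (hG v hv).sub (hasDerivAt_const_mul_rpow _ _ (hpos v hv))
  have hmono : MonotoneOn (fun v => G v - 1 / 2 * v ^ (β + 1)) (Set.Icc x y) := by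
    refine monotoneOn_of_hasDerivWithinAt_nonneg (convex_Icc x y)
      (fun v hv => (hH v hv).continuousAt.continuousWithinAt)
      (fun v hv => (hH v (interior_subset hv)).hasDerivWithinAt) fun v hv => ?_
    have h1 := hlow v (interior_subset hv)
    have h2 := rpow_pos_of_pos (hpos v (interior_subset hv)) β
    rw [add_sub_cancel_right]
    nlinarith
  refine ⟨z, hz, fun v hv h => ?_⟩
  rcases h with h | h
  · have h1 := hmono hv hz (by linarith)
    have h2 := rpow_le_rpow_add_one_sub_rpow_of_le_sub_one hβ0 (hpos v hv) h
    have h3 := hz1 (by linarith [hv.1])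
    have h4 := neg_le_abs (G v)
    simp only at h1
    linarith
  · have h1 := hmono hz hv (by linarith)
    have h2 := rpow_le_rpow_add_one_sub_rpow_of_add_one_le hβ0 (hpos z hz) h
    have h3 := hz2 (by linarith [hv.2])
    have h4 := le_abs_self (G v)
    simp only at h1
    linarith

/-- The phase `a β⁻¹ v^β + b (1 - β)⁻¹ v^(1 - β) + v^M`. -/
noncomputable def phase (a b β M v : ℝ) : ℝ :=
  a / β * v ^ β + b / (1 - β) * v ^ (1 - β) + 1 * v ^ M

/-- The function `v ^ β` times the derivative of `phase a b β M`. -/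
noncomputable def weightedDeriv (a b β M v : ℝ) : ℝ :=
  a * v ^ (2 * β - 1) + b + M * v ^ (M - 1 + β)

lemma hasDerivAt_phase {a b β M v : ℝ} (hβ0 : 0 < β) (hβ1 : β < 1) (hv : 0 < v) :
    HasDerivAt (phase a b β M) (v ^ (-β) * weightedDeriv a b β M v) v := by
  have h := ((hasDerivAt_const_mul_rpow (a / β) β hv).add
    (hasDerivAt_const_mul_rpow (b / (1 - β)) (1 - β) hv)).add
    (hasDerivAt_const_mul_rpow 1 M hv)
  refine h.congr_deriv ?_
  have h1 : v ^ (β - 1) = v ^ (-β) * v ^ (2 * β - 1) := by rw [← rpow_add hv]; ring_nf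
  have h2 : v ^ (1 - β - 1) = v ^ (-β) := by ring_nf
  have h3 : v ^ (M - 1) = v ^ (-β) * v ^ (M - 1 + β) := by rw [← rpow_add hv]; ring_nf
  have hb : 1 - β ≠ 0 := by linarith
  rw [h1, h2, h3, weightedDeriv]
  field_simp

lemma hasDerivAt_weightedDeriv {a b β M v : ℝ} (hv : 0 < v) :
    HasDerivAt (weightedDeriv a b β M)
      (v ^ (2 * β - 2) * (a * (2 * β - 1) + M * (M - 1 + β) * v ^ (M - β))) v := by
  have h := ((hasDerivAt_const_mul_rpow a (2 * β - 1) hv).add_const b).add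
    (hasDerivAt_const_mul_rpow M (M - 1 + β) hv)
  refine h.congr_deriv ?_
  have h1 : v ^ (2 * β - 1 - 1) = v ^ (2 * β - 2) := by ring_nf
  have h2 : v ^ (M - 1 + β - 1) = v ^ (2 * β - 2) * v ^ (M - β) := by
    rw [← rpow_add hv]; ring_nf
  rw [h1, h2]
  ring

lemma hasDerivAt_rpow_mul_weightedDeriv {a b β M v : ℝ} (hv : 0 < v) :
    HasDerivAt (fun v => v ^ (-β) * weightedDeriv a b β M v)
      (v ^ (β - 2) * (a * (β - 1) + -(b * β) * v ^ (1 - 2 * β) + M * (M - 1) * v ^ (M - β))) v := by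
  have h := (Real.hasDerivAt_rpow_const (p := -β) (Or.inl hv.ne')).mul
    (hasDerivAt_weightedDeriv (a := a) (b := b) (β := β) (M := M) hv)
  refine h.congr_deriv ?_
  have h1 : v ^ (-β - 1) = v ^ (β - 2) * v ^ (1 - 2 * β) := by rw [← rpow_add hv]; ring_nf
  have h2 : v ^ (-β) * v ^ (2 * β - 2) = v ^ (β - 2) := by rw [← rpow_add hv]; ring_nf
  have h3 : v ^ (1 - 2 * β) * v ^ (2 * β - 1) = 1 := by
    rw [← rpow_add hv]; ring_nf; exact rpow_zero v
  have h4 : v ^ (1 - 2 * β) * v ^ (M - 1 + β) = v ^ (M - β) := by rw [← rpow_add hv]; ring_nf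
  rw [h1, weightedDeriv, ← mul_assoc (v ^ (-β)), h2]
  linear_combination (-β * v ^ (β - 2) * a) * h3 - β * v ^ (β - 2) * M * h4

lemma hasDerivAt_second_order_factor {c d e β M v : ℝ} (hv : 0 < v) :
    HasDerivAt (fun v : ℝ => c + d * v ^ (1 - 2 * β) + e * v ^ (M - β))
      (v ^ (-(2 * β)) * (d * (1 - 2 * β) + e * (M - β) * v ^ (M + β - 1))) v := by
  have h := ((hasDerivAt_const_mul_rpow d (1 - 2 * β) hv).const_add c).add
    (hasDerivAt_const_mul_rpow e (M - β) hv)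
  refine h.congr_deriv ?_
  have h1 : v ^ (1 - 2 * β - 1) = v ^ (-(2 * β)) := by ring_nf
  have h2 : v ^ (M - β - 1) = v ^ (-(2 * β)) * v ^ (M + β - 1) := by
    rw [← rpow_add hv]; ring_nf
  rw [h1, h2]
  ring

lemma continuous_phase {a b β M : ℝ} (hβ0 : 0 < β) (hβ1 : β < 1) (hM : 3 ≤ M) :
    Continuous (phase a b β M) := by
  have h1 := Real.continuous_rpow_const hβ0.le
  have h2 := Real.continuous_rpow_const (sub_pos.2 hβ1).le
  have h3 := Real.continuous_rpow_const (q := M) (by linarith)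
  unfold phase
  fun_prop

lemma norm_exp_I_mul_phase (a b β M v : ℝ) :
    ‖Complex.exp (Complex.I * (phase a b β M v : ℂ))‖ = 1 := by
  rw [mul_comm]; exact Complex.norm_exp_ofReal_mul_I _

lemma monotoneOn_const_add_rpow {c d p x y : ℝ} (hd : 0 ≤ d) (hp : 0 ≤ p) (hx : 0 ≤ x) :
    MonotoneOn (fun v : ℝ => c + d * v ^ p) (Set.Icc x y) := fun _ hu _ _ huw =>
  add_le_add le_rfl (mul_le_mul_of_nonneg_left (rpow_le_rpow (hx.trans hu.1) huw hp) hd)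

lemma norm_integral_exp_phase_le_of_abs_deriv_ge {a b β M x y : ℝ} (hβ0 : 0 < β) (hβ1 : β < 1)
    (hM : 3 ≤ M) (hx : 1 ≤ x) (hxy : x ≤ y)
    (hlow : ∀ v ∈ Set.Icc x y, 1 / 2 ≤ |v ^ (-β) * weightedDeriv a b β M v|) :
    ‖∫ v in x..y, Complex.exp (Complex.I * (phase a b β M v : ℂ))‖ ≤ 32 := by
  have hF : Continuous fun v => Complex.exp (Complex.I * (phase a b β M v : ℂ)) := by
    have := continuous_phase (a := a) (b := b) hβ0 hβ1 hM
    fun_prop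
  have hF1 := fun v => (norm_exp_I_mul_phase a b β M v).le
  set h : ℝ → ℝ := fun v => a * (β - 1) + -(b * β) * v ^ (1 - 2 * β) + M * (M - 1) * v ^ (M - β)
    with hh
  set q : ℝ → ℝ := fun v => -(b * β) * (1 - 2 * β) + M * (M - 1) * (M - β) * v ^ (M + β - 1)
    with hq
  have hder : ∀ v, 0 < v → HasDerivAt h (v ^ (-(2 * β)) * q v) v :=
    fun v hv => hasDerivAt_second_order_factor hv
  have hpos : ∀ u, x ≤ u → ∀ w, ∀ v ∈ Set.Icc u w, 0 < v := fun u hu w v hv => by linarith [hv.1]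
  have hcont : ∀ u, x ≤ u → ∀ w, ContinuousOn h (Set.Icc u w) := fun u hu w v hv =>
    (hder v (hpos u hu w v hv)).continuousAt.continuousWithinAt
  have hsign : ∀ u w, x ≤ u → u ≤ w → w ≤ y →
      ((∀ v ∈ Set.Icc u w, 0 ≤ h v) ∨ (∀ v ∈ Set.Icc u w, h v ≤ 0)) →
      ‖∫ v in u..w, Complex.exp (Complex.I * (phase a b β M v : ℂ))‖ ≤ 8 := by
    intro u w hu huw hw hs
    have hp := hpos u hu w
    have := norm_integral_exp_le_of_abs_deriv_ge (φ := phase a b β M)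
      (f' := fun v => v ^ (β - 2) * h v) (δ := 1 / 2) huw (by norm_num)
      (fun v hv => hasDerivAt_phase hβ0 hβ1 (hp v hv))
      (fun v hv => hasDerivAt_rpow_mul_weightedDeriv (hp v hv))
      (ContinuousOn.mul (fun v hv =>
        (Real.continuousAt_rpow_const v _ (Or.inl (hp v hv).ne')).continuousWithinAt)
        (hcont u hu w))
      (fun v hv => hlow v ⟨hu.trans hv.1, hv.2.trans hw⟩)
      (hs.imp (fun h0 v hv => mul_nonneg (rpow_pos_of_pos (hp v hv) _).le (h0 v hv))
        (fun h0 v hv => mul_nonpos_of_nonneg_of_nonpos (rpow_pos_of_pos (hp v hv) _).le (h0 v hv)))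
    norm_num at this ⊢
    exact this
  have hmono : ∀ u w, x ≤ u → u ≤ w → w ≤ y →
      ((∀ v ∈ Set.Icc u w, 0 ≤ q v) ∨ (∀ v ∈ Set.Icc u w, q v ≤ 0)) →
      ‖∫ v in u..w, Complex.exp (Complex.I * (phase a b β M v : ℂ))‖ ≤ 2 * 8 := by
    intro u w hu huw hw hs
    have hp := hpos u hu w
    rcases hs with hs | hs
    · refine norm_integral_le_of_monotoneOn hF hF1 huw (by norm_num) (hcont u hu w)
        (monotoneOn_of_hasDerivWithinAt_nonneg (convex_Icc u w) (hcont u hu w)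
          (fun v hv => (hder v (hp v (interior_subset hv))).hasDerivWithinAt)
          (fun v hv => mul_nonneg (rpow_pos_of_pos (hp v (interior_subset hv)) _).le
            (hs v (interior_subset hv))))
        fun u' w' h1 h2 h3 => hsign u' w' (hu.trans h1) h2 (h3.trans hw)
    · refine norm_integral_le_of_antitoneOn hF hF1 huw (by norm_num) (hcont u hu w)
        (antitoneOn_of_hasDerivWithinAt_nonpos (convex_Icc u w) (hcont u hu w)
          (fun v hv => (hder v (hp v (interior_subset hv))).hasDerivWithinAt)
          (fun v hv => mul_nonpos_of_nonneg_of_nonpos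
            (rpow_pos_of_pos (hp v (interior_subset hv)) _).le (hs v (interior_subset hv))))
        fun u' w' h1 h2 h3 => hsign u' w' (hu.trans h1) h2 (h3.trans hw)
  have hqc : Continuous q := by
    have := Real.continuous_rpow_const (q := M + β - 1) (by linarith)
    fun_prop
  have hcoef : 0 ≤ M * (M - 1) * (M - β) :=
    mul_nonneg (mul_nonneg (by linarith) (by linarith)) (by linarith)
  have := norm_integral_le_of_monotoneOn hF hF1 hxy (by norm_num) hqc.continuousOn
    (monotoneOn_const_add_rpow hcoef (by linarith) (by linarith)) hmono
  norm_num at this ⊢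
  exact this

lemma norm_integral_exp_phase_le_of_weightedDeriv {a b β M x y : ℝ} (hβ0 : 0 < β) (hβ1 : β < 1)
    (hM : 3 ≤ M) (hx : 1 ≤ x) (hxy : x ≤ y) {G' : ℝ → ℝ}
    (hG : ∀ v ∈ Set.Icc x y, HasDerivAt (weightedDeriv a b β M) (G' v) v)
    (hlow : (∀ v ∈ Set.Icc x y, v ^ β ≤ G' v) ∨ (∀ v ∈ Set.Icc x y, v ^ β ≤ -G' v)) :
    ‖∫ v in x..y, Complex.exp (Complex.I * (phase a b β M v : ℂ))‖ ≤ 66 := by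
  have hF : Continuous fun v => Complex.exp (Complex.I * (phase a b β M v : ℂ)) := by
    have := continuous_phase (a := a) (b := b) hβ0 hβ1 hM
    fun_prop
  have hF1 := fun v => (norm_exp_I_mul_phase a b β M v).le
  obtain ⟨z, hz, hfar⟩ : ∃ z ∈ Set.Icc x y, ∀ v ∈ Set.Icc x y, v + 1 ≤ z ∨ z + 1 ≤ v →
      v ^ β / 2 ≤ |weightedDeriv a b β M v| := by
    rcases hlow with hlow | hlow
    · exact exists_forall_rpow_le_abs hβ0.le hβ1.le hx hxy hG hlow
    · obtain ⟨z, hz, h⟩ := exists_forall_rpow_le_abs hβ0.le hβ1.le hx hxy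
        (fun v hv => (hG v hv).neg) hlow
      exact ⟨z, hz, fun v hv hvz => by simpa only [Pi.neg_apply, abs_neg] using h v hv hvz⟩
  have hbig : ∀ v ∈ Set.Icc x y, v + 1 ≤ z ∨ z + 1 ≤ v →
      1 / 2 ≤ |v ^ (-β) * weightedDeriv a b β M v| := fun v hv hvz => by
    have hv0 : 0 < v := by linarith [hv.1]
    have hp := rpow_pos_of_pos hv0 (-β)
    rw [abs_mul, abs_of_pos hp]
    have h1 := mul_le_mul_of_nonneg_left (hfar v hv hvz) hp.le
    have h2 : v ^ (-β) * v ^ β = 1 := by rw [← rpow_add hv0]; simp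
    linarith
  have := norm_integral_le_of_excise hF hF1 hz zero_le_one (K := 32) (by norm_num)
    (fun h => norm_integral_exp_phase_le_of_abs_deriv_ge hβ0 hβ1 hM hx h.le fun v hv =>
      hbig v ⟨hv.1, by linarith [hv.2, hz.2]⟩ (Or.inl (by linarith [hv.2])))
    (fun h => norm_integral_exp_phase_le_of_abs_deriv_ge hβ0 hβ1 hM (by linarith [hz.1]) h.le
      fun v hv => hbig v ⟨by linarith [hv.1, hz.1], hv.2⟩ (Or.inr hv.1))
  norm_num at this ⊢
  exact this

lemma norm_integral_exp_phase_le_of_one_le {a b β M y : ℝ} (hβ0 : 0 < β) (hβ1 : β < 1)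
    (hM : 3 ≤ M) (hy : 1 ≤ y) :
    ‖∫ v in (1 : ℝ)..y, Complex.exp (Complex.I * (phase a b β M v : ℂ))‖ ≤ 134 := by
  have hF : Continuous fun v => Complex.exp (Complex.I * (phase a b β M v : ℂ)) := by
    have := continuous_phase (a := a) (b := b) hβ0 hβ1 hM
    fun_prop
  have hF1 := fun v => (norm_exp_I_mul_phase a b β M v).le
  have hc : Continuous fun v : ℝ => a * (2 * β - 1) + M * (M - 1 + β) * v ^ (M - β) := by
    have := Real.continuous_rpow_const (q := M - β) (by linarith)
    fun_prop
  obtain ⟨z, hz, hz1, hz2⟩ := exists_sign_change hy hc.continuousOn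
  have hcoef : 1 ≤ M * (M - 1 + β) := by nlinarith
  have hexp : M - β = M - β - 1 + 1 := by ring
  have hprod : ∀ v : ℝ, 1 ≤ v → ∀ g, v ^ (M - β - 1) ≤ g → v ^ β ≤ v ^ (2 * β - 2) * g := by
    intro v hv g hg
    have hv0 : 0 < v := by linarith
    calc v ^ β ≤ v ^ (2 * β - 2 + (M - β - 1)) := rpow_le_rpow_of_exponent_le hv (by linarith)
      _ = v ^ (2 * β - 2) * v ^ (M - β - 1) := rpow_add hv0 _ _
      _ ≤ _ := mul_le_mul_of_nonneg_left hg (rpow_pos_of_pos hv0 _).le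
  have := norm_integral_le_of_excise hF hF1 hz zero_le_one (K := 66) (by norm_num)
    (fun h => norm_integral_exp_phase_le_of_weightedDeriv hβ0 hβ1 hM le_rfl h.le
      (fun v hv => hasDerivAt_weightedDeriv (by linarith [hv.1])) (Or.inr fun v hv => by
        rw [← mul_neg]
        refine hprod v hv.1 _ ?_
        have h1 := rpow_le_rpow_add_one_sub_rpow_of_le_sub_one (q := M - β - 1) (z := z) (v := v)
          (by linarith) (by linarith [hv.1]) (by linarith [hv.2])
        rw [← hexp] at h1
        have h2 := hz1 (by linarith)
        have h3 : 0 < v ^ (M - β - 1) := rpow_pos_of_pos (by linarith [hv.1]) _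
        nlinarith))
    (fun h => norm_integral_exp_phase_le_of_weightedDeriv hβ0 hβ1 hM (by linarith [hz.1]) h.le
      (fun v hv => hasDerivAt_weightedDeriv (by linarith [hv.1, hz.1])) (Or.inl fun v hv => by
        refine hprod v (by linarith [hv.1, hz.1]) _ ?_
        have h1 := rpow_le_rpow_add_one_sub_rpow_of_add_one_le (q := M - β - 1) (z := z) (v := v)
          (by linarith) (by linarith [hz.1]) hv.1
        rw [← hexp] at h1
        have h2 := hz2 (by linarith)
        have h3 : 0 < v ^ (M - β - 1) := rpow_pos_of_pos (by linarith [hv.1, hz.1]) _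
        nlinarith))
  norm_num at this ⊢
  exact this

/-- The oscillatory integral of `phase` over `[0, y]` is bounded uniformly in all coefficients. -/
lemma norm_integral_exp_phase_le {a b β M y : ℝ} (hβ0 : 0 < β) (hβ1 : β < 1)
    (hM : 3 ≤ M) (hy : 0 ≤ y) :
    ‖∫ v in (0 : ℝ)..y, Complex.exp (Complex.I * (phase a b β M v : ℂ))‖ ≤ 135 := by
  have hF : Continuous fun v => Complex.exp (Complex.I * (phase a b β M v : ℂ)) := by
    have := continuous_phase (a := a) (b := b) hβ0 hβ1 hM
    fun_prop
  have hF1 := fun v => (norm_exp_I_mul_phase a b β M v).le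
  rcases le_total y 1 with h | h
  · exact (norm_integral_le_of_norm_le_one hF1 hy).trans (by linarith)
  · rw [← intervalIntegral.integral_add_adjacent_intervals (hF.intervalIntegrable 0 1)
      (hF.intervalIntegrable 1 y)]
    have h1 := norm_integral_le_of_norm_le_one hF1 zero_le_one
    have h2 := norm_integral_exp_phase_le_of_one_le (a := a) (b := b) hβ0 hβ1 hM h
    exact (norm_add_le _ _).trans (by linarith)

lemma phase_const_mul_rpow {α₁ α₂ m A₁ A₂ A₃ t : ℝ} (hα₁ : 0 < α₁) (hα₂ : 0 < α₂) (hm : 0 < m)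
    (hA₃ : 0 < A₃) (ht : 0 ≤ t) :
    phase (α₁ / (α₁ + α₂) * (A₁ * (A₃ ^ ((α₁ + α₂) / m)) ^ (-(α₁ / (α₁ + α₂)))))
      ((1 - α₁ / (α₁ + α₂)) * (A₂ * (A₃ ^ ((α₁ + α₂) / m)) ^ (-(1 - α₁ / (α₁ + α₂)))))
      (α₁ / (α₁ + α₂)) (m / (α₁ + α₂)) (A₃ ^ ((α₁ + α₂) / m) * t ^ (α₁ + α₂)) =
      A₁ * t ^ α₁ + A₂ * t ^ α₂ + A₃ * t ^ m := by
  have hσ : 0 < α₁ + α₂ := by linarith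
  have hl : 0 < A₃ ^ ((α₁ + α₂) / m) := rpow_pos_of_pos hA₃ _
  have hts : 0 ≤ t ^ (α₁ + α₂) := rpow_nonneg ht _
  have hβ : α₁ / (α₁ + α₂) ≠ 0 := (div_pos hα₁ hσ).ne'
  have hβ' : 1 - α₁ / (α₁ + α₂) = α₂ / (α₁ + α₂) := by field_simp; ring
  have hβ2 : α₂ / (α₁ + α₂) ≠ 0 := (div_pos hα₂ hσ).ne'
  have hpow : ∀ p, (t ^ (α₁ + α₂)) ^ (p / (α₁ + α₂)) = t ^ p := fun p => by
    rw [← rpow_mul ht, mul_div_cancel₀ _ hσ.ne']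
  have hcancel : ∀ p : ℝ, (A₃ ^ ((α₁ + α₂) / m)) ^ (-p) * (A₃ ^ ((α₁ + α₂) / m)) ^ p = 1 :=
    fun p => by rw [← rpow_add hl]; simp
  have hA : (A₃ ^ ((α₁ + α₂) / m)) ^ (m / (α₁ + α₂)) = A₃ := by
    rw [← rpow_mul hA₃.le, div_mul_div_cancel₀ hm.ne', div_self hσ.ne', rpow_one]
  rw [phase, hβ', mul_rpow hl.le hts, mul_rpow hl.le hts, mul_rpow hl.le hts, hpow, hpow, hpow, hA,
    mul_div_cancel_left₀ _ hβ, mul_div_cancel_left₀ _ hβ2]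
  linear_combination (A₁ * t ^ α₁) * hcancel (α₁ / (α₁ + α₂)) +
    (A₂ * t ^ α₂) * hcancel (α₂ / (α₁ + α₂))

lemma norm_integral_exp_mul_rpow_le {α₁ α₂ m : ℝ} (hα₁ : 0 < α₁) (hα₂ : 0 < α₂)
    (hm : 3 * (α₁ + α₂) ≤ m) (A₁ A₂ : ℝ) {A₃ : ℝ} (hA₃ : 0 < A₃) :
    ‖∫ t in Set.Ioo (0 : ℝ) 1,
        Complex.exp (Complex.I * ((A₁ * t ^ α₁ + A₂ * t ^ α₂ + A₃ * t ^ m : ℝ) : ℂ)) *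
          ((t ^ (α₁ + α₂ - 1) : ℝ) : ℂ)‖ ≤ 135 / (α₁ + α₂) * A₃ ^ (-((α₁ + α₂) / m)) := by
  have hσ : 0 < α₁ + α₂ := by linarith
  have hm0 : 0 < m := by linarith
  have hβ0 : 0 < α₁ / (α₁ + α₂) := div_pos hα₁ hσ
  have hβ1 : α₁ / (α₁ + α₂) < 1 := (div_lt_one hσ).2 (by linarith)
  have hM : 3 ≤ m / (α₁ + α₂) := (le_div_iff₀ hσ).2 hm
  have hphase := fun t (ht : 0 ≤ t) =>
    phase_const_mul_rpow (A₁ := A₁) (A₂ := A₂) hα₁ hα₂ hm0 hA₃ ht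
  set l : ℝ := A₃ ^ ((α₁ + α₂) / m) with hl_def
  have hl : 0 < l := rpow_pos_of_pos hA₃ _
  set a := α₁ / (α₁ + α₂) * (A₁ * l ^ (-(α₁ / (α₁ + α₂))))
  set b := (1 - α₁ / (α₁ + α₂)) * (A₂ * l ^ (-(1 - α₁ / (α₁ + α₂))))
  set g : ℝ → ℂ := fun v =>
    Complex.exp (Complex.I * (phase a b (α₁ / (α₁ + α₂)) (m / (α₁ + α₂)) v : ℂ)) with hg
  have hgc : Continuous g := by
    have := continuous_phase (a := a) (b := b) hβ0 hβ1 hM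
    fun_prop
  have hfc : Continuous fun t : ℝ => l * t ^ (α₁ + α₂) := by
    have := Real.continuous_rpow_const hσ.le
    fun_prop
  have hint : IntegrableOn (fun t : ℝ => (l * ((α₁ + α₂) * t ^ (α₁ + α₂ - 1))) •
      (g ∘ fun t : ℝ => l * t ^ (α₁ + α₂)) t) (Set.uIcc 0 1) := by
    have h1 : IntervalIntegrable (fun t : ℝ => l * ((α₁ + α₂) * t ^ (α₁ + α₂ - 1))) volume 0 1 :=
      ((intervalIntegral.intervalIntegrable_rpow' (by linarith)).const_mul _).const_mul _
    have h2 := h1.smul_continuousOn (hgc.comp hfc).continuousOn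
    rw [Set.uIcc_of_le zero_le_one]
    exact (intervalIntegrable_iff_integrableOn_Icc_of_le zero_le_one).1 h2
  have hsub := intervalIntegral.integral_deriv_smul_comp''' (a := 0) (b := 1) (g := g)
    hfc.continuousOn
    (fun t ht => (hasDerivAt_const_mul_rpow l (α₁ + α₂)
      (by simpa using ht.1)).hasDerivWithinAt)
    hgc.continuousOn
    (hgc.continuousOn.integrableOn_compact (isCompact_uIcc.image hfc)) hint
  have heq : ∫ t in (0 : ℝ)..1, (l * ((α₁ + α₂) * t ^ (α₁ + α₂ - 1))) •
      (g ∘ fun t : ℝ => l * t ^ (α₁ + α₂)) t =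
      ((l * (α₁ + α₂) : ℝ) : ℂ) * ∫ t in Set.Ioo (0 : ℝ) 1,
        Complex.exp (Complex.I * ((A₁ * t ^ α₁ + A₂ * t ^ α₂ + A₃ * t ^ m : ℝ) : ℂ)) *
          ((t ^ (α₁ + α₂ - 1) : ℝ) : ℂ) := by
    rw [← integral_Ioc_eq_integral_Ioo, ← intervalIntegral.integral_of_le zero_le_one,
      ← intervalIntegral.integral_const_mul]
    refine intervalIntegral.integral_congr fun t ht => ?_
    rw [Set.uIcc_of_le zero_le_one] at ht
    simp only [Function.comp_apply, hg, hphase t ht.1, Complex.real_smul]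
    push_cast
    ring
  have hbound := norm_integral_exp_phase_le (a := a) (b := b) hβ0 hβ1 hM hl.le
  rw [heq, zero_rpow hσ.ne', one_rpow, mul_zero, mul_one] at hsub
  rw [← hsub, norm_mul, Complex.norm_real, Real.norm_eq_abs,
    abs_of_pos (mul_pos hl hσ)] at hbound
  rw [rpow_neg hA₃.le, ← hl_def, ← div_eq_mul_inv, div_div, le_div_iff₀ (mul_pos hσ hl)]
  linarith

/-- The oscillatory integral estimate
`|∫₀¹ e^{−i(A₁t^{α₁}+A₂t^{α₂}+A₃t^m)} t^{α₁+α₂−1} dt| ≤ C |A₃|^{−(α₁+α₂)/m}`. -/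
theorem stmt_6 (α₁ α₂ m : ℝ) (hα₁ : 0 < α₁) (hα₂ : 0 < α₂) (hαne : α₁ ≠ α₂)
    (hm : 3 * (α₁ + α₂) ≤ m) :
    ∃ C : ℝ, 0 < C ∧ ∀ A₁ A₂ A₃ : ℝ, A₃ ≠ 0 →
      ‖∫ t in Set.Ioo (0 : ℝ) 1,
          Complex.exp (-Complex.I * ((A₁ * t ^ α₁ + A₂ * t ^ α₂ + A₃ * t ^ m : ℝ) : ℂ)) *
            ((t ^ (α₁ + α₂ - 1) : ℝ) : ℂ)‖ ≤ C * |A₃| ^ (-((α₁ + α₂) / m)) := by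
  refine ⟨135 / (α₁ + α₂), by positivity, fun A₁ A₂ A₃ hA₃ => ?_⟩
  rcases lt_or_gt_of_ne hA₃ with h | h
  · rw [abs_of_neg h]
    refine le_of_eq_of_le (congrArg norm (integral_congr_ae (.of_forall fun t => ?_)))
      (norm_integral_exp_mul_rpow_le hα₁ hα₂ hm (-A₁) (-A₂) (neg_pos.2 h))
    simp only
    congr 2
    push_cast
    ring
  · rw [abs_of_pos h, ← Complex.norm_conj, ← integral_conj]
    refine le_of_eq_of_le (congrArg norm (integral_congr_ae (.of_forall fun t => ?_)))
      (norm_integral_exp_mul_rpow_le hα₁ hα₂ hm A₁ A₂ h)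
    simp only [map_mul, ← Complex.exp_conj, map_neg, Complex.conj_I, Complex.conj_ofReal, neg_neg]
end

section
/- Let γ₁, γ₂ ∈ (0,1) with γ₁ ≠ γ₂, and let γ₃ ≥ 3. Then there exists a positive constant C, depending only on γ₁, γ₂, γ₃, such that for all a, b ∈ ℝ and all B > 1: | ∫₁^B e^{−i(a τ^{γ₁} + b τ^{γ₂} + τ^{γ₃})} dτ | ≤ C. -/
open MeasureTheory Real

lemma mul_rpow_mul_sub_le_image_sub {h h' : ℝ → ℝ} {u v c p : ℝ} (hu : 0 < u) (hc : 0 ≤ c)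
    (hp : 0 ≤ p) (hd : ∀ t ∈ Set.Icc u v, HasDerivAt h (h' t) t)
    (hb : ∀ t ∈ Set.Icc u v, c * t ^ p ≤ h' t) {x y : ℝ} (hx : u ≤ x) (hxy : x ≤ y)
    (hy : y ≤ v) : c * x ^ p * (y - x) ≤ h y - h x := by
  have hsub : ∀ t ∈ Set.Icc x y, t ∈ Set.Icc u v := fun t ht =>
    ⟨hx.trans ht.1, ht.2.trans hy⟩
  refine Convex.mul_sub_le_image_sub_of_le_deriv (convex_Icc x y)
    (fun t ht => (hd t (hsub t ht)).continuousAt.continuousWithinAt)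
    (fun t ht => (hd t (hsub t (interior_subset ht))).differentiableAt.differentiableWithinAt)
    (fun t ht => ?_) x (Set.left_mem_Icc.2 hxy) y (Set.right_mem_Icc.2 hxy) hxy
  have ht' := interior_subset ht
  rw [(hd t (hsub t ht')).deriv]
  refine le_trans ?_ (hb t (hsub t ht'))
  have := Real.rpow_le_rpow (hu.le.trans hx) ht'.1 hp
  gcongr

/-- A function whose derivative is at least `c * t ^ p` grows at least linearly, with the same
weight, away from its zero (or from the endpoint nearest to a zero). -/
lemma exists_lower_bound_of_rpow_le_deriv {h h' : ℝ → ℝ} {u v c p : ℝ} (hu : 0 < u)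
    (huv : u ≤ v) (hc : 0 ≤ c) (hp : 0 ≤ p) (hd : ∀ t ∈ Set.Icc u v, HasDerivAt h (h' t) t)
    (hb : ∀ t ∈ Set.Icc u v, c * t ^ p ≤ h' t) :
    ∃ s ∈ Set.Icc u v,
      (∀ t ∈ Set.Icc u v, t < s → c * (1 / 2) ^ (p + 1) * t ^ p * (s - t) ≤ -h t) ∧
      (∀ t ∈ Set.Icc u v, s < t → c * (1 / 2) ^ (p + 1) * t ^ p * (t - s) ≤ h t) := by
  have key := @mul_rpow_mul_sub_le_image_sub h h' u v c p hu hc hp hd hb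
  have left : ∀ s ∈ Set.Icc u v, h s ≤ 0 → ∀ t ∈ Set.Icc u v, t < s →
      c * (1 / 2) ^ (p + 1) * t ^ p * (s - t) ≤ -h t := by
    intro s hs h0 t ht hts
    have h1 := key ht.1 hts.le hs.2
    have h2 : ((1 : ℝ) / 2) ^ (p + 1) ≤ 1 :=
      Real.rpow_le_one (by norm_num) (by norm_num) (by linarith)
    have h3 : 0 ≤ c * t ^ p * (s - t) :=
      mul_nonneg (mul_nonneg hc (Real.rpow_nonneg (hu.le.trans ht.1) _)) (by linarith)
    nlinarith [mul_le_mul_of_nonneg_right h2 h3]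
  have right : ∀ s ∈ Set.Icc u v, 0 ≤ h s → ∀ t ∈ Set.Icc u v, s < t →
      c * (1 / 2) ^ (p + 1) * t ^ p * (t - s) ≤ h t := by
    intro s hs h0 t ht hst
    have hs0 : 0 < s := hu.trans_le hs.1
    have ht0 : 0 < t := hu.trans_le ht.1
    have h1 := key (x := (s + t) / 2) (y := t) (by linarith [hs.1]) (by linarith) ht.2
    have h2 := key (x := s) (y := (s + t) / 2) hs.1 (by linarith) (by linarith [ht.2])
    have h3 : 0 ≤ c * s ^ p * ((s + t) / 2 - s) :=
      mul_nonneg (mul_nonneg hc (Real.rpow_nonneg hs0.le _)) (by linarith)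
    have h4 : (1 / 2 * t) ^ p ≤ ((s + t) / 2) ^ p :=
      Real.rpow_le_rpow (by positivity) (by linarith) hp
    rw [Real.mul_rpow (by norm_num) ht0.le] at h4
    rw [Real.rpow_add_one (by norm_num)]
    have h5 : c * (((1 / 2) ^ p) * t ^ p) * (t - (s + t) / 2) ≤
        c * ((s + t) / 2) ^ p * (t - (s + t) / 2) :=
      mul_le_mul_of_nonneg_right (mul_le_mul_of_nonneg_left h4 hc) (by linarith)
    calc c * ((1 / 2) ^ p * (1 / 2)) * t ^ p * (t - s)
        = c * (((1 / 2) ^ p) * t ^ p) * (t - (s + t) / 2) := by ring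
      _ ≤ h t := by linarith
  have hul := Set.left_mem_Icc.2 huv
  have hvr := Set.right_mem_Icc.2 huv
  rcases le_total 0 (h u) with hu0 | hu0
  · exact ⟨u, hul, fun t ht htu => absurd ht.1 htu.not_ge, right u hul hu0⟩
  rcases le_total (h v) 0 with hv0 | hv0
  · exact ⟨v, hvr, left v hvr hv0, fun t ht htv => absurd ht.2 htv.not_ge⟩
  obtain ⟨s, hs, h0⟩ := intermediate_value_Icc huv
    (fun t ht => (hd t ht).continuousAt.continuousWithinAt) ⟨hu0, hv0⟩
  exact ⟨s, hs, left s hs h0.le, right s hs h0.ge⟩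

/-- Removing an interval of length two around `s` from the domain of integration. -/
lemma norm_integral_le_of_forall_away {F : ℝ → ℂ} (hF : Continuous F) (hF1 : ∀ t, ‖F t‖ ≤ 1)
    {u v s K : ℝ} (hs : s ∈ Set.Icc u v) (hK : 0 ≤ K)
    (hl : ∀ y, u ≤ y → y ≤ v → y ≤ s - 1 → ‖∫ t in u..y, F t‖ ≤ K)
    (hr : ∀ x, u ≤ x → x ≤ v → s + 1 ≤ x → ‖∫ t in x..v, F t‖ ≤ K) :
    ‖∫ t in u..v, F t‖ ≤ 2 * K + 2 := by
  have hI : ∀ x y, IntervalIntegrable F volume x y := fun x y => hF.intervalIntegrable x y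
  have h1 : ‖∫ t in u..max u (s - 1), F t‖ ≤ K := by
    rcases le_total u (s - 1) with h | h
    · rw [max_eq_right h]
      exact hl _ h (by linarith [hs.2]) le_rfl
    · simpa [max_eq_left h] using hK
  have h3 : ‖∫ t in min v (s + 1)..v, F t‖ ≤ K := by
    rcases le_total v (s + 1) with h | h
    · simpa [min_eq_left h] using hK
    · rw [min_eq_right h]
      exact hr _ (by linarith [hs.1]) h le_rfl
  have h2 : ‖∫ t in max u (s - 1)..min v (s + 1), F t‖ ≤ 2 := by
    refine (intervalIntegral.norm_integral_le_of_norm_le_const (C := 1) fun t _ => hF1 t).trans ?_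
    have h4 : max u (s - 1) ≤ s := max_le hs.1 (by linarith)
    have h5 : s ≤ min v (s + 1) := le_min hs.2 (by linarith)
    have h6 := le_max_right u (s - 1)
    have h7 := min_le_right v (s + 1)
    rw [one_mul, abs_of_nonneg (by linarith)]
    linarith
  rw [← intervalIntegral.integral_add_adjacent_intervals (hI u (max u (s - 1))) (hI _ v),
    ← intervalIntegral.integral_add_adjacent_intervals (hI _ (min v (s + 1))) (hI _ v)]
  refine (norm_add_le _ _).trans ?_
  linarith [norm_add_le (∫ t in max u (s - 1)..min v (s + 1), F t)
    (∫ t in min v (s + 1)..v, F t)]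

/-- A first-derivative test: `φ' = p`, where `t ^ q * p t` is monotone (`R` is its derivative
divided by `t ^ q`) and `p` grows linearly away from a point `s`. -/
lemma norm_integral_exp_le_of_weighted_monotone {φ p R : ℝ → ℝ} {u v s c q ε : ℝ} (hu : 1 ≤ u)
    (huv : u ≤ v) (hc : 0 < c) (hq : 0 ≤ q) (hε : |ε| = 1)
    (hφ : ∀ t ∈ Set.Icc u v, HasDerivAt φ (p t) t)
    (hp : ∀ t ∈ Set.Icc u v, HasDerivAt p (R t - q * p t / t) t)
    (hR : ∀ t ∈ Set.Icc u v, 0 ≤ ε * R t)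
    (hs : ∀ t ∈ Set.Icc u v, 1 ≤ |t - s|)
    (hlow : ∀ t ∈ Set.Icc u v, c * |t - s| ≤ |p t|)
    (hcont : Continuous φ) :
    ‖∫ t in u..v, Complex.exp (-Complex.I * (φ t : ℂ))‖ ≤ (4 + 4 * q) / c := by
  set E : ℝ → ℂ := fun t => Complex.exp (-Complex.I * (φ t : ℂ)) with hE
  have hEc : Continuous E := by fun_prop
  have hE1 : ∀ t, ‖E t‖ = 1 := fun t => by
    have : -Complex.I * (φ t : ℂ) = ((-φ t : ℝ) : ℂ) * Complex.I := by push_cast; ring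
    simp only [hE, this, Complex.norm_exp_ofReal_mul_I]
  have hpc : ∀ t ∈ Set.Icc u v, c ≤ |p t| := fun t ht =>
    le_trans (by nlinarith [hs t ht]) (hlow t ht)
  have hp0 : ∀ t ∈ Set.Icc u v, p t ≠ 0 := fun t ht => abs_pos.1 (hc.trans_le (hpc t ht))
  have hs0 : ∀ t ∈ Set.Icc u v, t - s ≠ 0 := fun t ht =>
    abs_pos.1 (one_pos.trans_le (hs t ht))
  have ht0 : ∀ t ∈ Set.Icc u v, 0 < t := fun t ht => by linarith [ht.1]
  have hw : ∀ t ∈ Set.Icc u v,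
      HasDerivAt (fun t => (p t)⁻¹) (-(R t - q * p t / t) / p t ^ 2) t := fun t ht =>
    (hp t ht).inv (hp0 t ht)
  set G : ℝ → ℝ := fun t => q / c * (-t⁻¹ - (t - s)⁻¹) - ε * (p t)⁻¹ with hG
  set G' : ℝ → ℝ := fun t => q / c * (1 / t ^ 2 + 1 / (t - s) ^ 2) -
    ε * (-(R t - q * p t / t) / p t ^ 2) with hG'
  have hGd : ∀ t ∈ Set.Icc u v, HasDerivAt G (G' t) t := fun t ht => by
    have h1 := (hasDerivAt_id t).inv (ht0 t ht).ne'
    have h2 := ((hasDerivAt_id t).sub_const s).inv (hs0 t ht)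
    refine HasDerivAt.congr_deriv (((h1.neg.sub h2).const_mul (q / c)).sub ((hw t ht).const_mul ε)) ?_
    simp only [hG', id]
    ring
  set Φ : ℝ → ℂ := fun t => (∫ x in u..t, E x) - Complex.I * (((p t)⁻¹ : ℝ) : ℂ) * E t with hΦ
  set Φ' : ℝ → ℂ := fun t =>
    -Complex.I * ((-(R t - q * p t / t) / p t ^ 2 : ℝ) : ℂ) * E t with hΦ'
  have hΦd : ∀ t ∈ Set.Icc u v, HasDerivAt Φ (Φ' t) t := fun t ht => by
    have h1 : HasDerivAt E (E t * (-Complex.I * (p t : ℂ))) t :=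
      (((hφ t ht).ofReal_comp).const_mul (-Complex.I)).cexp
    have h2 := ((hw t ht).ofReal_comp.const_mul Complex.I).mul h1
    have h3 := intervalIntegral.integral_hasDerivAt_right (hEc.intervalIntegrable u t)
      (hEc.stronglyMeasurableAtFilter _ _) hEc.continuousAt
    refine HasDerivAt.congr_deriv (h3.sub h2) ?_
    have hpt : (p t : ℂ) ≠ 0 := by exact_mod_cast hp0 t ht
    simp only [hΦ', Complex.ofReal_inv]
    have : Complex.I * (p t : ℂ)⁻¹ * (E t * (-Complex.I * (p t : ℂ))) = E t := by
      field_simp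
      rw [Complex.I_sq]; ring
    rw [this]; ring
  have hbound : ∀ t ∈ Set.Icc u v, ‖Φ' t‖ ≤ G' t := fun t ht => by
    have hn : ‖Φ' t‖ = |-(R t - q * p t / t) / p t ^ 2| := by
      simp only [hΦ', norm_mul, norm_neg, Complex.norm_I, hE1, one_mul, mul_one,
        Complex.norm_real, Real.norm_eq_abs]
    rw [hn]
    have hpt := hp0 t ht
    have htt := ht0 t ht
    have e1 : -(R t - q * p t / t) / p t ^ 2 = -(R t / p t ^ 2) + q * ((p t)⁻¹ / t) := by
      field_simp
      ring
    have hRabs : |R t / p t ^ 2| = ε * (R t / p t ^ 2) := by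
      have : 0 ≤ ε * (R t / p t ^ 2) := by
        rw [← mul_div_assoc]
        exact div_nonneg (hR t ht) (sq_nonneg _)
      rw [← abs_of_nonneg this, abs_mul, hε, one_mul]
    have hinv : |(p t)⁻¹ / t| ≤ 1 / (2 * c) * (1 / t ^ 2 + 1 / (t - s) ^ 2) := by
      have hst : 0 < |t - s| := one_pos.trans_le (hs t ht)
      have h1 : |(p t)⁻¹ / t| ≤ (c * |t - s|)⁻¹ / t := by
        rw [abs_div, abs_inv, abs_of_pos htt]
        exact div_le_div_of_nonneg_right
          (inv_anti₀ (mul_pos hc hst) (hlow t ht)) htt.le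
      refine h1.trans ?_
      have h2 : (c * |t - s|)⁻¹ / t = 1 / (2 * c) * (2 * t⁻¹ * |t - s|⁻¹) := by
        field_simp
      rw [h2]
      refine mul_le_mul_of_nonneg_left ?_ (by positivity)
      have h3 := two_mul_le_add_sq t⁻¹ |t - s|⁻¹
      rw [inv_pow, inv_pow, sq_abs] at h3
      simpa only [one_div] using h3
    have hεa : |ε * (q * ((p t)⁻¹ / t))| = q * |(p t)⁻¹ / t| := by
      rw [abs_mul, hε, one_mul, abs_mul, abs_of_nonneg hq]
    have h4 : |-(R t / p t ^ 2) + q * ((p t)⁻¹ / t)| ≤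
        ε * (R t / p t ^ 2) + q * |(p t)⁻¹ / t| := by
      refine (abs_add_le _ _).trans ?_
      rw [abs_neg, hRabs, abs_mul, abs_of_nonneg hq]
    have h5 := le_abs_self (ε * (q * ((p t)⁻¹ / t)))
    rw [hεa] at h5
    have h6 := mul_le_mul_of_nonneg_left hinv hq
    have h7 : q / c * (1 / t ^ 2 + 1 / (t - s) ^ 2) =
        2 * (q * (1 / (2 * c) * (1 / t ^ 2 + 1 / (t - s) ^ 2))) := by
      field_simp
    simp only [hG', e1]
    rw [h7]
    linarith
  have hmain : ‖Φ v - Φ u‖ ≤ G v - G u := by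
    refine image_norm_le_of_norm_deriv_right_le_deriv_boundary' (f := fun t => Φ t - Φ u)
      (f' := Φ') (B := fun t => G t - G u) (B' := G') (a := u) (b := v)
      (fun t ht => ((hΦd t ht).sub_const _).continuousAt.continuousWithinAt)
      (fun t ht => ((hΦd t ⟨ht.1, ht.2.le⟩).sub_const _).hasDerivWithinAt) (by simp)
      (fun t ht => ((hGd t ht).sub_const _).continuousAt.continuousWithinAt)
      (fun t ht => ((hGd t ⟨ht.1, ht.2.le⟩).sub_const _).hasDerivWithinAt)
      (fun t ht => hbound t ⟨ht.1, ht.2.le⟩) (Set.right_mem_Icc.2 huv)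
  have hinvp : ∀ t ∈ Set.Icc u v, |(p t)⁻¹| ≤ 1 / c := fun t ht => by
    rw [abs_inv, one_div]
    exact inv_anti₀ hc (hpc t ht)
  have hGb : ∀ t ∈ Set.Icc u v, |G t| ≤ (1 + 2 * q) / c := fun t ht => by
    have h1 : |t⁻¹| ≤ 1 := by
      rw [abs_inv, abs_of_pos (ht0 t ht)]
      exact inv_le_one_of_one_le₀ (hu.trans ht.1)
    have h2 : |(t - s)⁻¹| ≤ 1 := by
      rw [abs_inv]
      exact inv_le_one_of_one_le₀ (hs t ht)
    have h3 : |-t⁻¹ - (t - s)⁻¹| ≤ 2 := by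
      refine (abs_sub _ _).trans ?_
      rw [abs_neg]
      linarith
    refine (abs_sub _ _).trans ?_
    rw [abs_mul, abs_mul, hε, one_mul, abs_of_nonneg (div_nonneg hq hc.le)]
    have h4 := mul_le_mul_of_nonneg_left h3 (div_nonneg hq hc.le)
    have h5 : (1 + 2 * q) / c = q / c * 2 + 1 / c := by field_simp; ring
    linarith [hinvp t ht]
  have hbd : ∀ t ∈ Set.Icc u v, ‖Complex.I * (((p t)⁻¹ : ℝ) : ℂ) * E t‖ ≤ 1 / c := fun t ht => by
    rw [norm_mul, norm_mul, Complex.norm_I, hE1, one_mul, mul_one, Complex.norm_real]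
    exact hinvp t ht
  have hul := Set.left_mem_Icc.2 huv
  have hvr := Set.right_mem_Icc.2 huv
  have hsplit : (∫ t in u..v, E t) = (Φ v - Φ u) + (Complex.I * (((p v)⁻¹ : ℝ) : ℂ) * E v -
      Complex.I * (((p u)⁻¹ : ℝ) : ℂ) * E u) := by
    simp only [hΦ, intervalIntegral.integral_same]
    ring
  rw [hsplit]
  have h1 := norm_add_le (Φ v - Φ u) (Complex.I * (((p v)⁻¹ : ℝ) : ℂ) * E v -
      Complex.I * (((p u)⁻¹ : ℝ) : ℂ) * E u)
  have h2 := norm_sub_le (Complex.I * (((p v)⁻¹ : ℝ) : ℂ) * E v)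
    (Complex.I * (((p u)⁻¹ : ℝ) : ℂ) * E u)
  have h3 : (4 + 4 * q) / c = 2 * (1 / c) + 2 * ((1 + 2 * q) / c) := by field_simp; ring
  linarith [hbd u hul, hbd v hvr, abs_le.1 (hGb u hul), abs_le.1 (hGb v hvr)]

/-- The case where `t ^ q * p t` has a derivative of constant sign and of size at least
`c * t ^ r` with `q ≤ r`. -/
lemma norm_integral_exp_le_of_rpow_le_deriv {φ p f f' : ℝ → ℝ} {u v c q r ε : ℝ} (hu : 1 ≤ u)
    (huv : u ≤ v) (hc : 0 < c) (hq : 0 ≤ q) (hqr : q ≤ r) (hε : |ε| = 1)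
    (hφ : ∀ t ∈ Set.Icc u v, HasDerivAt φ (p t) t)
    (hp : ∀ t ∈ Set.Icc u v, p t = t ^ (-q) * f t)
    (hpd : ∀ t ∈ Set.Icc u v, HasDerivAt p (t ^ (-q) * f' t - q * p t / t) t)
    (hf : ∀ t ∈ Set.Icc u v, HasDerivAt f (f' t) t)
    (hf' : ∀ t ∈ Set.Icc u v, c * t ^ r ≤ ε * f' t)
    (hcont : Continuous φ) :
    ‖∫ t in u..v, Complex.exp (-Complex.I * (φ t : ℂ))‖ ≤
      2 * ((4 + 4 * q) / (c * (1 / 2) ^ (r + 1))) + 2 := by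
  obtain ⟨s, hs, hleft, hright⟩ := exists_lower_bound_of_rpow_le_deriv (one_pos.trans_le hu) huv
    hc.le (hq.trans hqr) (fun t ht => (hf t ht).const_mul ε) hf'
  have hc' : 0 < c * (1 / 2 : ℝ) ^ (r + 1) := by positivity
  have habs : ∀ t ∈ Set.Icc u v, t ≠ s → c * (1 / 2) ^ (r + 1) * |t - s| ≤ |p t| := by
    intro t ht hts
    have ht1 : 1 ≤ t := hu.trans ht.1
    have ht0 : 0 < t := one_pos.trans_le ht1
    have h1 : c * (1 / 2) ^ (r + 1) * t ^ r * |t - s| ≤ |f t| := by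
      have h2 : |ε * f t| = |f t| := by rw [abs_mul, hε, one_mul]
      rw [← h2]
      rcases lt_or_gt_of_ne hts with h | h
      · rw [abs_of_neg (sub_neg.2 h), neg_sub]
        exact (hleft t ht h).trans (neg_le_abs _)
      · rw [abs_of_pos (sub_pos.2 h)]
        exact (hright t ht h).trans (le_abs_self _)
    rw [hp t ht, abs_mul, abs_of_pos (Real.rpow_pos_of_pos ht0 _)]
    have h3 : 1 ≤ t ^ (-q) * t ^ r := by
      rw [← Real.rpow_add ht0]
      exact Real.one_le_rpow ht1 (by linarith)
    calc c * (1 / 2) ^ (r + 1) * |t - s|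
        ≤ (t ^ (-q) * t ^ r) * (c * (1 / 2) ^ (r + 1) * |t - s|) :=
          le_mul_of_one_le_left (by positivity) h3
      _ = t ^ (-q) * (c * (1 / 2) ^ (r + 1) * t ^ r * |t - s|) := by ring
      _ ≤ t ^ (-q) * |f t| := by gcongr
  have hpiece : ∀ x y, u ≤ x → x ≤ y → y ≤ v → (∀ t ∈ Set.Icc x y, 1 ≤ |t - s|) →
      ‖∫ t in x..y, Complex.exp (-Complex.I * (φ t : ℂ))‖ ≤
        (4 + 4 * q) / (c * (1 / 2) ^ (r + 1)) := by
    intro x y hx hxy hy hd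
    have hsub : ∀ t ∈ Set.Icc x y, t ∈ Set.Icc u v := fun t ht =>
      ⟨hx.trans ht.1, ht.2.trans hy⟩
    refine norm_integral_exp_le_of_weighted_monotone (R := fun t => t ^ (-q) * f' t) (ε := ε)
      (hu.trans hx) hxy hc' hq hε (fun t ht => hφ t (hsub t ht))
      (fun t ht => hpd t (hsub t ht)) (fun t ht => ?_) hd (fun t ht => ?_) hcont
    · have ht0 : 0 < t := by linarith [(hsub t ht).1]
      have h1 : 0 ≤ ε * f' t := le_trans (by positivity) (hf' t (hsub t ht))
      calc 0 ≤ t ^ (-q) * (ε * f' t) := mul_nonneg (Real.rpow_nonneg ht0.le _) h1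
        _ = ε * (t ^ (-q) * f' t) := by ring
    · refine habs t (hsub t ht) fun h => ?_
      have := hd t ht
      simp [h] at this
      linarith
  refine norm_integral_le_of_forall_away (by fun_prop) (fun t => ?_) hs (by positivity)
    (fun y hy hyv hys => hpiece u y le_rfl hy hyv fun t ht => ?_)
    (fun x hx hxv hsx => hpiece x v hx hxv le_rfl fun t ht => ?_)
  · have : -Complex.I * (φ t : ℂ) = ((-φ t : ℝ) : ℂ) * Complex.I := by push_cast; ring
    rw [this, Complex.norm_exp_ofReal_mul_I]
  · rw [abs_sub_comm]
    exact le_trans (by linarith [ht.2]) (le_abs_self _)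
  · exact le_trans (by linarith [ht.1]) (le_abs_self _)

/-- A uniform bound for `∫₁^B e^{−i(aτ^{γ₁}+bτ^{γ₂}+τ^{γ₃})} dτ`, independent of the
coefficients `a`, `b` and of `B > 1`. -/
theorem stmt_7 (γ₁ γ₂ γ₃ : ℝ) (hγ₁ : γ₁ ∈ Set.Ioo (0 : ℝ) 1) (hγ₂ : γ₂ ∈ Set.Ioo (0 : ℝ) 1)
    (hne : γ₁ ≠ γ₂) (hγ₃ : 3 ≤ γ₃) :
    ∃ C : ℝ, 0 < C ∧ ∀ a b B : ℝ, 1 < B →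
      ‖∫ τ in Set.Ioo (1 : ℝ) B,
          Complex.exp (-Complex.I * ((a * τ ^ γ₁ + b * τ ^ γ₂ + τ ^ γ₃ : ℝ) : ℂ))‖ ≤ C := by
  obtain ⟨h10, h11⟩ := hγ₁
  obtain ⟨h20, h21⟩ := hγ₂
  set c₀ : ℝ := γ₃ * (γ₃ - γ₁) * (γ₃ - γ₂) with hc₀
  have hc₀pos : 0 < c₀ :=
    mul_pos (mul_pos (by linarith) (by linarith)) (by linarith)
  set c₁ : ℝ := c₀ * (1 / 2) ^ (γ₃ - γ₂ - 1 + 1) with hc₁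
  have hc₁pos : 0 < c₁ := by positivity
  set K : ℝ := 2 * ((4 + 4 * (1 - γ₁)) / (c₁ * (1 / 2) ^ (γ₃ - γ₁ - 2 + 1))) + 2 with hK
  have hKpos : 0 < K := by
    have : 0 < 1 - γ₁ := by linarith
    positivity
  refine ⟨2 * K + 2, by positivity, fun a b B hB => ?_⟩
  rw [← integral_Ioc_eq_integral_Ioo, ← intervalIntegral.integral_of_le hB.le]
  set φ : ℝ → ℝ := fun t => a * t ^ γ₁ + b * t ^ γ₂ + t ^ γ₃ with hφ
  have hcont : Continuous φ := by
    have h1 := Real.continuous_rpow_const h10.le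
    have h2 := Real.continuous_rpow_const h20.le
    have h3 := Real.continuous_rpow_const (q := γ₃) (by linarith)
    fun_prop
  set f : ℝ → ℝ := fun t => a * γ₁ + b * γ₂ * t ^ (γ₂ - γ₁) + γ₃ * t ^ (γ₃ - γ₁) with hf
  set g : ℝ → ℝ := fun t => b * γ₂ * (γ₂ - γ₁) + γ₃ * (γ₃ - γ₁) * t ^ (γ₃ - γ₂) with hg
  set p : ℝ → ℝ := fun t => t ^ (-(1 - γ₁)) * f t with hp
  set f' : ℝ → ℝ := fun t => t ^ (γ₂ - γ₁ - 1) * g t with hf'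
  have hpow : ∀ t : ℝ, 0 < t → ∀ x : ℝ, HasDerivAt (fun t : ℝ => t ^ x) (x * t ^ (x - 1)) t :=
    fun t ht x => Real.hasDerivAt_rpow_const (Or.inl ht.ne')
  have hgd : ∀ t : ℝ, 0 < t → HasDerivAt g (c₀ * t ^ (γ₃ - γ₂ - 1)) t := fun t ht => by
    refine HasDerivAt.congr_deriv (((hpow t ht (γ₃ - γ₂)).const_mul (γ₃ * (γ₃ - γ₁))).const_add
      (b * γ₂ * (γ₂ - γ₁))) ?_
    ring
  have hfd : ∀ t : ℝ, 0 < t → HasDerivAt f (f' t) t := fun t ht => by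
    refine HasDerivAt.congr_deriv ((((hpow t ht (γ₂ - γ₁)).const_mul (b * γ₂)).const_add (a * γ₁)).add
      ((hpow t ht (γ₃ - γ₁)).const_mul γ₃)) ?_
    have h1 : t ^ (γ₃ - γ₁ - 1) = t ^ (γ₂ - γ₁ - 1) * t ^ (γ₃ - γ₂) := by
      rw [← Real.rpow_add ht]; congr 1; ring
    simp only [hf', hg, h1]
    ring
  have hφd : ∀ t : ℝ, 0 < t → HasDerivAt φ (p t) t := fun t ht => by
    refine HasDerivAt.congr_deriv ((((hpow t ht γ₁).const_mul a).add ((hpow t ht γ₂).const_mul b)).add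
      (hpow t ht γ₃)) ?_
    have h1 : t ^ (γ₂ - 1) = t ^ (-(1 - γ₁)) * t ^ (γ₂ - γ₁) := by
      rw [← Real.rpow_add ht]; congr 1; ring
    have h2 : t ^ (γ₃ - 1) = t ^ (-(1 - γ₁)) * t ^ (γ₃ - γ₁) := by
      rw [← Real.rpow_add ht]; congr 1; ring
    have h3 : t ^ (γ₁ - 1) = t ^ (-(1 - γ₁)) := by congr 1; ring
    simp only [hp, hf, h1, h2, h3]
    ring
  have hpd : ∀ t : ℝ, 0 < t →
      HasDerivAt p (t ^ (-(1 - γ₁)) * f' t - (1 - γ₁) * p t / t) t := fun t ht => by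
    refine HasDerivAt.congr_deriv ((hpow t ht (-(1 - γ₁))).mul (hfd t ht)) ?_
    rw [Real.rpow_sub_one ht.ne']
    simp only [hp]
    ring
  obtain ⟨s, hs, hleft, hright⟩ := exists_lower_bound_of_rpow_le_deriv (p := γ₃ - γ₂ - 1)
    one_pos hB.le hc₀pos.le (by linarith)
    (fun t ht => hgd t (one_pos.trans_le ht.1)) (fun t _ => le_rfl)
  have hpiece : ∀ x y ε, 1 ≤ x → x ≤ y → y ≤ B → |ε| = 1 →
      (∀ t ∈ Set.Icc x y, c₁ * t ^ (γ₃ - γ₂ - 1) ≤ ε * g t) →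
      ‖∫ t in x..y, Complex.exp (-Complex.I * (φ t : ℂ))‖ ≤ K := by
    intro x y ε hx hxy hy hε hlow
    have hpos : ∀ t ∈ Set.Icc x y, 0 < t := fun t ht => by linarith [ht.1]
    refine norm_integral_exp_le_of_rpow_le_deriv (f := f) (f' := f') (p := p) hx hxy hc₁pos
      (by linarith) (by linarith) hε (fun t ht => hφd t (hpos t ht)) (fun t _ => rfl)
      (fun t ht => hpd t (hpos t ht)) (fun t ht => hfd t (hpos t ht)) (fun t ht => ?_) hcont
    have h1 : t ^ (γ₃ - γ₁ - 2) = t ^ (γ₂ - γ₁ - 1) * t ^ (γ₃ - γ₂ - 1) := by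
      rw [← Real.rpow_add (hpos t ht)]; congr 1; ring
    calc c₁ * t ^ (γ₃ - γ₁ - 2)
        = t ^ (γ₂ - γ₁ - 1) * (c₁ * t ^ (γ₃ - γ₂ - 1)) := by rw [h1]; ring
      _ ≤ t ^ (γ₂ - γ₁ - 1) * (ε * g t) :=
          mul_le_mul_of_nonneg_left (hlow t ht) (Real.rpow_nonneg (hpos t ht).le _)
      _ = ε * f' t := by simp only [hf']; ring
  refine norm_integral_le_of_forall_away (F := fun t => Complex.exp (-Complex.I * (φ t : ℂ)))
    (by fun_prop) (fun t => ?_) hs hKpos.le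
    (fun y hy hyv hys => hpiece 1 y (-1) le_rfl hy hyv (by simp) fun t ht => ?_)
    (fun x hx hxv hsx => hpiece x B 1 hx hxv le_rfl (by simp) fun t ht => ?_)
  · have : -Complex.I * (φ t : ℂ) = ((-φ t : ℝ) : ℂ) * Complex.I := by push_cast; ring
    rw [this, Complex.norm_exp_ofReal_mul_I]
  · rw [neg_one_mul]
    refine le_trans ?_ (hleft t ⟨ht.1, ht.2.trans hyv⟩ (by linarith [ht.2]))
    have := ht.1
    exact le_mul_of_one_le_right (by positivity) (by linarith [ht.2])
  · rw [one_mul]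
    refine le_trans ?_ (hright t ⟨hx.trans ht.1, ht.2⟩ (by linarith [ht.1]))
    have : 0 ≤ t := by linarith [ht.1]
    exact le_mul_of_one_le_right (by positivity) (by linarith [ht.1])
end

section
/- Let θ₁ < θ₂ be real numbers, let f : [θ₁,θ₂] → ℝ be continuously differentiable, let γ > 1, and let I ⊆ [θ₁,θ₂] be a closed interval. Suppose that for positive constants A and α with α < 2γ − 2 one of the following holds: (f'(s))² ≥ A (s − θ₁)^α for all s ∈ I, or (f'(s))² ≥ A (θ₂ − s)^α for all s ∈ I. Then there exists a constant C > 0 depending only on A, α, θ₁, θ₂ and γ (in particular, not on f or I) such that ∫_I |f(s)|^{−1/γ} ds ≤ C. -/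
open MeasureTheory Real

/-- A function with nonvanishing derivative on an open interval is strictly monotone. -/
lemma strictMonoOn_or_strictAntiOn_of_hasDerivAt_ne_zero {f f' : ℝ → ℝ} {u v : ℝ} (huv : u ≤ v)
    (hf : ContinuousOn f (Set.Icc u v)) (hd : ∀ s ∈ Set.Ioo u v, HasDerivAt f (f' s) s)
    (h0 : ∀ s ∈ Set.Ioo u v, f' s ≠ 0) :
    StrictMonoOn f (Set.Icc u v) ∨ StrictAntiOn f (Set.Icc u v) := by
  refine hf.strictMonoOn_of_injOn_Icc' huv ?_
  have key : ∀ x ∈ Set.Icc u v, ∀ y ∈ Set.Icc u v, x < y → f x ≠ f y := by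
    intro x hx y hy hxy hfxy
    obtain ⟨c, hc, hc0⟩ := exists_hasDerivAt_eq_zero hxy
      (hf.mono (Set.Icc_subset_Icc hx.1 hy.2)) hfxy
      (fun s hs => hd s ⟨hx.1.trans_lt hs.1, hs.2.trans_le hy.2⟩)
    exact h0 c ⟨hx.1.trans_lt hc.1, hc.2.trans_le hy.2⟩ hc0
  intro x hx y hy hxy
  by_contra hne
  rcases lt_or_gt_of_ne hne with h | h
  · exact key x hx y hy h hxy
  · exact key y hy x hx h hxy.symm

/-- A lower bound on the derivative gives a lower bound on increments. -/
lemma mul_sub_le_abs_sub_of_le_abs_hasDerivAt {f f' : ℝ → ℝ} {x y m : ℝ} (hxy : x < y)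
    (hf : ContinuousOn f (Set.Icc x y)) (hd : ∀ s ∈ Set.Ioo x y, HasDerivAt f (f' s) s)
    (hm : ∀ s ∈ Set.Ioo x y, m ≤ |f' s|) :
    m * (y - x) ≤ |f y - f x| := by
  obtain ⟨c, hc, hc'⟩ := exists_hasDerivAt_eq_slope f f' hxy hf hd
  have hpos : 0 < y - x := sub_pos.2 hxy
  have h := hm c hc
  rwa [hc', abs_div, abs_of_pos hpos, le_div_iff₀ hpos] at h

/-- If `|f'|` dominates a power of the distance to one endpoint of an interval, then the
increments of `f` dominate a power of the distance between the points. -/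
lemma le_abs_sub_of_rpow_le_abs_hasDerivAt {f f' : ℝ → ℝ} {u v c β : ℝ}
    (hc : 0 ≤ c) (hβ : 0 ≤ β)
    (hf : ContinuousOn f (Set.Icc u v)) (hd : ∀ s ∈ Set.Ioo u v, HasDerivAt f (f' s) s)
    (hmono : MonotoneOn f (Set.Icc u v) ∨ AntitoneOn f (Set.Icc u v))
    (h : (∀ s ∈ Set.Ioo u v, c * (s - u) ^ β ≤ |f' s|) ∨
      (∀ s ∈ Set.Ioo u v, c * (v - s) ^ β ≤ |f' s|))
    {x y : ℝ} (hx : u ≤ x) (hxy : x < y) (hy : y ≤ v) :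
    c * ((y - x) / 2) ^ (β + 1) ≤ |f y - f x| := by
  set d := (y - x) / 2 with hd_def
  have hdpos : 0 < d := by rw [hd_def]; linarith
  set m := x + d with hm_def
  have hxm : x < m := by linarith
  have hmy : m < y := by linarith
  have hmd : y - m = d := by rw [hm_def, hd_def]; ring
  have hmd' : m - x = d := by rw [hm_def]; ring
  have hxI : x ∈ Set.Icc u v := ⟨hx, by linarith⟩
  have hyI : y ∈ Set.Icc u v := ⟨by linarith, hy⟩
  have hmI : m ∈ Set.Icc u v := ⟨by linarith, by linarith⟩
  have hsplit : |f y - f x| = |f y - f m| + |f m - f x| := by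
    rcases hmono with hm | hm
    · have h1 := hm hxI hmI hxm.le
      have h2 := hm hmI hyI hmy.le
      rw [abs_of_nonneg (by linarith), abs_of_nonneg (by linarith), abs_of_nonneg (by linarith)]
      ring
    · have h1 := hm hxI hmI hxm.le
      have h2 := hm hmI hyI hmy.le
      rw [abs_of_nonpos (by linarith), abs_of_nonpos (by linarith), abs_of_nonpos (by linarith)]
      ring
  rw [hsplit, rpow_add_one hdpos.ne', ← mul_assoc]
  rcases h with h | h
  · have := mul_sub_le_abs_sub_of_le_abs_hasDerivAt (m := c * d ^ β) hmy
      (hf.mono (Set.Icc_subset_Icc hmI.1 hy))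
      (fun s hs => hd s ⟨hmI.1.trans_lt hs.1, hs.2.trans_le hy⟩)
      (fun s hs => le_trans (by gcongr; linarith [hs.1])
        (h s ⟨hmI.1.trans_lt hs.1, hs.2.trans_le hy⟩))
    rw [hmd] at this
    linarith [abs_nonneg (f m - f x)]
  · have := mul_sub_le_abs_sub_of_le_abs_hasDerivAt (m := c * d ^ β) hxm
      (hf.mono (Set.Icc_subset_Icc hx hmI.2))
      (fun s hs => hd s ⟨hx.trans_lt hs.1, hs.2.trans_le hmI.2⟩)
      (fun s hs => le_trans (by gcongr; linarith [hs.2])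
        (h s ⟨hx.trans_lt hs.1, hs.2.trans_le hmI.2⟩))
    rw [hmd'] at this
    linarith [abs_nonneg (f y - f m)]

/-- The point of an interval where a monotone continuous function is closest to zero. -/
lemma MonotoneOn.exists_abs_sub_le_abs {f : ℝ → ℝ} {u v : ℝ} (huv : u ≤ v)
    (hf : ContinuousOn f (Set.Icc u v)) (hm : MonotoneOn f (Set.Icc u v)) :
    ∃ t ∈ Set.Icc u v, ∀ s ∈ Set.Icc u v, |f s - f t| ≤ |f s| := by
  have hu := Set.left_mem_Icc.2 huv
  have hv := Set.right_mem_Icc.2 huv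
  rcases le_total 0 (f u) with h0 | h0
  · refine ⟨u, hu, fun s hs => ?_⟩
    have := hm hu hs hs.1
    rw [abs_of_nonneg (by linarith), abs_of_nonneg (by linarith)]
    linarith
  rcases le_total (f v) 0 with h1 | h1
  · refine ⟨v, hv, fun s hs => ?_⟩
    have := hm hs hv hs.2
    rw [abs_of_nonpos (by linarith), abs_of_nonpos (by linarith)]
    linarith
  obtain ⟨t, ht, ht0⟩ := intermediate_value_Icc huv hf ⟨h0, h1⟩
  exact ⟨t, ht, fun s _ => by simp [ht0]⟩

lemma AntitoneOn.exists_abs_sub_le_abs {f : ℝ → ℝ} {u v : ℝ} (huv : u ≤ v)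
    (hf : ContinuousOn f (Set.Icc u v)) (hm : AntitoneOn f (Set.Icc u v)) :
    ∃ t ∈ Set.Icc u v, ∀ s ∈ Set.Icc u v, |f s - f t| ≤ |f s| := by
  obtain ⟨t, ht, h⟩ := MonotoneOn.exists_abs_sub_le_abs huv hf.neg hm.neg
  refine ⟨t, ht, fun s hs => ?_⟩
  have := h s hs
  simpa [abs_sub_comm, neg_add_eq_sub] using this

lemma integrableOn_abs_rpow_Icc {r : ℝ} (hr : -1 < r) (L : ℝ) :
    IntegrableOn (fun s : ℝ => |s| ^ r) (Set.Icc (-L) L) := by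
  rcases lt_or_ge L 0 with hL | hL
  · rw [Set.Icc_eq_empty (by linarith)]
    exact integrableOn_empty
  have h1 : IntervalIntegrable (fun s : ℝ => |s| ^ r) volume 0 L := by
    refine (intervalIntegral.intervalIntegrable_rpow' hr).congr ?_
    intro s hs
    rw [Set.uIoc_of_le hL] at hs
    simp [abs_of_pos hs.1]
  have h2 : IntervalIntegrable (fun s : ℝ => |s| ^ r) volume (-L) 0 := by
    have := (IntervalIntegrable.iff_comp_neg (f := fun s : ℝ => |s| ^ r)).1 h1
    simpa using this.symm
  exact (intervalIntegrable_iff_integrableOn_Icc_of_le (by linarith)).1 (h2.trans h1)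

/-- Integrals of a power of the distance to a point of an interval are bounded uniformly. -/
lemma lintegral_abs_sub_rpow_le {a b t : ℝ} (r : ℝ) (ht : t ∈ Set.Icc a b) :
    ∫⁻ s in Set.Icc a b, ENNReal.ofReal (|s - t| ^ r) ≤
      ∫⁻ s in Set.Icc (-(b - a)) (b - a), ENNReal.ofReal (|s| ^ r) := by
  rw [← lintegral_indicator measurableSet_Icc, ← lintegral_indicator measurableSet_Icc,
    ← lintegral_sub_right_eq_self
      ((Set.Icc (-(b - a)) (b - a)).indicator fun s => ENNReal.ofReal (|s| ^ r)) t]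
  refine lintegral_mono fun s => ?_
  by_cases hs : s ∈ Set.Icc a b
  · have hs' : s - t ∈ Set.Icc (-(b - a)) (b - a) :=
      ⟨by linarith [hs.1, ht.2], by linarith [hs.2, ht.1]⟩
    rw [Set.indicator_of_mem hs, Set.indicator_of_mem hs']
  · rw [Set.indicator_of_notMem hs]
    exact zero_le

/-- If `(f')² ≥ A(s−θ₁)^α` or `(f')² ≥ A(θ₂−s)^α` on `I`, with `α < 2γ−2`, then `∫_I |f|^{−1/γ} ≤ C` with `C = C(A,α,θ₁,θ₂,γ)`. -/
theorem stmt_8 (θ₁ θ₂ A α γ : ℝ) (hθ : θ₁ < θ₂) (hA : 0 < A) (hα : 0 < α)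
    (hγ : 1 < γ) (hαγ : α < 2 * γ - 2) :
    ∃ C : ℝ, 0 < C ∧ ∀ (f f' : ℝ → ℝ) (u v : ℝ),
      Set.Icc u v ⊆ Set.Icc θ₁ θ₂ →
      (hder : ∀ s ∈ Set.Icc θ₁ θ₂, HasDerivWithinAt f (f' s) (Set.Icc θ₁ θ₂) s) →
      ContinuousOn f' (Set.Icc θ₁ θ₂) →
      ((∀ s ∈ Set.Icc u v, A * (s - θ₁) ^ α ≤ f' s ^ 2) ∨
        (∀ s ∈ Set.Icc u v, A * (θ₂ - s) ^ α ≤ f' s ^ 2)) →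
      ∫⁻ s in Set.Icc u v, ENNReal.ofReal (|f s| ^ (-(1 / γ))) ≤ ENNReal.ofReal C := by
  have hγ0 : 0 < γ := by linarith
  set β := α / 2 with hβ
  have hβ0 : 0 < β := by rw [hβ]; linarith
  set r := (β + 1) * (-(1 / γ)) with hr
  have hr1 : -1 < r := by
    have : (β + 1) / γ < 1 := by rw [div_lt_one hγ0, hβ]; linarith
    have h' : r = -((β + 1) / γ) := by rw [hr]; ring
    linarith
  set c := √A * (1 / 2) ^ (β + 1) with hc
  have hc0 : 0 < c := by positivity
  set K := ∫⁻ s in Set.Icc (-(θ₂ - θ₁)) (θ₂ - θ₁), ENNReal.ofReal (|s| ^ r) with hK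
  have hKfin : K ≠ ⊤ := (integrableOn_abs_rpow_Icc hr1 _).lintegral_lt_top.ne
  refine ⟨c ^ (-(1 / γ)) * K.toReal + 1, by positivity, ?_⟩
  intro f f' u v hsub hder _ hlow
  rcases le_or_gt v u with hvu | huv
  · rw [setLIntegral_measure_zero _ _ (by simp [hvu])]
    exact zero_le
  have hu := (hsub (Set.left_mem_Icc.2 huv.le)).1
  have hv := (hsub (Set.right_mem_Icc.2 huv.le)).2
  have hf : ContinuousOn f (Set.Icc u v) := fun s hs =>
    ((hder s (hsub hs)).continuousWithinAt).mono hsub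
  have hd : ∀ s ∈ Set.Ioo u v, HasDerivAt f (f' s) s := fun s hs =>
    (hder s (hsub (Set.Ioo_subset_Icc_self hs))).hasDerivAt
      (Icc_mem_nhds (hu.trans_lt hs.1) (hs.2.trans_le hv))
  have hsqrt : ∀ {x y z : ℝ}, 0 ≤ x → x ≤ y → A * y ^ α ≤ z ^ 2 → √A * x ^ β ≤ |z| := by
    intro x y z hx hxy h
    refine abs_le_of_sq_le_sq' ?_ (abs_nonneg z) |>.2
    have h2 : (x ^ β) ^ 2 = x ^ α := by
      rw [← rpow_natCast, ← rpow_mul hx, hβ]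
      norm_num
    rw [mul_pow, sq_sqrt hA.le, h2, sq_abs]
    exact le_trans (by gcongr) h
  have hlow' : (∀ s ∈ Set.Ioo u v, √A * (s - u) ^ β ≤ |f' s|) ∨
      (∀ s ∈ Set.Ioo u v, √A * (v - s) ^ β ≤ |f' s|) := by
    refine hlow.imp (fun h s hs => ?_) (fun h s hs => ?_)
    · exact hsqrt (by linarith [hs.1]) (by linarith) (h s (Set.Ioo_subset_Icc_self hs))
    · exact hsqrt (by linarith [hs.2]) (by linarith) (h s (Set.Ioo_subset_Icc_self hs))
  have hne : ∀ s ∈ Set.Ioo u v, f' s ≠ 0 := by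
    intro s hs
    have h1 : 0 < s - u := sub_pos.2 hs.1
    have h2 : 0 < v - s := sub_pos.2 hs.2
    refine abs_pos.1 ?_
    rcases hlow' with h | h
    · exact lt_of_lt_of_le (by positivity) (h s hs)
    · exact lt_of_lt_of_le (by positivity) (h s hs)
  have hmono : MonotoneOn f (Set.Icc u v) ∨ AntitoneOn f (Set.Icc u v) :=
    (strictMonoOn_or_strictAntiOn_of_hasDerivAt_ne_zero huv.le hf hd hne).imp
      StrictMonoOn.monotoneOn StrictAntiOn.antitoneOn
  obtain ⟨t, ht, hft⟩ : ∃ t ∈ Set.Icc u v, ∀ s ∈ Set.Icc u v, |f s - f t| ≤ |f s| :=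
    hmono.elim (MonotoneOn.exists_abs_sub_le_abs huv.le hf)
      (AntitoneOn.exists_abs_sub_le_abs huv.le hf)
  have hexp : ∀ x y, u ≤ x → x < y → y ≤ v → c * |y - x| ^ (β + 1) ≤ |f y - f x| := by
    intro x y hx hxy hy
    have h := le_abs_sub_of_rpow_le_abs_hasDerivAt (sqrt_nonneg A) hβ0.le hf hd hmono hlow' hx hxy hy
    rw [abs_of_pos (sub_pos.2 hxy), hc, mul_assoc, ← mul_rpow (by norm_num) (by linarith)]
    convert h using 3
    ring
  have hfs : ∀ s ∈ Set.Icc u v, s ≠ t → c * |s - t| ^ (β + 1) ≤ |f s| := by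
    intro s hs hst
    refine le_trans ?_ (hft s hs)
    rcases lt_or_gt_of_ne hst with h | h
    · rw [abs_sub_comm s, abs_sub_comm (f s)]
      exact hexp s t hs.1 h ht.2
    · exact hexp t s ht.1 h hs.2
  have hpt : ∀ s ∈ Set.Icc u v, s ≠ t →
      |f s| ^ (-(1 / γ)) ≤ c ^ (-(1 / γ)) * |s - t| ^ r := by
    intro s hs hst
    have hpos : 0 < |s - t| := abs_pos.2 (sub_ne_zero.2 hst)
    rw [hr, rpow_mul hpos.le, ← mul_rpow hc0.le (by positivity)]
    exact rpow_le_rpow_of_nonpos (by positivity) (hfs s hs hst)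
      (neg_nonpos.2 (by positivity))
  calc ∫⁻ s in Set.Icc u v, ENNReal.ofReal (|f s| ^ (-(1 / γ)))
      ≤ ∫⁻ s in Set.Icc u v, ENNReal.ofReal (c ^ (-(1 / γ))) * ENNReal.ofReal (|s - t| ^ r) := by
        refine lintegral_mono_ae ?_
        filter_upwards [ae_restrict_mem measurableSet_Icc,
          ae_restrict_of_ae (Measure.ae_ne volume t)] with s hs hst
        rw [← ENNReal.ofReal_mul (by positivity)]
        exact ENNReal.ofReal_le_ofReal (hpt s hs hst)
    _ = ENNReal.ofReal (c ^ (-(1 / γ))) *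
          ∫⁻ s in Set.Icc u v, ENNReal.ofReal (|s - t| ^ r) :=
        lintegral_const_mul' _ _ ENNReal.ofReal_ne_top
    _ ≤ ENNReal.ofReal (c ^ (-(1 / γ))) * K := by
        gcongr
        exact (lintegral_mono_set hsub).trans (lintegral_abs_sub_rpow_le r (hsub ht))
    _ = ENNReal.ofReal (c ^ (-(1 / γ)) * K.toReal) := by
        rw [ENNReal.ofReal_mul (by positivity), ENNReal.ofReal_toReal hKfin]
    _ ≤ ENNReal.ofReal (c ^ (-(1 / γ)) * K.toReal + 1) :=
        ENNReal.ofReal_le_ofReal (by linarith)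
end

section
/- Let θ₁ < θ₂ be real numbers, let f : [θ₁,θ₂] → ℝ be twice continuously differentiable, let γ > 1, and let I ⊆ [θ₁,θ₂] be a closed interval. Suppose that for positive constants A and α with α < 2γ − 3 one of the following holds: |f'(s) f''(s)| ≥ A (s − θ₁)^α for all s ∈ I, or |f'(s) f''(s)| ≥ A (θ₂ − s)^α for all s ∈ I. Then there exists a constant C > 0 depending only on A, α, θ₁, θ₂ and γ (in particular, not on f or I) such that ∫_I |f(s)|^{−1/γ} ds ≤ C. -/
open MeasureTheory Real

/-- A continuous function on a compact interval whose derivative does not vanish in the interior is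
strictly monotone or strictly antitone. -/
theorem strictMonoOn_or_strictAntiOn_of_hasDerivAt_ne_zero_s9 {F F' : ℝ → ℝ} {a b : ℝ} (hab : a ≤ b)
    (hc : ContinuousOn F (Set.Icc a b)) (hd : ∀ x ∈ Set.Ioo a b, HasDerivAt F (F' x) x)
    (hne : ∀ x ∈ Set.Ioo a b, F' x ≠ 0) :
    StrictMonoOn F (Set.Icc a b) ∨ StrictAntiOn F (Set.Icc a b) := by
  refine hc.strictMonoOn_of_injOn_Icc' hab ?_
  have key : ∀ x ∈ Set.Icc a b, ∀ y ∈ Set.Icc a b, x < y → F x ≠ F y := by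
    intro x hx y hy hxy hF
    obtain ⟨c, hcm, h0⟩ := exists_hasDerivAt_eq_zero hxy (hc.mono (Set.Icc_subset_Icc hx.1 hy.2)) hF
      fun z hz => hd z ⟨hx.1.trans_lt hz.1, hz.2.trans_le hy.2⟩
    exact hne c ⟨hx.1.trans_lt hcm.1, hcm.2.trans_le hy.2⟩ h0
  intro x hx y hy hF
  by_contra hxy
  rcases lt_or_gt_of_ne hxy with h | h
  · exact key x hx y hy h hF
  · exact key y hy x hx h hF.symm

/-- If a function has nonvanishing derivative, a lower bound for the size of the derivative on a
subinterval bounds from below the increment over the whole interval. -/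
theorem mul_sub_le_abs_sub_of_le_abs_deriv {F F' : ℝ → ℝ} {a b c d m : ℝ} (hac : a ≤ c)
    (hcd : c < d) (hdb : d ≤ b)
    (hc : ContinuousOn F (Set.Icc a b)) (hd : ∀ x ∈ Set.Ioo a b, HasDerivAt F (F' x) x)
    (hne : ∀ x ∈ Set.Ioo a b, F' x ≠ 0) (hm : ∀ x ∈ Set.Ioo c d, m ≤ |F' x|) :
    m * (d - c) ≤ |F b - F a| := by
  have hab : a ≤ b := hac.trans (hcd.le.trans hdb)
  have hmem : a ∈ Set.Icc a b ∧ b ∈ Set.Icc a b ∧ c ∈ Set.Icc a b ∧ d ∈ Set.Icc a b :=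
    ⟨⟨le_rfl, hab⟩, ⟨hab, le_rfl⟩, ⟨hac, hcd.le.trans hdb⟩, ⟨hac.trans hcd.le, hdb⟩⟩
  obtain ⟨ha, hb, hc', hd'⟩ := hmem
  obtain ⟨ξ, hξ, hs⟩ := exists_hasDerivAt_eq_slope F F' hcd (hc.mono (Set.Icc_subset_Icc hac hdb))
    fun z hz => hd z ⟨hac.trans_lt hz.1, hz.2.trans_le hdb⟩
  have hpos : 0 < d - c := sub_pos.2 hcd
  have h1 : m * (d - c) ≤ |F d - F c| := by
    have := hm ξ hξ
    rwa [hs, abs_div, abs_of_pos hpos, le_div_iff₀ hpos] at this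
  refine h1.trans ?_
  rcases strictMonoOn_or_strictAntiOn_of_hasDerivAt_ne_zero_s9 hab hc hd hne with h | h
  · have e1 := h.monotoneOn ha hc' hac
    have e2 := h.monotoneOn hd' hb hdb
    have e3 := h.monotoneOn hc' hd' hcd.le
    rw [abs_of_nonneg (by linarith), abs_of_nonneg (by linarith)]
    linarith
  · have e1 := h.antitoneOn ha hc' hac
    have e2 := h.antitoneOn hd' hb hdb
    have e3 := h.antitoneOn hc' hd' hcd.le
    rw [abs_of_nonpos (by linarith), abs_of_nonpos (by linarith)]
    linarith

/-- A power-type lower bound for `|f' f''|` on half of each subinterval yields a power-type lower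
bound for the increments of `f`. -/
theorem mul_rpow_le_abs_sub {f f' f'' : ℝ → ℝ} {u v A α : ℝ} (hA : 0 < A) (hα : 0 < α)
    (hfc : ContinuousOn f (Set.Icc u v)) (hfc' : ContinuousOn f' (Set.Icc u v))
    (hfd : ∀ s ∈ Set.Ioo u v, HasDerivAt f (f' s) s)
    (hfd' : ∀ s ∈ Set.Ioo u v, HasDerivAt f' (f'' s) s)
    (hne : ∀ s ∈ Set.Ioo u v, f' s * f'' s ≠ 0)
    (hlow : ∀ x ∈ Set.Icc u v, ∀ y ∈ Set.Icc u v, x < y → ∃ c d, x ≤ c ∧ d ≤ y ∧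
      d - c = (y - x) / 2 ∧ ∀ s ∈ Set.Ioo c d, A * ((y - x) / 2) ^ α ≤ |f' s * f'' s|)
    {s t : ℝ} (hs : s ∈ Set.Icc u v) (ht : t ∈ Set.Icc u v) (hst : s < t) :
    √(2 * A * (1 / 4) ^ (α + 1)) / 2 * (t - s) ^ ((α + 3) / 2) ≤ |f t - f s| := by
  have huv : u ≤ v := hs.1.trans hs.2
  have hgc : ContinuousOn (fun x => f' x ^ 2) (Set.Icc u v) := hfc'.pow 2
  have hgd : ∀ x ∈ Set.Ioo u v, HasDerivAt (fun x => f' x ^ 2) (2 * (f' x * f'' x)) x := by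
    intro x hx
    have := (hfd' x hx).fun_pow 2
    refine this.congr_deriv ?_
    norm_num
    ring
  have hgne : ∀ x ∈ Set.Ioo u v, 2 * (f' x * f'' x) ≠ 0 := fun x hx =>
    mul_ne_zero two_ne_zero (hne x hx)
  have hg : ∀ x ∈ Set.Icc u v, ∀ y ∈ Set.Icc u v, x < y →
      2 * A * ((y - x) / 2) ^ (α + 1) ≤ |f' y ^ 2 - f' x ^ 2| := by
    intro x hx y hy hxy
    obtain ⟨c, d, hxc, hdy, hcd, hb⟩ := hlow x hx y hy hxy
    have hsub : Set.Ioo x y ⊆ Set.Ioo u v := Set.Ioo_subset_Ioo hx.1 hy.2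
    have := mul_sub_le_abs_sub_of_le_abs_deriv (m := 2 * (A * ((y - x) / 2) ^ α)) hxc
      (by linarith) hdy (hgc.mono (Set.Icc_subset_Icc hx.1 hy.2)) (fun z hz => hgd z (hsub hz))
      (fun z hz => hgne z (hsub hz)) (fun z hz => by
        rw [abs_mul, abs_two]; linarith [hb z hz])
    rw [hcd] at this
    rw [rpow_add_one (by linarith : (y - x) / 2 ≠ 0)]
    linarith
  -- the derivative is large on one half of the interval
  obtain ⟨c, d, hsc, hdt, hcd, hb⟩ : ∃ c d, s ≤ c ∧ d ≤ t ∧ d - c = (t - s) / 2 ∧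
      ∀ z ∈ Set.Ioo c d, 2 * A * ((t - s) / 4) ^ (α + 1) ≤ f' z ^ 2 := by
    have hpow : ∀ w, (t - s) / 4 ≤ w → 2 * A * ((t - s) / 4) ^ (α + 1) ≤ 2 * A * w ^ (α + 1) :=
      fun w hw => by
        have : 0 ≤ (t - s) / 4 := by linarith
        gcongr
    rcases strictMonoOn_or_strictAntiOn_of_hasDerivAt_ne_zero_s9 huv hgc hgd hgne with h | h
    · refine ⟨(s + t) / 2, t, by linarith, le_rfl, by ring, fun z hz => ?_⟩
      have hz' : s < z := by linarith [hz.1]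
      have hzm : z ∈ Set.Icc u v := ⟨hs.1.trans hz'.le, hz.2.le.trans ht.2⟩
      have e1 := hg s hs z hzm hz'
      have e2 : f' s ^ 2 < f' z ^ 2 := h hs hzm hz'
      rw [abs_of_pos (by linarith)] at e1
      have := hpow ((z - s) / 2) (by linarith [hz.1])
      nlinarith [sq_nonneg (f' s)]
    · refine ⟨s, (s + t) / 2, le_rfl, by linarith, by ring, fun z hz => ?_⟩
      have hz' : z < t := by linarith [hz.2]
      have hzm : z ∈ Set.Icc u v := ⟨hs.1.trans hz.1.le, hz'.le.trans ht.2⟩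
      have e1 := hg z hzm t ht hz'
      have e2 : f' t ^ 2 < f' z ^ 2 := h hzm ht hz'
      rw [abs_of_neg (by linarith)] at e1
      have := hpow ((t - z) / 2) (by linarith [hz.2])
      nlinarith [sq_nonneg (f' t)]
  have hsub : Set.Ioo s t ⊆ Set.Ioo u v := Set.Ioo_subset_Ioo hs.1 ht.2
  have := mul_sub_le_abs_sub_of_le_abs_deriv (m := √(2 * A * ((t - s) / 4) ^ (α + 1))) hsc
    (by linarith) hdt (hfc.mono (Set.Icc_subset_Icc hs.1 ht.2)) (fun z hz => hfd z (hsub hz))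
    (fun z hz => left_ne_zero_of_mul (hne z (hsub hz)))
    (fun z hz => by
      rw [← sqrt_sq_eq_abs]
      exact sqrt_le_sqrt (hb z hz))
  refine le_of_eq_of_le ?_ this
  have hpos : 0 < t - s := sub_pos.2 hst
  rw [hcd, div_eq_mul_one_div (t - s) 4, mul_rpow hpos.le (by norm_num),
    mul_comm ((t - s) ^ (α + 1)), ← mul_assoc,
    sqrt_mul (by positivity : 0 ≤ 2 * A * (1 / 4) ^ (α + 1)) ((t - s) ^ (α + 1)),
    sqrt_eq_rpow ((t - s) ^ (α + 1)), ← rpow_mul hpos.le,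
    show (α + 3) / 2 = (α + 1) * (1 / 2) + 1 by ring, rpow_add_one hpos.ne']
  ring

/-- If `|f s - f t| ≥ c |s - t| ^ β` on an interval, then `∫ |f| ^ (-q)` over it is bounded by the
integral of a fixed power function. -/
theorem lintegral_abs_rpow_neg_le {f : ℝ → ℝ} {u v c β q L : ℝ} (hc : 0 < c) (hq : 0 < q)
    (hL : v - u < L) (hfc : ContinuousOn f (Set.Icc u v))
    (hf : ∀ s ∈ Set.Icc u v, ∀ t ∈ Set.Icc u v, s < t → c * (t - s) ^ β ≤ |f t - f s|) :
    ∫⁻ s in Set.Icc u v, ENNReal.ofReal (|f s| ^ (-q)) ≤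
      ∫⁻ s in Metric.ball 0 L, ENNReal.ofReal ((c / 2) ^ (-q) * |s| ^ (-(β * q))) := by
  rcases lt_or_ge v u with huv | huv
  · simp [Set.Icc_eq_empty_of_lt huv]
  obtain ⟨p, hp, hmin⟩ := isCompact_Icc.exists_isMinOn (Set.nonempty_Icc.2 huv) hfc.abs
  set G : ℝ → ENNReal := (Metric.ball 0 L).indicator
    fun s => ENNReal.ofReal ((c / 2) ^ (-q) * |s| ^ (-(β * q))) with hG
  have hbound : ∀ s ∈ Set.Icc u v, s ≠ p → ENNReal.ofReal (|f s| ^ (-q)) ≤ G (s - p) := by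
    intro s hs hsp
    have hmem : s - p ∈ Metric.ball (0 : ℝ) L := by
      rw [mem_ball_zero_iff, norm_eq_abs, abs_lt]
      constructor <;> linarith [hs.1, hs.2, hp.1, hp.2]
    have h1 : c * |s - p| ^ β ≤ |f s - f p| := by
      rcases lt_or_gt_of_ne hsp with h | h
      · rw [abs_sub_comm s, abs_sub_comm (f s), abs_of_pos (sub_pos.2 h)]
        exact hf s hs p hp h
      · rw [abs_of_pos (sub_pos.2 h)]
        exact hf p hp s hs h
    have h2 : |f p| ≤ |f s| := hmin hs
    have h3 : c / 2 * |s - p| ^ β ≤ |f s| := by linarith [abs_sub (f s) (f p)]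
    have hpos : 0 < |s - p| := abs_pos.2 (sub_ne_zero.2 hsp)
    rw [hG, Set.indicator_of_mem hmem]
    apply ENNReal.ofReal_le_ofReal
    calc |f s| ^ (-q) ≤ (c / 2 * |s - p| ^ β) ^ (-q) :=
          rpow_le_rpow_of_nonpos (by positivity) h3 (by linarith)
      _ = _ := by
          rw [mul_rpow (by positivity) (by positivity), ← rpow_mul hpos.le, mul_neg]
  calc ∫⁻ s in Set.Icc u v, ENNReal.ofReal (|f s| ^ (-q))
      ≤ ∫⁻ s in Set.Icc u v, G (s - p) := by
        refine lintegral_mono_ae ?_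
        filter_upwards [ae_restrict_mem measurableSet_Icc,
          ae_restrict_of_ae (Measure.ae_ne volume p)] with s hs hsp using hbound s hs hsp
    _ ≤ ∫⁻ s, G (s - p) := setLIntegral_le_lintegral _ _
    _ = ∫⁻ s, G s := lintegral_sub_right_eq_self G p
    _ = _ := lintegral_indicator Metric.isOpen_ball.measurableSet _

/-- The power function `|s| ^ (-κ)` with `κ < 1` has finite integral near the origin. -/
theorem lintegral_ball_const_mul_abs_rpow_lt_top {K κ L : ℝ} (hK : 0 ≤ K) (hκ : κ < 1) :
    ∫⁻ s in Metric.ball 0 L, ENNReal.ofReal (K * |s| ^ (-κ)) < ⊤ := by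
  have h : IntegrableOn (fun s : ℝ => K * |s| ^ (-κ)) (Metric.ball 0 L) := by
    refine integrableOn_ball_of_norm_le_rpow (C := K) (α := κ) (by simp) (by simpa using hκ) ?_
      (by fun_prop : Measurable fun s : ℝ => K * |s| ^ (-κ)).aestronglyMeasurable
    refine Filter.Eventually.of_forall fun s => ?_
    rw [norm_of_nonneg (by positivity), norm_eq_abs]
  exact h.lintegral_lt_top

/-- If `|f' f''| ≥ A(s−θ₁)^α` or `|f' f''| ≥ A(θ₂−s)^α` on `I`, with `α < 2γ−3`, then `∫_I |f|^{−1/γ} ≤ C` with `C = C(A,α,θ₁,θ₂,γ)`. -/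
theorem stmt_9 (θ₁ θ₂ A α γ : ℝ) (hθ : θ₁ < θ₂) (hA : 0 < A) (hα : 0 < α)
    (hγ : 1 < γ) (hαγ : α < 2 * γ - 3) :
    ∃ C : ℝ, 0 < C ∧ ∀ (f f' f'' : ℝ → ℝ) (u v : ℝ),
      Set.Icc u v ⊆ Set.Icc θ₁ θ₂ →
      (hder : ∀ s ∈ Set.Icc θ₁ θ₂, HasDerivWithinAt f (f' s) (Set.Icc θ₁ θ₂) s) →
      (∀ s ∈ Set.Icc θ₁ θ₂, HasDerivWithinAt f' (f'' s) (Set.Icc θ₁ θ₂) s) →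
      ContinuousOn f' (Set.Icc θ₁ θ₂) → ContinuousOn f'' (Set.Icc θ₁ θ₂) →
      ((∀ s ∈ Set.Icc u v, A * (s - θ₁) ^ α ≤ |f' s * f'' s|) ∨
        (∀ s ∈ Set.Icc u v, A * (θ₂ - s) ^ α ≤ |f' s * f'' s|)) →
      ∫⁻ s in Set.Icc u v, ENNReal.ofReal (|f s| ^ (-(1 / γ))) ≤ ENNReal.ofReal C := by
  set c := √(2 * A * (1 / 4) ^ (α + 1)) / 2 with hc
  have hcpos : 0 < c := by positivity
  have hγ0 : 0 < γ := by linarith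
  have hfin : ∫⁻ s in Metric.ball 0 (θ₂ - θ₁ + 1), ENNReal.ofReal
      ((c / 2) ^ (-(1 / γ)) * |s| ^ (-((α + 3) / 2 * (1 / γ)))) < ⊤ := by
    refine lintegral_ball_const_mul_abs_rpow_lt_top (by positivity) ?_
    rw [mul_one_div, div_lt_one hγ0]
    linarith
  refine ⟨(∫⁻ s in Metric.ball 0 (θ₂ - θ₁ + 1), ENNReal.ofReal
      ((c / 2) ^ (-(1 / γ)) * |s| ^ (-((α + 3) / 2 * (1 / γ))))).toReal + 1, by positivity, ?_⟩
  intro f f' f'' u v hI hder hder' hc' _ hlow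
  rcases lt_or_ge v u with huv | huv
  · simp [Set.Icc_eq_empty_of_lt huv]
  have hu : θ₁ ≤ u := (hI (Set.left_mem_Icc.2 huv)).1
  have hv : v ≤ θ₂ := (hI (Set.right_mem_Icc.2 huv)).2
  have hfc : ContinuousOn f (Set.Icc u v) :=
    ContinuousOn.mono (fun s hs => (hder s hs).continuousWithinAt) hI
  have hnhds : ∀ s ∈ Set.Ioo u v, Set.Icc θ₁ θ₂ ∈ nhds s := fun s hs =>
    Icc_mem_nhds (hu.trans_lt hs.1) (hs.2.trans_le hv)
  have hpos : ∀ s ∈ Set.Ioo u v, f' s * f'' s ≠ 0 := by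
    intro s hs
    rw [← abs_pos]
    rcases hlow with h | h
    · refine lt_of_lt_of_le ?_ (h s (Set.Ioo_subset_Icc_self hs))
      exact mul_pos hA (rpow_pos_of_pos (by linarith [hs.1]) _)
    · refine lt_of_lt_of_le ?_ (h s (Set.Ioo_subset_Icc_self hs))
      exact mul_pos hA (rpow_pos_of_pos (by linarith [hs.2]) _)
  refine (lintegral_abs_rpow_neg_le (L := θ₂ - θ₁ + 1) hcpos (by positivity) (by linarith) hfc
    (fun s hs t ht hst => mul_rpow_le_abs_sub hA hα hfc (hc'.mono hI)
      (fun z hz => (hder z (hI (Set.Ioo_subset_Icc_self hz))).hasDerivAt (hnhds z hz))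
      (fun z hz => (hder' z (hI (Set.Ioo_subset_Icc_self hz))).hasDerivAt (hnhds z hz))
      hpos ?_ hs ht hst)).trans ?_
  · intro x hx y hy hxy
    rcases hlow with h | h
    · refine ⟨(x + y) / 2, y, by linarith, le_rfl, by ring, fun z hz => ?_⟩
      refine le_trans ?_ (h z ⟨by linarith [hz.1, hx.1], hz.2.le.trans hy.2⟩)
      exact mul_le_mul_of_nonneg_left
        (rpow_le_rpow (by linarith) (by linarith [hz.1, hx.1]) hα.le) hA.le
    · refine ⟨x, (x + y) / 2, le_rfl, by linarith, by ring, fun z hz => ?_⟩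
      refine le_trans ?_ (h z ⟨hx.1.trans hz.1.le, by linarith [hz.2, hy.2]⟩)
      exact mul_le_mul_of_nonneg_left
        (rpow_le_rpow (by linarith) (by linarith [hz.2, hy.2]) hα.le) hA.le
  · rw [← ENNReal.ofReal_toReal hfin.ne]
    refine ENNReal.ofReal_le_ofReal ?_
    rw [ENNReal.toReal_ofReal ENNReal.toReal_nonneg]
    linarith
end

section
/- Let θ₁ < θ₂ be real numbers, let f : [θ₁,θ₂] → ℝ be twice continuously differentiable, let γ > 1, and let I ⊆ [θ₁,θ₂] be a closed interval. Suppose that for positive constants A and α with α < 2γ − 2 one of the following holds: f(s) f''(s) ≥ A (s − θ₁)^α for all s ∈ I, or f(s) f''(s) ≥ A (θ₂ − s)^α for all s ∈ I. Then there exists a constant C > 0 depending only on A, α, θ₁, θ₂ and γ (in particular, not on f or I) such that ∫_I |f(s)|^{−1/γ} ds ≤ C. -/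
open MeasureTheory Real

lemma convexOn_sub_mul_sub_rpow {h h' h'' : ℝ → ℝ} {a b A α : ℝ} (hα : 0 < α)
    (hd : ∀ s ∈ Set.Icc a b, HasDerivWithinAt h (h' s) (Set.Icc a b) s)
    (hd' : ∀ s ∈ Set.Icc a b, HasDerivWithinAt h' (h'' s) (Set.Icc a b) s)
    (hA : ∀ s ∈ Set.Icc a b, A * (s - a) ^ α ≤ h'' s) :
    ConvexOn ℝ (Set.Icc a b) (fun s ↦ h s - A / ((α + 1) * (α + 2)) * (s - a) ^ (α + 2)) ∧
    ∀ s ∈ Set.Icc a b,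
      HasDerivWithinAt (fun s ↦ h s - A / ((α + 1) * (α + 2)) * (s - a) ^ (α + 2))
        (h' s - A / (α + 1) * (s - a) ^ (α + 1)) (Set.Icc a b) s := by
  have key : ∀ s ∈ Set.Icc a b,
      HasDerivWithinAt (fun s ↦ h s - A / ((α + 1) * (α + 2)) * (s - a) ^ (α + 2))
        (h' s - A / (α + 1) * (s - a) ^ (α + 1)) (Set.Icc a b) s := by
    intro s hs
    have h1 := (((hasDerivAt_id s).sub_const a).rpow_const (p := α + 2)
      (Or.inr (by linarith))).const_mul (A / ((α + 1) * (α + 2)))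
    refine ((hd s hs).fun_sub h1.hasDerivWithinAt).congr_deriv ?_
    rw [show α + 2 - 1 = α + 1 by ring]
    simp only [id]
    field_simp
  have key' : ∀ s ∈ Set.Icc a b,
      HasDerivWithinAt (fun s ↦ h' s - A / (α + 1) * (s - a) ^ (α + 1))
        (h'' s - A * (s - a) ^ α) (Set.Icc a b) s := by
    intro s hs
    have h1 := (((hasDerivAt_id s).sub_const a).rpow_const (p := α + 1)
      (Or.inr (by linarith))).const_mul (A / (α + 1))
    refine ((hd' s hs).fun_sub h1.hasDerivWithinAt).congr_deriv ?_
    rw [show α + 1 - 1 = α by ring]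
    simp only [id]
    field_simp
  refine ⟨convexOn_of_hasDerivWithinAt2_nonneg (convex_Icc a b)
    (fun s hs ↦ (key s hs).continuousWithinAt)
    (fun s hs ↦ (key s (interior_subset hs)).mono interior_subset)
    (fun s hs ↦ (key' s (interior_subset hs)).mono interior_subset)
    (fun s hs ↦ sub_nonneg.2 (hA s (interior_subset hs))), key⟩

lemma exists_mul_abs_sub_rpow_le {h h' h'' : ℝ → ℝ} {θ u v A α : ℝ} (hα : 0 < α) (hA : 0 < A)
    (huv : u ≤ v) (hθ : θ ≤ u) (h0 : ∀ s, 0 ≤ h s)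
    (hd : ∀ s ∈ Set.Icc u v, HasDerivWithinAt h (h' s) (Set.Icc u v) s)
    (hd' : ∀ s ∈ Set.Icc u v, HasDerivWithinAt h' (h'' s) (Set.Icc u v) s)
    (hA' : ∀ s ∈ Set.Icc u v, A * (s - θ) ^ α ≤ h'' s) :
    ∃ m ∈ Set.Icc u v, ∀ s ∈ Set.Icc u v,
      A / ((α + 1) * (α + 2)) * |s - m| ^ (α + 2) ≤ h s := by
  obtain ⟨m, hm, hmin⟩ := isCompact_Icc.exists_isMinOn (Set.nonempty_Icc.2 huv)
    (fun s hs ↦ (hd s hs).continuousWithinAt : ContinuousOn h (Set.Icc u v))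
  have hsgn : ∀ s ∈ Set.Icc u v, 0 ≤ (s - m) * h' m := fun s hs ↦ by
    simpa using hmin.localize.hasFDerivWithinAt_nonneg (hd m hm).hasFDerivWithinAt
      (sub_mem_posTangentConeAt_of_segment_subset ((convex_Icc u v).segment_subset hm hs))
  have hconv : ∀ a b, u ≤ a → b ≤ v → _ := fun a b hua hbv ↦
    have hsub : Set.Icc a b ⊆ Set.Icc u v := Set.Icc_subset_Icc hua hbv
    convexOn_sub_mul_sub_rpow (h := h) (h' := h') (h'' := h'') (a := a) (b := b) (A := A) hα
      (fun s hs ↦ (hd s (hsub hs)).mono hsub) (fun s hs ↦ (hd' s (hsub hs)).mono hsub)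
      (fun s hs ↦ le_trans (by
        have := hs.1
        gcongr
        linarith) (hA' s (hsub hs)))
  refine ⟨m, hm, fun s hs ↦ ?_⟩
  rcases lt_trichotomy s m with hsm | rfl | hsm
  · obtain ⟨hc, hk⟩ := hconv s m hs.1 hm.2
    have hslope := hc.slope_le_of_hasDerivWithinAt (Set.left_mem_Icc.2 hsm.le)
      (Set.right_mem_Icc.2 hsm.le) hsm (hk m (Set.right_mem_Icc.2 hsm.le))
    rw [slope_def_field, div_le_iff₀ (by linarith)] at hslope
    have e : (m - s) ^ (α + 2) = (m - s) ^ (α + 1) * (m - s) := by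
      rw [← rpow_add_one (by linarith)]; ring_nf
    have e2 : A / (α + 1) = A / ((α + 1) * (α + 2)) * (α + 2) := by field_simp
    have hP : 0 ≤ A / ((α + 1) * (α + 2)) * (m - s) ^ (α + 2) := by
      have : 0 ≤ m - s := by linarith
      positivity
    have hms := hsgn s hs
    rw [abs_sub_comm, abs_of_pos (by linarith)]
    rw [sub_self, zero_rpow (by linarith), sub_mul, e2, mul_assoc _ _ (m - s), ← e] at hslope
    nlinarith [h0 m, mul_nonneg hα.le hP]
  · simpa [zero_rpow (by linarith : α + 2 ≠ 0)] using h0 s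
  · obtain ⟨hc, hk⟩ := hconv m s hm.1 hs.2
    have hslope := hc.le_slope_of_hasDerivWithinAt (Set.left_mem_Icc.2 hsm.le)
      (Set.right_mem_Icc.2 hsm.le) hsm (hk m (Set.left_mem_Icc.2 hsm.le))
    rw [slope_def_field, le_div_iff₀ (by linarith), sub_self, zero_rpow (by linarith),
      zero_rpow (by linarith)] at hslope
    rw [abs_of_pos (by linarith)]
    nlinarith [h0 m, hsgn s hs]

lemma exists_mul_abs_sub_rpow_le' {h h' h'' : ℝ → ℝ} {θ u v A α : ℝ} (hα : 0 < α) (hA : 0 < A)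
    (huv : u ≤ v) (hθ : v ≤ θ) (h0 : ∀ s, 0 ≤ h s)
    (hd : ∀ s ∈ Set.Icc u v, HasDerivWithinAt h (h' s) (Set.Icc u v) s)
    (hd' : ∀ s ∈ Set.Icc u v, HasDerivWithinAt h' (h'' s) (Set.Icc u v) s)
    (hA' : ∀ s ∈ Set.Icc u v, A * (θ - s) ^ α ≤ h'' s) :
    ∃ m ∈ Set.Icc u v, ∀ s ∈ Set.Icc u v,
      A / ((α + 1) * (α + 2)) * |s - m| ^ (α + 2) ≤ h s := by
  have hneg : ∀ s ∈ Set.Icc (-v) (-u), -s ∈ Set.Icc u v := fun s hs ↦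
    ⟨by linarith [hs.2], by linarith [hs.1]⟩
  have hcomp : ∀ {g g' : ℝ → ℝ},
      (∀ s ∈ Set.Icc u v, HasDerivWithinAt g (g' s) (Set.Icc u v) s) →
      ∀ s ∈ Set.Icc (-v) (-u),
        HasDerivWithinAt (fun s ↦ g (-s)) (-g' (-s)) (Set.Icc (-v) (-u)) s := by
    intro g g' hg s hs
    simpa [Function.comp_def] using
      (hg (-s) (hneg s hs)).comp s (hasDerivAt_neg s).hasDerivWithinAt hneg
  obtain ⟨m, hm, H⟩ := exists_mul_abs_sub_rpow_le (h := fun s ↦ h (-s)) (h' := fun s ↦ -h' (-s))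
    (h'' := fun s ↦ h'' (-s)) (θ := -θ) hα hA (neg_le_neg huv) (neg_le_neg hθ) (fun s ↦ h0 _)
    (hcomp hd) (fun s hs ↦ by simpa using (hcomp hd' s hs).fun_neg)
    (fun s hs ↦ by
      have := hA' (-s) (hneg s hs)
      rwa [show θ - -s = s - -θ by ring] at this)
  refine ⟨-m, hneg m hm, fun s hs ↦ ?_⟩
  have := H (-s) ⟨by linarith [hs.2], by linarith [hs.1]⟩
  rwa [neg_neg, show -s - m = -(s - -m) by ring, abs_neg] at this

lemma integrableOn_abs_rpow {r : ℝ} (hr : -1 < r) (D : ℝ) (hD : 0 ≤ D) :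
    IntegrableOn (fun t : ℝ ↦ |t| ^ r) (Set.Icc (-D) D) := by
  have h1 : IntervalIntegrable (fun t : ℝ ↦ |t| ^ r) volume 0 D :=
    (intervalIntegral.intervalIntegrable_rpow' hr).congr fun t ht ↦ by
      rw [Set.uIoc_of_le hD] at ht
      simp only [abs_of_pos ht.1]
  have h2 : IntervalIntegrable (fun t : ℝ ↦ |t| ^ r) volume (-D) 0 := by
    rw [IntervalIntegrable.iff_comp_neg]
    simpa using h1.symm
  exact (intervalIntegrable_iff_integrableOn_Icc_of_le (by linarith)).1 (h2.trans h1)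

lemma abs_rpow_le_of_mul_rpow_le_sq {x y c p r : ℝ} (hc : 0 < c) (hy : 0 < y) (hr : 0 < r)
    (h : c * y ^ p ≤ x ^ 2) :
    |x| ^ (-r) ≤ c ^ (-r / 2) * y ^ (-(p * r / 2)) := by
  have hp : 0 < y ^ p := rpow_pos_of_pos hy p
  have hx : |x| ^ (-r) = (x ^ 2) ^ (-r / 2) := by
    rw [← sq_abs, ← rpow_natCast, ← rpow_mul (abs_nonneg x)]
    congr 1
    push_cast
    ring
  calc |x| ^ (-r) = (x ^ 2) ^ (-r / 2) := hx
    _ ≤ (c * y ^ p) ^ (-r / 2) :=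
      rpow_le_rpow_of_nonpos (by positivity) h (by linarith)
    _ = c ^ (-r / 2) * y ^ (-(p * r / 2)) := by
      rw [mul_rpow hc.le hp.le, ← rpow_mul hy.le]
      congr 2
      ring

/-- If `f f'' ≥ A(s−θ₁)^α` or `f f'' ≥ A(θ₂−s)^α` on `I`, with `α < 2γ−2`, then `∫_I |f|^{−1/γ} ≤ C` with `C = C(A,α,θ₁,θ₂,γ)`. -/
theorem stmt_10 (θ₁ θ₂ A α γ : ℝ) (hθ : θ₁ < θ₂) (hA : 0 < A) (hα : 0 < α)
    (hγ : 1 < γ) (hαγ : α < 2 * γ - 2) :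
    ∃ C : ℝ, 0 < C ∧ ∀ (f f' f'' : ℝ → ℝ) (u v : ℝ),
      Set.Icc u v ⊆ Set.Icc θ₁ θ₂ →
      (hder : ∀ s ∈ Set.Icc θ₁ θ₂, HasDerivWithinAt f (f' s) (Set.Icc θ₁ θ₂) s) →
      (∀ s ∈ Set.Icc θ₁ θ₂, HasDerivWithinAt f' (f'' s) (Set.Icc θ₁ θ₂) s) →
      ContinuousOn f' (Set.Icc θ₁ θ₂) → ContinuousOn f'' (Set.Icc θ₁ θ₂) →
      ((∀ s ∈ Set.Icc u v, A * (s - θ₁) ^ α ≤ f s * f'' s) ∨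
        (∀ s ∈ Set.Icc u v, A * (θ₂ - s) ^ α ≤ f s * f'' s)) →
      ∫⁻ s in Set.Icc u v, ENNReal.ofReal (|f s| ^ (-(1 / γ))) ≤ ENNReal.ofReal C := by
  set c : ℝ := 2 * A / ((α + 1) * (α + 2)) with hc
  have hc0 : 0 < c := by positivity
  set G : ℝ → ℝ := fun t ↦ c ^ (-(1 / γ) / 2) * |t| ^ (-((α + 2) * (1 / γ) / 2)) with hG
  set D : ℝ := θ₂ - θ₁ with hD
  have hr : -1 < -((α + 2) * (1 / γ) / 2) := by
    rw [neg_lt_neg_iff, mul_one_div, div_div, div_lt_one (by linarith)]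
    linarith
  have hfin : ∫⁻ t in Set.Icc (-D) D, ENNReal.ofReal (G t) ≠ ⊤ :=
    ((integrableOn_abs_rpow hr D (by linarith)).const_mul _).lintegral_lt_top.ne
  refine ⟨(∫⁻ t in Set.Icc (-D) D, ENNReal.ofReal (G t)).toReal + 1, by positivity, ?_⟩
  intro f f' f'' u v hI hf hf' _ _ hcase
  refine le_trans ?_ ((ENNReal.ofReal_toReal hfin).ge.trans
    (ENNReal.ofReal_le_ofReal (by linarith)))
  rcases lt_or_ge v u with huv | huv
  · simp [Set.Icc_eq_empty (not_le.2 huv)]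
  have hu := hI (Set.left_mem_Icc.2 huv)
  have hv := hI (Set.right_mem_Icc.2 huv)
  have hd : ∀ s ∈ Set.Icc u v,
      HasDerivWithinAt (fun s ↦ f s ^ 2) (2 * (f s * f' s)) (Set.Icc u v) s := by
    intro s hs
    refine (((hf s (hI hs)).fun_pow 2).mono hI).congr_deriv ?_
    push_cast
    ring
  have hd' : ∀ s ∈ Set.Icc u v, HasDerivWithinAt (fun s ↦ 2 * (f s * f' s))
      (2 * (f' s * f' s + f s * f'' s)) (Set.Icc u v) s := fun s hs ↦
    (((hf s (hI hs)).fun_mul (hf' s (hI hs))).const_mul 2).mono hI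
  obtain ⟨m, hm, hgrow⟩ : ∃ m ∈ Set.Icc u v, ∀ s ∈ Set.Icc u v,
      c * |s - m| ^ (α + 2) ≤ f s ^ 2 := by
    rcases hcase with h | h
    · exact exists_mul_abs_sub_rpow_le hα (by linarith) huv hu.1 (fun s ↦ sq_nonneg _) hd hd'
        fun s hs ↦ by nlinarith [h s hs, mul_self_nonneg (f' s)]
    · exact exists_mul_abs_sub_rpow_le' hα (by linarith) huv hv.2 (fun s ↦ sq_nonneg _) hd hd'
        fun s hs ↦ by nlinarith [h s hs, mul_self_nonneg (f' s)]
  calc ∫⁻ s in Set.Icc u v, ENNReal.ofReal (|f s| ^ (-(1 / γ)))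
      ≤ ∫⁻ s in Set.Icc u v, ENNReal.ofReal (G (s - m)) := by
        refine lintegral_mono_ae ?_
        filter_upwards [ae_restrict_mem measurableSet_Icc,
          ae_restrict_of_ae (Measure.ae_ne volume m)] with s hs hsm
        exact ENNReal.ofReal_le_ofReal (abs_rpow_le_of_mul_rpow_le_sq hc0
          (abs_pos.2 (sub_ne_zero.2 hsm)) (by positivity) (hgrow s hs))
    _ ≤ ∫⁻ s in (fun s ↦ s - m) ⁻¹' Set.Icc (-D) D, ENNReal.ofReal (G (s - m)) := by
        refine lintegral_mono_set fun s hs ↦ ?_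
        have h1 := hI hs
        have h2 := hI hm
        exact ⟨by linarith [h1.1, h2.2], by linarith [h1.2, h2.1]⟩
    _ = ∫⁻ t in Set.Icc (-D) D, ENNReal.ofReal (G t) :=
        (measurePreserving_sub_right volume m).setLIntegral_comp_preimage measurableSet_Icc
          (f := fun t ↦ ENNReal.ofReal (G t)) (by fun_prop)
end
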